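/- Let k be a number field which is not formally real (i.e., −1 is a sum of squares in k) and in which −1 is not a sum of two squares. Then there exists a nonzero b ∈ k such that the three fields k_{-1,-1}, k_{b,-1} and k_{1,1} are pairwise not Witt equivalent; in particular there are at least 3 Witt-inequivalent fields of the form k_{a,b} with a, b ∈ kˣ. -/

import Mathlib

open MvPolynomial

noncomputable section

/-- The defining polynomial `a·x² + b·y² − 1` of the affine conic. -/
def conicPoly (k : Type*) [Field k] (a b : k) : MvPolynomial (Fin 2) k :=
  C a * X 0 ^ 2 + C b * X 1 ^ 2 - 1

/-- The coordinate ring `k[x,y]/(a·x² + b·y² − 1)` of the affine conic. -/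
abbrev ConicRing (k : Type*) [Field k] (a b : k) : Type _ :=
  MvPolynomial (Fin 2) k ⧸ Ideal.span {conicPoly k a b}

/-- `K` (together with the embedding `ι : k →+* K`) is a model of the function field
`k_{a,b}`, i.e. the quotient field of `k[x,y]/(a·x² + b·y² − 1)`. -/
def IsConicFunctionField (k : Type*) [Field k] (a b : k)
    (K : Type*) [Field K] (ι : k →+* K) : Prop :=
  ∃ f : ConicRing k a b →+* K,
    Function.Injective f ∧
    f.comp (algebraMap k (ConicRing k a b)) = ι ∧
    ∀ z : K, ∃ p q : ConicRing k a b, f q ≠ 0 ∧ z = f p / f q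

/-- The subgroup of squares in `Kˣ`. -/
def sqSubgroup (K : Type*) [Field K] : Subgroup Kˣ :=
  MonoidHom.range (powMonoidHom 2 : Kˣ →* Kˣ)

/-- The square class group `Kˣ/Kˣ²`. -/
abbrev SqClass (K : Type*) [Field K] := Kˣ ⧸ sqSubgroup K

/-- The square class of a unit. -/
def sqCl {K : Type*} [Field K] (u : Kˣ) : SqClass K := QuotientGroup.mk u

/-- `α : Kˣ/Kˣ² → Lˣ/Lˣ²` is a Witt equivalence: it sends `-1` to `-1` and preserves
binary value sets. -/
structure IsWittEquiv {K L : Type*} [Field K] [Field L]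
    (α : SqClass K ≃* SqClass L) : Prop where
  map_neg_one : α (sqCl (-1)) = sqCl (-1)
  represents : ∀ (a b c : Kˣ) (a' b' c' : Lˣ),
    α (sqCl a) = sqCl a' → α (sqCl b) = sqCl b' → α (sqCl c) = sqCl c' →
    ((∃ x y : K, (c : K) = (a : K) * x ^ 2 + (b : K) * y ^ 2) ↔
      (∃ x y : L, (c' : L) = (a' : L) * x ^ 2 + (b' : L) * y ^ 2))

/-- Two fields are Witt equivalent if there is a Witt equivalence between them. -/
def WittEquivalent (K L : Type*) [Field K] [Field L] : Prop :=
  ∃ α : SqClass K ≃* SqClass L, IsWittEquiv α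

/-- An ordering of a field `F`. -/
structure IsOrdering {F : Type*} [Field F] (P : Set F) : Prop where
  add_mem : ∀ x ∈ P, ∀ y ∈ P, x + y ∈ P
  mul_mem : ∀ x ∈ P, ∀ y ∈ P, x * y ∈ P
  total : ∀ x : F, x ∈ P ∨ -x ∈ P
  antisymm : ∀ x : F, x ∈ P → -x ∈ P → x = 0

universe u

/-- The function fields `k_{a,b}` and `k_{c,d}` are *not* Witt equivalent:
no model of `k_{a,b}` is Witt equivalent to a model of `k_{c,d}`. -/
def ConicNotWittEquivalent (k : Type u) [Field k] (a b c d : k) : Prop :=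
  ∀ (K L : Type u) [Field K] [Field L] (ι : k →+* K) (ι' : k →+* L),
    IsConicFunctionField k a b K ι → IsConicFunctionField k c d L ι' →
    ¬ WittEquivalent K L

set_option linter.unusedSectionVars false

open IsDedekindDomain NumberField Module WithZero

open Module in
theorem index_range_nsmul_prod (M T : Type*) [AddCommGroup M] [AddCommGroup T] [Module.Free ℤ M]
    [Module.Finite ℤ M] [Finite T] (n : ℕ) (hn : n ≠ 0) :
    (nsmulAddMonoidHom (α := M × T) n).range.index =
      n ^ finrank ℤ M * Nat.card (nsmulAddMonoidHom (α := M × T) n).ker := by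
  have h1 : (nsmulAddMonoidHom (α := M × T) n).range =
      (nsmulAddMonoidHom (α := M) n).range.prod (nsmulAddMonoidHom (α := T) n).range := by
    ext ⟨x, y⟩
    simp [AddSubgroup.mem_prod, AddMonoidHom.mem_range, Prod.ext_iff]
  rw [h1, AddSubgroup.index_prod, AddSubgroup.index_range_nsmul, AddSubgroup.index_range]
  congr 1
  refine Nat.card_congr ⟨fun x => ⟨(0, x.1), ?_⟩, fun x => ⟨x.1.2, ?_⟩, fun x => ?_, fun x => ?_⟩
  · have := x.2
    rw [AddMonoidHom.mem_ker, nsmulAddMonoidHom_apply] at this ⊢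
    simp [this]
  · have := x.2
    simp only [AddMonoidHom.mem_ker, nsmulAddMonoidHom_apply, Prod.smul_def, Prod.mk_eq_zero] at this ⊢
    exact this.2
  · rfl
  · obtain ⟨⟨x, y⟩, h⟩ := x
    simp only [AddMonoidHom.mem_ker, nsmulAddMonoidHom_apply, Prod.smul_def, Prod.mk_eq_zero] at h
    have : x = 0 := by
      have := h.1
      rw [← natCast_zsmul] at this
      exact (smul_eq_zero.mp this).resolve_left (by exact_mod_cast hn)
    simp [this]

open Module in
theorem index_range_nsmul_eq (M : Type*) [AddCommGroup M] [Module.Finite ℤ M] (n : ℕ)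
    (hn : n ≠ 0) :
    (nsmulAddMonoidHom (α := M) n).range.index =
      n ^ finrank ℤ M * Nat.card (nsmulAddMonoidHom (α := M) n).ker := by
  have : AddGroup.FG M := Module.Finite.iff_addGroup_fg.mp inferInstance
  obtain ⟨r, ι, _, p, hp, e, ⟨f⟩⟩ := AddCommGroup.equiv_free_prod_directSum_zmod M
  have : ∀ i, NeZero (p i ^ e i) := fun i => ⟨pow_ne_zero _ (hp i).ne_zero⟩
  let T := (i : ι) → ZMod (p i ^ e i)
  have : Finite T := by unfold T; infer_instance
  classical
  let g : M ≃+ (Fin r →₀ ℤ) × T :=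
    f.trans (AddEquiv.prodCongr (AddEquiv.refl _) (DirectSum.addEquivProd _))
  have key := index_range_nsmul_prod (Fin r →₀ ℤ) T n hn
  have hr : finrank ℤ M = finrank ℤ (Fin r →₀ ℤ) := by
    rw [LinearEquiv.finrank_eq g.toIntLinearEquiv]
    have hT : finrank ℤ T = 0 := by
      rw [Module.finrank_eq_zero_iff_isTorsion]
      intro x
      refine ⟨⟨(Nat.card T : ℤ), mem_nonZeroDivisors_of_ne_zero (by exact_mod_cast Nat.card_pos.ne')⟩, ?_⟩
      change (Nat.card T : ℤ) • x = 0
      rw [natCast_zsmul, card_nsmul_eq_zero']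
    have := Submodule.finrank_quotient_add_finrank (LinearMap.ker (LinearMap.fst ℤ (Fin r →₀ ℤ) T))
    rw [← this, (LinearMap.quotKerEquivOfSurjective (LinearMap.fst ℤ (Fin r →₀ ℤ) T)
      LinearMap.fst_surjective).finrank_eq]
    have h0 : finrank ℤ (LinearMap.ker (LinearMap.fst ℤ (Fin r →₀ ℤ) T)) = 0 := by
      have e2 : T ≃ₗ[ℤ] LinearMap.ker (LinearMap.fst ℤ (Fin r →₀ ℤ) T) := by
        rw [LinearMap.ker_fst]
        exact LinearEquiv.ofInjective _ LinearMap.inr_injective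
      rw [← e2.finrank_eq, hT]
    omega
  have h1 : (nsmulAddMonoidHom (α := M) n).range.index =
      (nsmulAddMonoidHom (α := (Fin r →₀ ℤ) × T) n).range.index := by
    simpa [AddEquiv.map_range_nsmulAddMonoidHom]
        using (AddSubgroup.index_map_equiv (nsmulAddMonoidHom (α := M) n).range g).symm
  have h2 : Nat.card (nsmulAddMonoidHom (α := M) n).ker =
      Nat.card (nsmulAddMonoidHom (α := (Fin r →₀ ℤ) × T) n).ker := by
    refine Nat.card_congr (g.toEquiv.subtypeEquiv fun x => ?_)
    simp only [AddMonoidHom.mem_ker, nsmulAddMonoidHom_apply]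
    rw [← map_eq_zero_iff g g.injective, map_nsmul]
    rfl
  rw [h1, h2, hr, key]

section Vord

variable {R : Type*} [CommRing R] [IsDedekindDomain R] {K : Type*} [Field K] [Algebra R K]
  [IsFractionRing R K]

/-- The additive integer-valued order of `x` at `v` (with `vord v 0 = 0`). -/
def vord (v : HeightOneSpectrum R) (x : K) : ℤ := -(log (v.valuation K x))

variable (v : HeightOneSpectrum R)

theorem valuation_eq_exp_vord {x : K} (hx : x ≠ 0) : v.valuation K x = exp (-(vord v x)) := by
  have : v.valuation K x ≠ 0 := (Valuation.ne_zero_iff _).2 hx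
  simp [vord, exp_log this]

@[simp] theorem vord_zero : vord v (0 : K) = 0 := by simp [vord]
@[simp] theorem vord_one : vord v (1 : K) = 0 := by simp [vord]

theorem vord_mul {x y : K} (hx : x ≠ 0) (hy : y ≠ 0) : vord v (x * y) = vord v x + vord v y := by
  simp only [vord, map_mul]
  rw [log_mul ((Valuation.ne_zero_iff _).2 hx) ((Valuation.ne_zero_iff _).2 hy)]; ring

@[simp] theorem vord_neg (x : K) : vord v (-x) = vord v x := by simp [vord, Valuation.map_neg]

@[simp] theorem vord_inv (x : K) : vord v x⁻¹ = -vord v x := by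
  simp [vord, map_inv₀, log_inv]

theorem vord_div {x y : K} (hx : x ≠ 0) (hy : y ≠ 0) : vord v (x / y) = vord v x - vord v y := by
  rw [div_eq_mul_inv, vord_mul v hx (inv_ne_zero hy), vord_inv]; ring

@[simp] theorem vord_pow (x : K) (n : ℕ) : vord v (x ^ n) = n * vord v x := by
  simp [vord, map_pow, log_pow]

theorem vord_eq_iff {x : K} (hx : x ≠ 0) (n : ℤ) :
    vord v x = n ↔ v.valuation K x = exp (-n) := by
  rw [valuation_eq_exp_vord v hx, exp_inj, neg_inj]

theorem vord_eq_zero_iff {x : K} (hx : x ≠ 0) : vord v x = 0 ↔ v.valuation K x = 1 := by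
  rw [vord_eq_iff v hx, neg_zero, exp_zero]

theorem le_vord_iff {x : K} (hx : x ≠ 0) (n : ℤ) :
    n ≤ vord v x ↔ v.valuation K x ≤ exp (-n) := by
  rw [valuation_eq_exp_vord v hx, exp_le_exp, neg_le_neg_iff]

theorem vord_nonneg (x : R) : 0 ≤ vord v (algebraMap R K x) := by
  by_cases hx : algebraMap R K x = 0
  · simp [hx]
  · rw [le_vord_iff v hx]; simpa using v.valuation_le_one x

theorem le_vord_iff_mem {x : R} (hx : x ≠ 0) (n : ℕ) :
    (n : ℤ) ≤ vord v (algebraMap R K x) ↔ x ∈ v.asIdeal ^ n := by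
  rw [le_vord_iff v (by simpa using hx), HeightOneSpectrum.valuation_of_algebraMap,
    HeightOneSpectrum.intValuation_le_pow_iff_mem]

theorem vord_pos_iff_mem {x : R} (hx : x ≠ 0) :
    0 < vord v (algebraMap R K x) ↔ x ∈ v.asIdeal := by
  have := le_vord_iff_mem (K := K) v hx 1
  rw [pow_one] at this
  rw [← this]; push_cast; omega

theorem vord_eq_zero_iff_notMem {x : R} (hx : x ≠ 0) :
    vord v (algebraMap R K x) = 0 ↔ x ∉ v.asIdeal := by
  rw [← vord_pos_iff_mem (K := K) v hx]
  have := vord_nonneg (K := K) v x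
  omega

theorem le_vord_add {x y : K} (hxy : x + y ≠ 0) (n : ℤ) (hx : x = 0 ∨ n ≤ vord v x)
    (hy : y = 0 ∨ n ≤ vord v y) : n ≤ vord v (x + y) := by
  have h : ∀ z : K, z = 0 ∨ n ≤ vord v z → v.valuation K z ≤ exp (-n) := by
    rintro z (rfl | hz)
    · simp
    · by_cases h0 : z = 0
      · simp [h0]
      · exact (le_vord_iff v h0 n).1 hz
  rw [le_vord_iff v hxy]
  exact Valuation.map_add_le _ (h x hx) (h y hy)

theorem vord_add_eq_left {x y : K} (hx : x ≠ 0) (hy : y = 0 ∨ vord v x < vord v y) :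
    x + y ≠ 0 ∧ vord v (x + y) = vord v x := by
  rcases hy with rfl | hy
  · simp [hx]
  by_cases h0 : y = 0
  · simp [h0, hx]
  have h1 : v.valuation K y < v.valuation K x := by
    rw [valuation_eq_exp_vord v hx, valuation_eq_exp_vord v h0, exp_lt_exp]; omega
  have h2 := Valuation.map_add_eq_of_lt_left _ h1
  have h3 : x + y ≠ 0 := by
    rw [← Valuation.ne_zero_iff (v.valuation K), h2]
    exact (Valuation.ne_zero_iff _).2 hx
  exact ⟨h3, by simp only [vord, h2]⟩

theorem exists_integer_of_vord_nonneg {x : K} (h : ∀ v : HeightOneSpectrum R, 0 ≤ vord v x) :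
    ∃ r : R, algebraMap R K r = x := by
  by_cases hx : x = 0
  · exact ⟨0, by simp [hx]⟩
  · refine HeightOneSpectrum.mem_integers_of_valuation_le_one K x fun v => ?_
    simpa using (le_vord_iff v hx 0).1 (h v)

theorem exists_vord_eq_one : ∃ x : R, x ≠ 0 ∧ vord v (algebraMap R K x) = 1 := by
  obtain ⟨x, hx⟩ := v.intValuation_exists_uniformizer
  have h0 : x ≠ 0 := by
    rintro rfl; rw [map_zero] at hx; exact exp_ne_zero hx.symm
  refine ⟨x, h0, ?_⟩
  rw [vord_eq_iff v (by simpa using h0), HeightOneSpectrum.valuation_of_algebraMap, hx]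

theorem finite_vord_ne_zero {x : K} (hx : x ≠ 0) :
    {v : HeightOneSpectrum R | vord v x ≠ 0}.Finite := by
  obtain ⟨a, b, hb, rfl⟩ := IsFractionRing.div_surjective (A := R) x
  have hb0 : b ≠ 0 := nonZeroDivisors.ne_zero hb
  have ha0 : a ≠ 0 := by rintro rfl; simp at hx
  have key : ∀ r : R, r ≠ 0 → {v : HeightOneSpectrum R | vord v (algebraMap R K r) ≠ 0}.Finite := by
    intro r hr
    refine (Ideal.finite_factors (I := Ideal.span {r}) (by simpa using hr)).subset fun v hv => ?_
    simp only [Set.mem_ofPred_eq, ne_eq, vord_eq_zero_iff_notMem v hr, not_not] at hv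
    simpa [Ideal.dvd_span_singleton] using hv
  refine ((key a ha0).union (key b hb0)).subset fun v hv => ?_
  by_contra h
  simp only [Set.mem_union, Set.mem_ofPred_eq, ne_eq, not_or, not_not] at h
  apply hv
  rw [vord_div v (by simpa using ha0) (by simpa using hb0), h.1, h.2, sub_zero]

theorem vord_of_span_eq_pow {n : ℕ} {x : R} (hx : Ideal.span {x} = v.asIdeal ^ n) :
    x ≠ 0 ∧ vord v (algebraMap R K x) = n ∧
      ∀ w : HeightOneSpectrum R, w ≠ v → vord w (algebraMap R K x) = 0 := by
  have hx0 : x ≠ 0 := by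
    rintro rfl
    exact pow_ne_zero n v.ne_bot (by rw [← hx]; simp)
  refine ⟨hx0, le_antisymm ?_ ?_, fun w hw => ?_⟩
  · by_contra! hlt
    have : x ∈ v.asIdeal ^ (n + 1) := by
      rw [← le_vord_iff_mem (K := K) v hx0]; push_cast; omega
    have h1 : v.asIdeal ^ n ≤ v.asIdeal ^ (n + 1) := by
      rwa [← hx, Ideal.span_singleton_le_iff_mem]
    exact absurd (Ideal.pow_right_strictAnti v.asIdeal v.ne_bot v.isPrime.ne_top
      (Nat.lt_succ_self n)) (not_lt_of_ge h1)
  · rw [le_vord_iff_mem v hx0, ← hx]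
    exact Ideal.mem_span_singleton_self x
  · rw [vord_eq_zero_iff_notMem w hx0]
    intro hmem
    have h1 : v.asIdeal ^ n ≤ w.asIdeal := by
      rw [← hx, Ideal.span_singleton_le_iff_mem]; exact hmem
    have h2 := w.isPrime.le_of_pow_le h1
    exact hw (HeightOneSpectrum.ext ((v.isMaximal.eq_of_le w.isPrime.ne_top h2).symm))

/-- The order at `v` as a homomorphism on units. -/
def vordHom (K : Type*) [Field K] [Algebra R K] [IsFractionRing R K]
    (v : HeightOneSpectrum R) : Additive Kˣ →+ ℤ where
  toFun x := vord v (x.toMul : K)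
  map_zero' := by simp
  map_add' x y := by simp [vord_mul v]

theorem mem_unit_iff (S : Set (HeightOneSpectrum R)) (x : Kˣ) :
    x ∈ S.unit K ↔ ∀ v ∉ S, vord v (x : K) = 0 := by
  have : x ∈ S.unit K ↔ ∀ v ∉ S, v.valuation K (x : K) = 1 := by
    constructor
    · intro h v hv
      exact Set.unit_valuation_eq_one S K ⟨x, h⟩ hv
    · intro h
      exact h
  rw [this]
  exact forall₂_congr fun v _ => (vord_eq_zero_iff v x.ne_zero).symm

end Vord

section SUnits

variable {E : Type*} [Field E] [NumberField E]

theorem exists_pow_principal (v : HeightOneSpectrum (𝓞 E)) :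
    ∃ (n : ℕ) (x : 𝓞 E), 0 < n ∧ Ideal.span {x} = v.asIdeal ^ n := by
  let I : nonZeroDivisors (Ideal (𝓞 E)) := ⟨v.asIdeal, mem_nonZeroDivisors_of_ne_zero v.ne_bot⟩
  have h : ClassGroup.mk0 (I ^ Fintype.card (ClassGroup (𝓞 E))) = 1 := by
    rw [map_pow, pow_card_eq_one]
  rw [ClassGroup.mk0_eq_one_iff] at h
  obtain ⟨x, hx⟩ := h
  exact ⟨_, x, Fintype.card_pos, by simpa [I] using hx.symm⟩

end SUnits

section SUnits

variable {E : Type*} [Field E] [NumberField E]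

theorem mem_unit_empty_iff (x : Eˣ) :
    (∀ v : HeightOneSpectrum (𝓞 E), vord v (x : E) = 0) ↔
      ∃ u : (𝓞 E)ˣ, Units.map (algebraMap (𝓞 E) E : 𝓞 E →* E) u = x := by
  constructor
  · intro h
    obtain ⟨r, hr⟩ := exists_integer_of_vord_nonneg (fun v => (h v).ge)
    obtain ⟨s, hs⟩ := exists_integer_of_vord_nonneg (R := 𝓞 E) (x := ((x⁻¹ : Eˣ) : E))
      (fun v => by simp [h v])
    have hrs : r * s = 1 := by
      apply FaithfulSMul.algebraMap_injective (𝓞 E) E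
      simp [hr, hs]
    exact ⟨⟨r, s, hrs, by rw [mul_comm, hrs]⟩, Units.ext hr⟩
  · rintro ⟨u, rfl⟩ v
    have h1 := vord_nonneg (K := E) v (u : 𝓞 E)
    have h2 := vord_nonneg (K := E) v ((u⁻¹ : (𝓞 E)ˣ) : 𝓞 E)
    have h3 : vord v (algebraMap (𝓞 E) E u) + vord v (algebraMap (𝓞 E) E (u⁻¹ : (𝓞 E)ˣ)) = 0 := by
      rw [← vord_mul v (by simp) (by simp), ← map_mul]; simp
    simp only [Units.coe_map, MonoidHom.coe_coe]
    omega

/-- The vector of orders of an `S`-unit at the primes in `S`. -/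
def sUnitOrd (S : Set (HeightOneSpectrum (𝓞 E))) :
    Additive (S.unit E) →ₗ[ℤ] (S → ℤ) :=
  AddMonoidHom.toIntLinearMap
    { toFun := fun x v => vordHom E v.1 (Additive.ofMul (x.toMul : Eˣ))
      map_zero' := by ext v; exact map_zero _
      map_add' := fun x y => by ext v; exact map_add (vordHom E v.1) _ _ }

theorem sUnitOrd_apply (S : Set (HeightOneSpectrum (𝓞 E))) (x : S.unit E) (v : S) :
    sUnitOrd S (Additive.ofMul x) v = vord v.1 ((x : Eˣ) : E) := rfl

/-- Units as `S`-units. -/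
def unitToSUnit (S : Set (HeightOneSpectrum (𝓞 E))) :
    Additive (𝓞 E)ˣ →ₗ[ℤ] Additive (S.unit E) :=
  AddMonoidHom.toIntLinearMap <| MonoidHom.toAdditive <|
    (Units.map (algebraMap (𝓞 E) E : 𝓞 E →* E)).codRestrict (S.unit E) fun u => by
      rw [mem_unit_iff]
      exact fun v _ => (mem_unit_empty_iff _).2 ⟨u, rfl⟩ v

theorem unitToSUnit_injective (S : Set (HeightOneSpectrum (𝓞 E))) :
    Function.Injective (unitToSUnit (E := E) S) := by
  intro x y h
  have h1 : Units.map (algebraMap (𝓞 E) E : 𝓞 E →* E) x.toMul =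
    Units.map (algebraMap (𝓞 E) E : 𝓞 E →* E) y.toMul := congrArg (fun z => ((Additive.toMul z : S.unit E) : Eˣ)) h
  exact Additive.toMul.injective
    (Units.map_injective (FaithfulSMul.algebraMap_injective (𝓞 E) E) h1)

theorem range_unitToSUnit (S : Set (HeightOneSpectrum (𝓞 E))) :
    LinearMap.range (unitToSUnit (E := E) S) = LinearMap.ker (sUnitOrd S) := by
  ext x
  rw [LinearMap.mem_range, LinearMap.mem_ker]
  obtain ⟨x, rfl⟩ := Additive.ofMul.surjective x
  have h0 := (mem_unit_iff S (x : Eˣ)).1 x.2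
  have : sUnitOrd S (Additive.ofMul x) = 0 ↔ ∀ v : HeightOneSpectrum (𝓞 E), vord v ((x : Eˣ) : E) = 0 := by
    constructor
    · intro h v
      by_cases hv : v ∈ S
      · exact congrFun h ⟨v, hv⟩
      · exact h0 v hv
    · intro h
      ext v
      exact h v.1
  rw [this, mem_unit_empty_iff]
  constructor
  · rintro ⟨u, hu⟩
    exact ⟨u.toMul, congrArg (fun z => ((Additive.toMul z : S.unit E) : Eˣ)) hu⟩
  · rintro ⟨u, hu⟩
    exact ⟨Additive.ofMul u, Additive.toMul.injective (Subtype.ext hu)⟩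

theorem sUnit_finite (S : Set (HeightOneSpectrum (𝓞 E))) [Finite S] :
    Module.Finite ℤ (Additive (S.unit E)) := by
  have h1 : Module.Finite ℤ (LinearMap.ker (sUnitOrd S)) := by
    rw [← range_unitToSUnit]; infer_instance
  have h2 : Module.Finite ℤ (Additive (S.unit E) ⧸ LinearMap.ker (sUnitOrd S)) :=
    Module.Finite.equiv (LinearMap.quotKerEquivRange (sUnitOrd S)).symm
  exact Module.Finite.of_submodule_quotient (LinearMap.ker (sUnitOrd S))

theorem sUnit_finrank (S : Set (HeightOneSpectrum (𝓞 E))) [Finite S] :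
    finrank ℤ (Additive (S.unit E)) = Units.rank E + Nat.card S := by
  have := sUnit_finite S
  have := Fintype.ofFinite S
  classical
  rw [← Submodule.finrank_quotient_add_finrank (LinearMap.ker (sUnitOrd S)),
    (LinearMap.quotKerEquivRange (sUnitOrd S)).finrank_eq, ← range_unitToSUnit,
    ← (LinearEquiv.ofInjective _ (unitToSUnit_injective S)).finrank_eq, Units.finrank_eq, add_comm]
  congr 1
  apply le_antisymm
  · refine (Submodule.finrank_le _).trans ?_
    simp
  · choose n x hn hx using fun v : HeightOneSpectrum (𝓞 E) => exists_pow_principal v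
    have hx' := fun v => vord_of_span_eq_pow (K := E) v (hx v)
    let u : S → S.unit E := fun v => ⟨Units.mk0 (algebraMap (𝓞 E) E (x v)) (by simpa using (hx' v).1), by
      rw [mem_unit_iff]
      intro w hw
      exact (hx' v).2.2 w (by rintro rfl; exact hw v.2)⟩
    have hu : ∀ v, sUnitOrd S (Additive.ofMul (u v)) = Pi.single v (n v : ℤ) := by
      intro v
      ext w
      rw [sUnitOrd_apply]
      by_cases hw : w = v
      · subst hw
        simp only [Pi.single_eq_same]
        exact (hx' w).2.1
      · rw [Pi.single_eq_of_ne hw]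
        exact (hx' v).2.2 w fun h => hw (Subtype.ext h)
    have hli : LinearIndependent ℤ (fun v : S => (⟨Pi.single v (n v : ℤ), ⟨_, hu v⟩⟩ : LinearMap.range (sUnitOrd S))) := by
      apply LinearIndependent.of_comp (LinearMap.range (sUnitOrd S)).subtype
      rw [Fintype.linearIndependent_iff]
      intro g hg v
      have := congrFun hg v
      simp only [Function.comp_apply, Submodule.coe_subtype, Finset.sum_apply, Pi.smul_apply, Pi.single_apply, smul_eq_mul, mul_ite, mul_zero, Finset.sum_ite_eq, Finset.mem_univ, if_true, Pi.zero_apply] at this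
      have hnv := hn v
      rcases mul_eq_zero.1 this with h | h
      · exact h
      · omega
    rw [Nat.card_eq_fintype_card]
    exact hli.fintype_card_le_finrank

/-- The squaring endomorphism. -/
abbrev sqHom (G : Type*) [CommGroup G] : G →* G := powMonoidHom 2

theorem index_sqHom_range (G : Type*) [CommGroup G] [Module.Finite ℤ (Additive G)] :
    (sqHom G).range.index = 2 ^ finrank ℤ (Additive G) * Nat.card (sqHom G).ker :=
  index_range_nsmul_eq (Additive G) 2 two_ne_zero

theorem card_sqHom_ker (G : Subgroup Eˣ) (h : -1 ∈ G) : Nat.card (sqHom G).ker = 2 := by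
  rw [Nat.card_eq_two_iff]
  refine ⟨1, ⟨⟨-1, h⟩, ?_⟩, ?_, ?_⟩
  · rw [MonoidHom.mem_ker]; ext; simp
  · intro h1
    have h2 : (((1 : (sqHom G).ker) : G) : Eˣ) = ((⟨-1, h⟩ : G) : Eˣ) := by rw [h1]
    have h3 := congrArg (Units.val) h2
    norm_num at h3
  · rw [Set.eq_univ_iff_forall]
    rintro ⟨⟨x, hx⟩, hx2⟩
    have h1 : (x : E) * x = 1 := by
      have := congrArg (fun z : G => ((z : Eˣ) : E)) ((MonoidHom.mem_ker).1 hx2)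
      simpa [sq] using this
    rcases mul_self_eq_one_iff.1 h1 with h1 | h1
    · left
      exact Subtype.ext (Subtype.ext (Units.ext h1))
    · right
      exact Subtype.ext (Subtype.ext (Units.ext (by simpa using h1)))

theorem index_sqHom_range_sUnit (S : Set (HeightOneSpectrum (𝓞 E))) [Finite S] :
    (sqHom (S.unit E)).range.index = 2 ^ (Units.rank E + Nat.card S + 1) := by
  have := sUnit_finite S
  rw [index_sqHom_range, sUnit_finrank, card_sqHom_ker, pow_succ]
  rw [mem_unit_iff]
  simp

end SUnits

section Approx

variable {R : Type*} [CommRing R] [IsDedekindDomain R] {K : Type*} [Field K] [Algebra R K]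
  [IsFractionRing R K]

theorem exists_sub_mem_pow (T : Finset (HeightOneSpectrum R)) (x : HeightOneSpectrum R → R)
    (e : HeightOneSpectrum R → ℕ) : ∃ y : R, ∀ v ∈ T, y - x v ∈ v.asIdeal ^ e v :=
  IsDedekindDomain.exists_forall_sub_mem_ideal (s := T) (fun v => v.asIdeal) e
    (fun v _ => v.prime) (fun _ _ _ _ h h' => h (HeightOneSpectrum.ext h')) (fun v => x v)

theorem exists_vord_eq_nat (K : Type*) [Field K] [Algebra R K] [IsFractionRing R K]
    (T : Finset (HeightOneSpectrum R)) (n : HeightOneSpectrum R → ℕ) :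
    ∃ y : R, y ≠ 0 ∧ ∀ v ∈ T, vord v (algebraMap R K y) = n v := by
  rcases T.eq_empty_or_nonempty with rfl | ⟨v₀, hv₀⟩
  · exact ⟨1, one_ne_zero, by simp⟩
  choose p hp0 hp using fun v : HeightOneSpectrum R => exists_vord_eq_one (K := K) v
  obtain ⟨y, hy⟩ := exists_sub_mem_pow T (fun v => p v ^ n v) (fun v => n v + 1)
  have key : ∀ v ∈ T, y ≠ 0 ∧ vord v (algebraMap R K y) = n v := by
    intro v hv
    have h1 : algebraMap R K (p v ^ n v) ≠ 0 := by
      simpa using fun h => absurd h (hp0 v)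
    have h2 : vord v (algebraMap R K (p v ^ n v)) = n v := by
      rw [map_pow, vord_pow, hp, mul_one]
    have h3 : algebraMap R K (y - p v ^ n v) = 0 ∨
        vord v (algebraMap R K (p v ^ n v)) < vord v (algebraMap R K (y - p v ^ n v)) := by
      by_cases h0 : y - p v ^ n v = 0
      · left; rw [h0, map_zero]
      · right
        rw [h2]
        have := (le_vord_iff_mem (K := K) v h0 (n v + 1)).2 (hy v hv)
        rw [Nat.cast_add, Nat.cast_one] at this
        exact lt_of_lt_of_le (lt_add_one _) this
    have h4 := vord_add_eq_left v h1 h3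
    rw [← map_add, add_sub_cancel] at h4
    refine ⟨fun h => h4.1 (by rw [h, map_zero]), h4.2.trans h2⟩
  exact ⟨y, (key v₀ hv₀).1, fun v hv => (key v hv).2⟩

theorem exists_vord_eq_int (T : Finset (HeightOneSpectrum R)) (n : HeightOneSpectrum R → ℤ) :
    ∃ y : K, y ≠ 0 ∧ ∀ v ∈ T, vord v y = n v := by
  obtain ⟨y, hy0, hy⟩ := exists_vord_eq_nat K T (fun v => (n v).toNat)
  obtain ⟨z, hz0, hz⟩ := exists_vord_eq_nat K T (fun v => (-n v).toNat)
  have hy0' : algebraMap R K y ≠ 0 := by simpa using hy0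
  have hz0' : algebraMap R K z ≠ 0 := by simpa using hz0
  refine ⟨algebraMap R K y / algebraMap R K z, div_ne_zero hy0' hz0', fun v hv => ?_⟩
  rw [vord_div v hy0' hz0', hy v hv, hz v hv]
  omega

end Approx

/-- `M = E(r)` is the quadratic extension of `E` obtained by adjoining a square root `r` of `a`,
with nontrivial automorphism `σ`. -/
structure IsQuadExt {E M : Type*} [Field E] [Field M] [Algebra E M] (a : E) (r : M)
    (σ : M ≃ₐ[E] M) : Prop where
  sq : r ^ 2 = algebraMap E M a
  not_isSquare : ¬ IsSquare a
  map_r : σ r = -r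
  span : ∀ m : M, ∃ x y : E, m = algebraMap E M x + algebraMap E M y * r

namespace IsQuadExt

section Basic

variable {E M : Type*} [Field E] [Field M] [Algebra E M] {a : E} {r : M}
    {σ : M ≃ₐ[E] M} (h : IsQuadExt a r σ)
include h

theorem a_ne_zero : a ≠ 0 := by
  rintro rfl; exact h.not_isSquare ⟨0, by simp⟩

theorem r_ne_zero : r ≠ 0 := by
  intro h0
  have := h.sq
  rw [h0, zero_pow two_ne_zero] at this
  exact h.a_ne_zero ((algebraMap E M).injective (by rw [← this, map_zero]))

theorem two_ne_zero' [CharZero E] : (2 : M) ≠ 0 := by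
  rw [← map_ofNat (algebraMap E M) 2]
  exact (map_ne_zero _).2 two_ne_zero

theorem map_eq (x y : E) : σ (algebraMap E M x + algebraMap E M y * r) =
    algebraMap E M x - algebraMap E M y * r := by
  rw [map_add, map_mul, AlgEquiv.commutes, AlgEquiv.commutes, h.map_r]; ring

theorem map_map (m : M) : σ (σ m) = m := by
  obtain ⟨x, y, rfl⟩ := h.span m
  rw [h.map_eq, map_sub, map_mul, AlgEquiv.commutes, AlgEquiv.commutes, h.map_r]; ring

theorem exists_of_map_eq [CharZero E] {m : M} (hm : σ m = m) : ∃ x : E, algebraMap E M x = m := by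
  obtain ⟨x, y, rfl⟩ := h.span m
  rw [h.map_eq] at hm
  have h1 : 2 * (algebraMap E M y * r) = 0 := by linear_combination -hm
  have h2 := (mul_eq_zero.1 h1).resolve_left h.two_ne_zero'
  exact ⟨x, by rw [h2, add_zero]⟩

theorem mul_map_eq (x y : E) : (algebraMap E M x + algebraMap E M y * r) *
    σ (algebraMap E M x + algebraMap E M y * r) = algebraMap E M (x ^ 2 - a * y ^ 2) := by
  rw [h.map_eq]
  simp only [map_sub, map_mul, map_pow]
  rw [← h.sq]; ring

theorem exists_norm (m : M) : ∃ z : E, algebraMap E M z = m * σ m := by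
  obtain ⟨x, y, rfl⟩ := h.span m
  exact ⟨_, (h.mul_map_eq x y).symm⟩

theorem exists_of_norm {m : M} {z : E} (hz : algebraMap E M z = m * σ m) :
    ∃ x y : E, z = x ^ 2 - a * y ^ 2 := by
  obtain ⟨x, y, rfl⟩ := h.span m
  exact ⟨x, y, (algebraMap E M).injective (hz.trans (h.mul_map_eq x y))⟩

theorem finrank_eq : finrank E M = 2 := by
  have hli : LinearIndependent E ![(1 : M), r] := by
    rw [LinearIndependent.pair_iff]
    intro s t hst
    simp only [Algebra.smul_def, mul_one] at hst
    by_cases ht : t = 0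
    · subst ht
      simpa using hst
    · exfalso
      apply h.not_isSquare
      refine ⟨-s / t, (algebraMap E M).injective ?_⟩
      have ht' : algebraMap E M t ≠ 0 := by simpa using ht
      have hr : r = algebraMap E M (-s / t) := by
        rw [map_div₀, map_neg, eq_div_iff ht']
        linear_combination hst
      rw [← h.sq, hr, map_mul]; ring
  have hsp : ⊤ ≤ Submodule.span E (Set.range ![(1 : M), r]) := by
    intro m _
    obtain ⟨x, y, rfl⟩ := h.span m
    refine Submodule.add_mem _ ?_ ?_
    · rw [Algebra.algebraMap_eq_smul_one]
      exact Submodule.smul_mem _ _ (Submodule.subset_span ⟨0, rfl⟩)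
    · rw [← Algebra.smul_def]
      exact Submodule.smul_mem _ _ (Submodule.subset_span ⟨1, rfl⟩)
  simpa using finrank_eq_card_basis (Basis.mk hli hsp)

end Basic

end IsQuadExt

/-- Every nonsquare gives rise to a quadratic extension. -/
theorem exists_isQuadExt {E : Type u} [Field E] [NumberField E] {a : E} (ha : ¬ IsSquare a) :
    ∃ (M : Type u) (_ : Field M) (_ : NumberField M) (_ : Algebra E M) (r : M) (σ : M ≃ₐ[E] M),
      IsQuadExt a r σ := by
  have hirr : Irreducible (Polynomial.X ^ 2 - Polynomial.C a) := by
    apply (X_pow_sub_C_irreducible_iff_of_prime Nat.prime_two).2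
    intro b hb
    exact ha ⟨b, by rw [← hb]; ring⟩
  have : Fact (Irreducible (Polynomial.X ^ 2 - Polynomial.C a)) := ⟨hirr⟩
  have hmonic : (Polynomial.X ^ 2 - Polynomial.C a).Monic := Polynomial.monic_X_pow_sub_C a two_ne_zero
  let f := Polynomial.X ^ 2 - Polynomial.C a
  let M := AdjoinRoot f
  let r : M := AdjoinRoot.root f
  have hfin : Module.Finite E M := hmonic.finite_adjoinRoot
  have hnf : NumberField M := NumberField.of_module_finite E M
  have hr : r ^ 2 = algebraMap E M a := by
    have := AdjoinRoot.eval₂_root f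
    simp only [f, Polynomial.eval₂_sub, Polynomial.eval₂_pow, Polynomial.eval₂_X,
      Polynomial.eval₂_C] at this
    exact sub_eq_zero.1 this
  have hspan : ∀ m : M, ∃ x y : E, m = algebraMap E M x + algebraMap E M y * r := by
    intro m
    obtain ⟨p, rfl⟩ := AdjoinRoot.mk_surjective m
    rw [← AdjoinRoot.mk_leftInverse hmonic (AdjoinRoot.mk f p)]
    rw [AdjoinRoot.modByMonicHom_mk]
    have hdeg : (p %ₘ f).natDegree ≤ 1 := by
      have := Polynomial.natDegree_modByMonic_lt p hmonic (by
        intro h1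
        have := congrArg Polynomial.natDegree h1
        rw [Polynomial.natDegree_X_pow_sub_C] at this; simp at this)
      rw [Polynomial.natDegree_X_pow_sub_C] at this
      exact Nat.lt_succ_iff.1 this
    refine ⟨(p %ₘ f).coeff 0, (p %ₘ f).coeff 1, ?_⟩
    conv_lhs => rw [Polynomial.eq_X_add_C_of_natDegree_le_one hdeg]
    rw [map_add, map_mul, add_comm]
    rfl
  let φ : M →ₐ[E] M := AdjoinRoot.liftAlgHom f (Algebra.ofId E M) (-r) (by
    simp only [f, Polynomial.eval₂_sub, Polynomial.eval₂_pow, Polynomial.eval₂_X,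
      Polynomial.eval₂_C]
    rw [neg_sq, hr]; exact sub_self _)
  have hφ : φ r = -r := AdjoinRoot.liftAlgHom_root ..
  let σ : M ≃ₐ[E] M := AlgEquiv.ofBijective φ ⟨φ.toRingHom.injective, by
    have : Function.Injective φ.toLinearMap := φ.toRingHom.injective
    exact LinearMap.surjective_of_injective this⟩
  exact ⟨M, inferInstance, hnf, inferInstance, r, σ, hr, ha, hφ, hspan⟩

section Primes

variable {E M : Type*} [Field E] [NumberField E] [Field M] [NumberField M] [Algebra E M]

/-- The prime of `E` below a prime of `M`. -/
def below (E : Type*) [Field E] [NumberField E] [Algebra E M]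
    (w : HeightOneSpectrum (𝓞 M)) : HeightOneSpectrum (𝓞 E) :=
  HeightOneSpectrum.under (𝓞 E) w

theorem mem_below (w : HeightOneSpectrum (𝓞 M)) (x : 𝓞 E) :
    x ∈ (below E w).asIdeal ↔ algebraMap (𝓞 E) (𝓞 M) x ∈ w.asIdeal := Iff.rfl

theorem exists_vord_algebraMap (w : HeightOneSpectrum (𝓞 M)) :
    ∃ e : ℕ, 0 < e ∧ ∀ x : E, vord w (algebraMap E M x) = e * vord (below E w) x := by
  have : w.asIdeal.LiesOver (below E w).asIdeal := ⟨rfl⟩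
  refine ⟨(below E w).asIdeal.ramificationIdx' w.asIdeal,
    Nat.pos_of_ne_zero (Ideal.IsDedekindDomain.ramificationIdx'_ne_zero_of_liesOver w.asIdeal
      (below E w).ne_bot), fun x => ?_⟩
  unfold vord
  rw [← HeightOneSpectrum.valuation_liesOver M (below E w) w x, log_pow]
  simp

theorem exists_below_eq (M : Type*) [Field M] [NumberField M] [Algebra E M]
    (v : HeightOneSpectrum (𝓞 E)) : ∃ w : HeightOneSpectrum (𝓞 M), below E w = v := by
  obtain ⟨Q, hQ, hQ'⟩ := Ideal.exists_maximal_ideal_liesOver_of_isIntegral (S := 𝓞 M) v.asIdeal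
  refine ⟨⟨Q, hQ.isPrime, ?_⟩, ?_⟩
  · exact Ideal.ne_bot_of_liesOver_of_ne_bot v.ne_bot Q
  · ext1
    exact hQ'.over.symm

theorem vord_algebraMap_eq_zero_iff (w : HeightOneSpectrum (𝓞 M)) (x : E) :
    vord w (algebraMap E M x) = 0 ↔ vord (below E w) x = 0 := by
  obtain ⟨e, he, h⟩ := exists_vord_algebraMap (E := E) w
  rw [h]; simp [he.ne']

theorem vord_algebraMap_pos_iff (w : HeightOneSpectrum (𝓞 M)) (x : E) :
    0 < vord w (algebraMap E M x) ↔ 0 < vord (below E w) x := by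
  obtain ⟨e, he, h⟩ := exists_vord_algebraMap (E := E) w
  rw [h]
  have : (0 : ℤ) < e := by exact_mod_cast he
  exact mul_pos_iff_of_pos_left this

theorem finite_below_preimage (S : Set (HeightOneSpectrum (𝓞 E))) [Finite S] :
    Finite {w : HeightOneSpectrum (𝓞 M) | below E w ∈ S} := by
  have key : ∀ v : HeightOneSpectrum (𝓞 E),
      {w : HeightOneSpectrum (𝓞 M) | below E w = v}.Finite := by
    intro v
    obtain ⟨x, hx0, hx⟩ := exists_vord_eq_one (K := E) v
    have hx0' : algebraMap (𝓞 E) E x ≠ 0 := by simpa using hx0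
    have hx1 : algebraMap E M (algebraMap (𝓞 E) E x) ≠ 0 := by simpa using hx0
    refine (finite_vord_ne_zero (R := 𝓞 M) hx1).subset fun w hw => ?_
    have hw' : below E w = v := hw
    show vord w _ ≠ 0
    rw [Ne, vord_algebraMap_eq_zero_iff, hw', hx]
    exact one_ne_zero
  have : {w : HeightOneSpectrum (𝓞 M) | below E w ∈ S} =
      ⋃ v ∈ S, {w : HeightOneSpectrum (𝓞 M) | below E w = v} := by
    ext w; simp
  rw [this]
  exact (Set.Finite.biUnion (Set.toFinite S) fun v _ => key v).to_subtype

/-- The image of a prime under an automorphism. -/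
def conj (σ : M ≃ₐ[E] M) (w : HeightOneSpectrum (𝓞 M)) : HeightOneSpectrum (𝓞 M) :=
  HeightOneSpectrum.equivOfRingEquiv (RingOfIntegers.mapRingEquiv (σ : M ≃+* M)) w

variable (σ : M ≃ₐ[E] M)

theorem mem_conj (w : HeightOneSpectrum (𝓞 M)) (x : 𝓞 M) :
    x ∈ (conj σ w).asIdeal ↔
      (RingOfIntegers.mapRingEquiv (σ : M ≃+* M)).symm x ∈ w.asIdeal := Iff.rfl

theorem map_mem_conj (w : HeightOneSpectrum (𝓞 M)) (x : 𝓞 M) :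
    RingOfIntegers.mapRingEquiv (σ : M ≃+* M) x ∈ (conj σ w).asIdeal ↔ x ∈ w.asIdeal := by
  rw [mem_conj, RingEquiv.symm_apply_apply]

theorem map_mem_conj_pow (w : HeightOneSpectrum (𝓞 M)) (x : 𝓞 M) (n : ℕ) :
    RingOfIntegers.mapRingEquiv (σ : M ≃+* M) x ∈ (conj σ w).asIdeal ^ n ↔
      x ∈ w.asIdeal ^ n := by
  have h1 : (conj σ w).asIdeal = w.asIdeal.map (RingOfIntegers.mapRingEquiv (σ : M ≃+* M)) := by
    ext y
    rw [mem_conj, Ideal.mem_map_of_equiv]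
    constructor
    · intro hy; exact ⟨_, hy, RingEquiv.apply_symm_apply _ _⟩
    · rintro ⟨z, hz, rfl⟩; rwa [RingEquiv.symm_apply_apply]
  rw [h1, ← Ideal.map_pow, Ideal.mem_map_of_equiv]
  constructor
  · rintro ⟨z, hz, hzx⟩
    rwa [← (RingOfIntegers.mapRingEquiv (σ : M ≃+* M)).injective hzx]
  · intro hx; exact ⟨x, hx, rfl⟩

theorem below_conj (w : HeightOneSpectrum (𝓞 M)) : below E (conj σ w) = below E w := by
  ext1
  ext x
  rw [mem_below, mem_below, ← map_mem_conj σ w]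
  have : RingOfIntegers.mapRingEquiv (σ : M ≃+* M) (algebraMap (𝓞 E) (𝓞 M) x) =
      algebraMap (𝓞 E) (𝓞 M) x := by
    ext
    rw [RingOfIntegers.mapRingEquiv_apply]
    exact σ.commutes (x : E)
  rw [this]

theorem vord_conj (w : HeightOneSpectrum (𝓞 M)) (m : M) :
    vord (conj σ w) (σ m) = vord w m := by
  have key : ∀ x : 𝓞 M, x ≠ 0 → vord (conj σ w) (σ (algebraMap (𝓞 M) M x)) =
      vord w (algebraMap (𝓞 M) M x) := by
    intro x hx
    let y := RingOfIntegers.mapRingEquiv (σ : M ≃+* M) x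
    have hy : σ (algebraMap (𝓞 M) M x) = algebraMap (𝓞 M) M y := rfl
    have hy0 : y ≠ 0 := by simpa [y] using hx
    rw [hy]
    have h1 := vord_nonneg (K := M) (conj σ w) y
    have h2 := vord_nonneg (K := M) w x
    obtain ⟨p, hp⟩ := Int.eq_ofNat_of_zero_le h1
    obtain ⟨q, hq⟩ := Int.eq_ofNat_of_zero_le h2
    have h3 : ∀ n : ℕ, (n : ℤ) ≤ vord (conj σ w) (algebraMap (𝓞 M) M y) ↔
        (n : ℤ) ≤ vord w (algebraMap (𝓞 M) M x) := by
      intro n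
      rw [le_vord_iff_mem _ hy0, le_vord_iff_mem _ hx, map_mem_conj_pow]
    have h4 := (h3 p).1 hp.ge
    have h5 := (h3 q).2 hq.ge
    exact le_antisymm (by rw [hp]; exact h4) (by rw [hq]; exact h5)
  by_cases hm : m = 0
  · subst hm; simp
  obtain ⟨x, y, hy, rfl⟩ := IsFractionRing.div_surjective (A := 𝓞 M) m
  have hy0 : y ≠ 0 := nonZeroDivisors.ne_zero hy
  have hx0 : x ≠ 0 := by rintro rfl; simp at hm
  have hx1 : algebraMap (𝓞 M) M x ≠ 0 := by simpa using hx0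
  have hy1 : algebraMap (𝓞 M) M y ≠ 0 := by simpa using hy0
  rw [map_div₀, vord_div _ ((map_ne_zero σ).2 hx1) ((map_ne_zero σ).2 hy1), vord_div _ hx1 hy1,
    key x hx0, key y hy0]

/-- A prime of `E` is nonsplit in `M` if there is only one prime above it. -/
def Nonsplit (M : Type*) [Field M] [NumberField M] [Algebra E M]
    (v : HeightOneSpectrum (𝓞 E)) : Prop :=
  ∀ w w' : HeightOneSpectrum (𝓞 M), below E w = v → below E w' = v → w = w'

end Primes

namespace IsQuadExt

variable {E M : Type*} [Field E] [NumberField E] [Field M] [NumberField M] [Algebra E M]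
  {a : E} {r : M} {σ : M ≃ₐ[E] M} (h : IsQuadExt a r σ)
include h

theorem conj_conj (w : HeightOneSpectrum (𝓞 M)) : conj σ (conj σ w) = w := by
  ext1
  ext x
  have : RingOfIntegers.mapRingEquiv (σ : M ≃+* M)
      (RingOfIntegers.mapRingEquiv (σ : M ≃+* M) x) = x := by
    ext
    rw [RingOfIntegers.mapRingEquiv_apply, RingOfIntegers.mapRingEquiv_apply]
    exact h.map_map _
  conv_lhs => rw [← this]
  rw [map_mem_conj, map_mem_conj]

theorem vord_map (w : HeightOneSpectrum (𝓞 M)) (m : M) : vord w (σ m) = vord (conj σ w) m := by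
  conv_lhs => rw [← h.conj_conj w]
  exact vord_conj σ (conj σ w) m

theorem map_ne_zero {m : M} (hm : m ≠ 0) : σ m ≠ 0 := (_root_.map_ne_zero σ).2 hm

theorem eq_or_eq_conj {w w' : HeightOneSpectrum (𝓞 M)} (hw : below E w' = below E w) :
    w' = w ∨ w' = conj σ w := by
  classical
  by_contra! hne
  obtain ⟨m, hm0, hm⟩ := exists_vord_eq_nat M ({w, conj σ w, w'} : Finset _)
    (fun u => if u = w' then 1 else 0)
  have h1 := hm w (by simp)
  have h2 := hm (conj σ w) (by simp)
  have h3 := hm w' (by simp)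
  rw [if_neg hne.1.symm] at h1
  rw [if_neg hne.2.symm] at h2
  rw [if_pos rfl] at h3
  set m' := algebraMap (𝓞 M) M m
  have hm0' : m' ≠ 0 := by simpa [m'] using hm0
  obtain ⟨z, hz⟩ := h.exists_norm m'
  have h4 : vord w (algebraMap E M z) = 0 := by
    rw [hz, vord_mul w hm0' (h.map_ne_zero hm0'), h.vord_map, h1, h2]; rfl
  have h5 : 0 < vord w' (algebraMap E M z) := by
    rw [hz, vord_mul w' hm0' (h.map_ne_zero hm0'), h.vord_map, h3]
    have := vord_nonneg (K := M) (conj σ w') m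
    have h6 : 0 ≤ vord (conj σ w') m' := this
    push_cast; omega
  rw [vord_algebraMap_pos_iff, hw] at h5
  rw [vord_algebraMap_eq_zero_iff] at h4
  omega

theorem nonsplit_iff (w : HeightOneSpectrum (𝓞 M)) :
    Nonsplit M (below E w) ↔ conj σ w = w := by
  constructor
  · intro hn
    exact hn _ _ (below_conj σ w) rfl
  · intro hc w1 w2 h1 h2
    have e1 := h.eq_or_eq_conj h1
    have e2 := h.eq_or_eq_conj h2
    rw [hc, or_self] at e1 e2
    rw [e1, e2]

theorem unramified_of_conj_ne {w : HeightOneSpectrum (𝓞 M)} (hw : conj σ w ≠ w) (x : E) :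
    vord w (algebraMap E M x) = vord (below E w) x := by
  classical
  obtain ⟨e, he, hx⟩ := exists_vord_algebraMap (E := E) w
  obtain ⟨m, hm0, hm⟩ := exists_vord_eq_nat M ({w, conj σ w} : Finset _)
    (fun u => if u = w then 1 else 0)
  have h1 := hm w (by simp)
  have h2 := hm (conj σ w) (by simp)
  rw [if_pos rfl] at h1
  rw [if_neg hw] at h2
  set m' := algebraMap (𝓞 M) M m
  have hm0' : m' ≠ 0 := by simpa [m'] using hm0
  obtain ⟨z, hz⟩ := h.exists_norm m'
  have h4 : vord w (algebraMap E M z) = 1 := by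
    rw [hz, vord_mul w hm0' (h.map_ne_zero hm0'), h.vord_map, h1, h2]; rfl
  rw [hx] at h4
  have : (e : ℤ) = 1 := by
    have := Int.eq_one_or_neg_one_of_mul_eq_one h4
    omega
  rw [hx, this, one_mul]

theorem unramified_of_even {w : HeightOneSpectrum (𝓞 M)} (h2 : vord (below E w) (2 : E) = 0)
    (ha : Even (vord (below E w) a)) (x : E) :
    vord w (algebraMap E M x) = vord (below E w) x := by
  by_cases hw : conj σ w = w
  swap
  · exact h.unramified_of_conj_ne hw x
  obtain ⟨e, he, hx⟩ := exists_vord_algebraMap (E := E) w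
  have he' : (0 : ℤ) < e := by exact_mod_cast he
  suffices (e : ℤ) ≤ 1 by
    have : (e : ℤ) = 1 := by omega
    rw [hx, this, one_mul]
  obtain ⟨m₀, hm0, hm1⟩ := exists_vord_eq_one (K := M) w
  set m := algebraMap (𝓞 M) M m₀
  have hm0' : m ≠ 0 := by simpa [m] using hm0
  have hσm : vord w (σ m) = 1 := by rw [h.vord_map, hw, hm1]
  have h2M : vord w (2 : M) = 0 := by
    have := (vord_algebraMap_eq_zero_iff w (2 : E)).2 h2
    rwa [map_ofNat] at this
  obtain ⟨x, y, hxy⟩ := h.span m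
  have hsig : σ m = algebraMap E M x - algebraMap E M y * r := by rw [hxy, h.map_eq]
  have hr0 := h.r_ne_zero
  obtain ⟨n, hn⟩ := ha
  have hrord : vord w r = e * n := by
    have h5 : vord w (r ^ 2) = e * (n + n) := by rw [h.sq, hx, hn]
    rw [vord_pow] at h5
    push_cast at h5; linarith
  have aux : ∀ z : M, z ≠ 0 → 2 * z = m + σ m ∨ 2 * z = m + -σ m → (1 : ℤ) ≤ vord w z := by
    intro z hz hh
    have h20 : (2 : M) ≠ 0 := two_ne_zero
    have h6 : vord w (2 * z) = vord w z := by rw [vord_mul w h20 hz, h2M, zero_add]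
    rw [← h6]
    rcases hh with hh | hh
    · have := mul_ne_zero h20 hz
      rw [hh] at this ⊢
      exact le_vord_add w this 1 (Or.inr hm1.ge) (Or.inr hσm.ge)
    · have := mul_ne_zero h20 hz
      rw [hh] at this ⊢
      exact le_vord_add w this 1 (Or.inr hm1.ge) (Or.inr (by rw [vord_neg]; exact hσm.ge))
  rw [← hm1]
  have hm0'' := hm0'
  rw [hxy] at hm0'' ⊢
  refine le_vord_add w hm0'' e ?_ ?_
  · by_cases hx0 : algebraMap E M x = 0
    · exact Or.inl hx0
    right
    have h7 := aux _ hx0 (Or.inl (by rw [hsig, hxy]; ring))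
    rw [hx] at h7 ⊢
    have : 0 < vord (below E w) x := by
      by_contra! hneg
      have := mul_nonpos_of_nonneg_of_nonpos he'.le hneg
      omega
    exact le_mul_of_one_le_right he'.le this
  · by_cases hy0 : algebraMap E M y = 0
    · left; rw [hy0, zero_mul]
    right
    have h7 := aux _ (mul_ne_zero hy0 hr0) (Or.inr (by rw [hsig, hxy]; ring))
    rw [vord_mul w hy0 hr0, hx, hrord, ← mul_add] at h7 ⊢
    have : 0 < vord (below E w) y + n := by
      by_contra! hneg
      have := mul_nonpos_of_nonneg_of_nonpos he'.le hneg
      omega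
    exact le_mul_of_one_le_right he'.le this

/-- Splitting criterion. -/
theorem conj_ne_of_close {w : HeightOneSpectrum (𝓞 M)} {t : E} (ht : t ≠ 0)
    (hc : vord (below E w) (4 : E) < vord (below E w) (a / t ^ 2 - 1)) : conj σ w ≠ w := by
  intro hw
  have ht' : algebraMap E M t ≠ 0 := by simpa using ht
  have h2M : (2 : M) ≠ 0 := two_ne_zero
  set η : M := (1 + r / algebraMap E M t) / 2
  set ζ : E := (1 - a / t ^ 2) / 4
  have hsη : σ η = (1 - r / algebraMap E M t) / 2 := by
    simp only [η, map_div₀, map_add, map_one, AlgEquiv.commutes, h.map_r, map_ofNat]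
    ring
  have h1 : η * σ η = algebraMap E M ζ := by
    rw [hsη]
    simp only [η, ζ, map_div₀, map_sub, map_one, map_pow, map_ofNat]
    rw [← h.sq]; field_simp; ring
  have h2 : η + σ η = 1 := by
    rw [hsη]; simp only [η]; field_simp; ring
  have hne : (1 - a / t ^ 2) ≠ 0 := by
    intro h0
    apply h.not_isSquare
    refine ⟨t, ?_⟩
    have h3 : a / t ^ 2 = 1 := by linear_combination -h0
    rw [div_eq_one_iff_eq (pow_ne_zero 2 ht)] at h3
    rw [h3]; ring
  have h4 : (4 : E) ≠ 0 := by norm_num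
  have hζ0 : ζ ≠ 0 := div_ne_zero hne h4
  have hζ : 0 < vord (below E w) ζ := by
    simp only [ζ]
    rw [vord_div _ hne h4]
    have : vord (below E w) (1 - a / t ^ 2) = vord (below E w) (a / t ^ 2 - 1) := by
      rw [← vord_neg]; congr 1; ring
    rw [this]; omega
  rw [← vord_algebraMap_pos_iff, ← h1] at hζ
  have hη0 : η ≠ 0 := by
    intro h0
    rw [h0, zero_mul] at h1
    exact hζ0 ((algebraMap E M).injective (by rw [← h1, map_zero]))
  rw [vord_mul w hη0 (h.map_ne_zero hη0), h.vord_map, hw] at hζ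
  have h5 : vord w (η + σ η) ≥ 1 := by
    apply le_vord_add w (by rw [h2]; exact one_ne_zero) 1 (Or.inr (by omega))
    right
    rw [h.vord_map, hw]; omega
  rw [h2, vord_one] at h5
  omega

end IsQuadExt

/-- The abstract index computation behind the norm index inequality for quadratic extensions. -/
theorem norm_range_index_mul {G A : Type*} [CommGroup G] [CommGroup A]
    [Module.Finite ℤ (Additive G)] (i : A →* G) (hi : Function.Injective i) (σ : G →* G)
    (N : G →* A) (hN : ∀ g, i (N g) = g * σ g) (hσ : ∀ g, σ (σ g) = g)
    (hfix : ∀ g, σ g = g → ∃ a, i a = g) (hifix : ∀ a, σ (i a) = i a)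
    (h90 : ∀ b ∈ N.ker, ∃ g, b = g / σ g) (hA2 : Nat.card (sqHom A).ker = 2)
    (hB2 : Nat.card (sqHom N.ker).ker = 2) :
    N.range.index * 2 ^ finrank ℤ (Additive G) = 2 ^ (2 * finrank ℤ (Additive A)) := by
  have hNker : ∀ g, N (g / σ g) = 1 := by
    intro g
    apply hi
    rw [hN, map_div, hσ, map_one]; simp
  let φ : G →* N.ker :=
    { toFun := fun g => ⟨g / σ g, hNker g⟩
      map_one' := by ext; simp
      map_mul' := fun x y => by ext; simp [mul_div_mul_comm] }
  have hφ : Function.Surjective φ := by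
    rintro ⟨b, hb⟩
    obtain ⟨g, hg⟩ := h90 b hb
    exact ⟨g, Subtype.ext hg.symm⟩
  have hNi : ∀ a, N (i a) = a ^ 2 := fun a => hi (by rw [hN, hifix, map_pow, sq])
  have hkB : ∀ b ∈ N.ker, σ b = b⁻¹ := by
    intro b hb
    have := hN b
    rw [MonoidHom.mem_ker.1 hb, map_one] at this
    exact (inv_eq_of_mul_eq_one_right this.symm).symm
  have hcomap : (sqHom A).range.comap N = (sqHom N.ker).range.comap φ := by
    ext g
    simp only [Subgroup.mem_comap, MonoidHom.mem_range, powMonoidHom_apply]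
    constructor
    · rintro ⟨a, ha⟩
      refine ⟨⟨g / i a, ?_⟩, ?_⟩
      · rw [MonoidHom.mem_ker, map_div, hNi, ha, div_self']
      · ext
        show (g / i a) ^ 2 = g / σ g
        rw [div_pow, ← map_pow, ha, hN, sq, mul_div_mul_left_eq_div]
    · rintro ⟨⟨b, hb⟩, hbg⟩
      have hbg' : b ^ 2 = g / σ g := congrArg Subtype.val hbg
      obtain ⟨a, ha⟩ := hfix (g / b) (by
        rw [map_div, hkB b hb, div_inv_eq_mul, eq_div_iff_mul_eq', mul_assoc, ← sq, hbg']; simp)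
      refine ⟨a, hi ?_⟩
      rw [hN, map_pow, ha, div_pow, hbg', sq, div_div_eq_mul_div, mul_div_assoc, mul_assoc]
      simp
  have hle : (sqHom A).range ≤ N.range := by
    rintro _ ⟨a, rfl⟩
    exact ⟨i a, hNi a⟩
  have h1 : (sqHom A).range.relIndex N.range * N.range.index = (sqHom A).range.index :=
    Subgroup.relIndex_mul_index hle
  rw [← Subgroup.index_comap, hcomap, Subgroup.index_comap_of_surjective _ hφ] at h1
  let iL : Additive A →ₗ[ℤ] Additive G := (MonoidHom.toAdditive i).toIntLinearMap
  let φL : Additive G →ₗ[ℤ] Additive N.ker := (MonoidHom.toAdditive φ).toIntLinearMap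
  have hiL : Function.Injective iL := fun x y hxy => hi hxy
  have hφL : Function.Surjective φL := fun x => hφ x
  have : Module.Finite ℤ (Additive A) := Module.Finite.of_injective iL hiL
  have : Module.Finite ℤ (Additive N.ker) := Module.Finite.of_surjective φL hφL
  have hker : LinearMap.ker φL = LinearMap.range iL := by
    ext x
    constructor
    · intro hx
      have hx' : φ x.toMul = 1 := hx
      have hx2 : x.toMul / σ x.toMul = 1 := congrArg Subtype.val hx'
      obtain ⟨a, ha⟩ := hfix x.toMul (div_eq_one.1 hx2).symm
      exact ⟨Additive.ofMul a, ha⟩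
    · rintro ⟨a, rfl⟩
      show φ (i a.toMul) = 1
      ext
      show i a.toMul / σ (i a.toMul) = 1
      rw [hifix, div_self']
  have hrank : finrank ℤ (Additive N.ker) + finrank ℤ (Additive A) = finrank ℤ (Additive G) := by
    have h1 := (LinearMap.quotKerEquivOfSurjective φL hφL).finrank_eq
    have h2 := Submodule.finrank_quotient_add_finrank (LinearMap.ker φL)
    rw [h1, hker, LinearMap.finrank_range_of_inj hiL] at h2
    exact h2
  rw [index_sqHom_range, index_sqHom_range, hA2, hB2] at h1
  rw [← hrank, pow_add, two_mul, pow_add]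
  have h2 : 2 ^ finrank ℤ (Additive N.ker) * N.range.index = 2 ^ finrank ℤ (Additive A) := by
    apply Nat.eq_of_mul_eq_mul_right two_pos
    rw [← h1]; ring
  rw [← h2]; ring

namespace IsQuadExt

variable {E M : Type*} [Field E] [NumberField E] [Field M] [NumberField M] [Algebra E M]
  {a : E} {r : M} {σ : M ≃ₐ[E] M} (h : IsQuadExt a r σ)

/-- The norm map of a quadratic extension, on units. -/
def nm : Mˣ →* Eˣ where
  toFun m := Units.mk0 (h.exists_norm (m : M)).choose (by
    have := (h.exists_norm (m : M)).choose_spec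
    intro h0
    rw [h0, map_zero] at this
    exact mul_ne_zero m.ne_zero (h.map_ne_zero m.ne_zero) this.symm)
  map_one' := by
    ext
    apply (algebraMap E M).injective
    rw [Units.val_mk0, (h.exists_norm _).choose_spec]; simp
  map_mul' x y := by
    ext
    apply (algebraMap E M).injective
    rw [Units.val_mul (Units.mk0 _ _), map_mul, Units.val_mk0, Units.val_mk0, Units.val_mk0,
      (h.exists_norm _).choose_spec, (h.exists_norm _).choose_spec, (h.exists_norm _).choose_spec]
    simp; ring

theorem algebraMap_nm (m : Mˣ) : algebraMap E M (h.nm m) = m * σ m :=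
  (h.exists_norm (m : M)).choose_spec

include h

theorem hilbert90 (b : Mˣ) (hb : (b : M) * σ b = 1) : ∃ y : M, y ≠ 0 ∧ (b : M) = y / σ y := by
  by_cases h1 : 1 + (b : M) = 0
  · refine ⟨r, h.r_ne_zero, ?_⟩
    rw [h.map_r, div_neg, div_self h.r_ne_zero]
    linear_combination h1
  · refine ⟨1 + b, h1, ?_⟩
    rw [eq_div_iff (h.map_ne_zero h1), map_add, map_one, mul_add, hb]; ring

theorem card_preimage (S : Set (HeightOneSpectrum (𝓞 E))) [Finite S] :
    Nat.card {w : HeightOneSpectrum (𝓞 M) | below E w ∈ S} +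
      Nat.card {v : S // Nonsplit M v.1} = 2 * Nat.card S := by
  classical
  have := finite_below_preimage (M := M) S
  have := Fintype.ofFinite S
  have := Fintype.ofFinite {w : HeightOneSpectrum (𝓞 M) | below E w ∈ S}
  simp only [Nat.card_eq_fintype_card]
  let f : {w : HeightOneSpectrum (𝓞 M) | below E w ∈ S} → S := fun w => ⟨below E w.1, w.2⟩
  have h1 : Fintype.card {w : HeightOneSpectrum (𝓞 M) | below E w ∈ S} =
      ∑ v : S, (Finset.univ.filter fun w => f w = v).card :=
    Finset.card_eq_sum_card_fiberwise (f := f) (fun _ _ => Finset.mem_coe.2 (Finset.mem_univ _))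
  have h2 : Fintype.card {v : S // Nonsplit M v.1} =
      ∑ v : S, if Nonsplit M v.1 then 1 else 0 := by
    rw [Fintype.card_subtype, Finset.card_filter]
  rw [h1, h2, ← Finset.sum_add_distrib]
  have h3 : ∀ v : S, (Finset.univ.filter fun w => f w = v).card +
      (if Nonsplit M v.1 then 1 else 0) = 2 := by
    intro v
    obtain ⟨w, hw⟩ := exists_below_eq M v.1
    let w1 : {w : HeightOneSpectrum (𝓞 M) | below E w ∈ S} := ⟨w, by
      show below E w ∈ S
      rw [hw]; exact v.2⟩
    let w2 : {w : HeightOneSpectrum (𝓞 M) | below E w ∈ S} := ⟨conj σ w, by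
      show below E (conj σ w) ∈ S
      rw [below_conj, hw]; exact v.2⟩
    have h4 : (Finset.univ.filter fun w => f w = v) = {w1, w2} := by
      ext u
      simp only [Finset.mem_filter, Finset.mem_univ, true_and, Finset.mem_insert,
        Finset.mem_singleton]
      constructor
      · intro hu
        have hu' : below E u.1 = below E w := by rw [hw, ← hu]
        rcases h.eq_or_eq_conj hu' with e | e
        · left; exact Subtype.ext e
        · right; exact Subtype.ext e
      · rintro (rfl | rfl)
        · exact Subtype.ext hw
        · exact Subtype.ext ((below_conj σ w).trans hw)
    rw [h4]
    have h5 : Nonsplit M v.1 ↔ conj σ w = w := by rw [← hw]; exact h.nonsplit_iff w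
    split_ifs with h6
    · have : w2 = w1 := Subtype.ext (h5.1 h6)
      rw [this]; simp
    · have : w1 ≠ w2 := fun e => h6 (h5.2 (congrArg Subtype.val e).symm)
      rw [Finset.card_pair this]
  rw [Finset.sum_congr rfl fun v _ => h3 v]
  simp [mul_comm]

/-- The norm index equality for `S`-units in a quadratic extension. -/
theorem exists_norm_subgroup [IsTotallyComplex E] (S : Set (HeightOneSpectrum (𝓞 E))) [Finite S]
    (hS2 : ∀ v ∉ S, vord v (2 : E) = 0) (hSa : ∀ v ∉ S, Even (vord v a))
    (hcl : ∀ n : HeightOneSpectrum (𝓞 E) → ℤ, (Function.support n).Finite →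
      ∃ x : E, x ≠ 0 ∧ ∀ v ∉ S, vord v x = n v) :
    ∃ H : Subgroup (S.unit E), (∀ z ∈ H, ∃ x y : E, ((z : Eˣ) : E) = x ^ 2 - a * y ^ 2) ∧
      2 * H.index = 2 ^ Nat.card {v : S // Nonsplit M v.1} := by
  set SM := {w : HeightOneSpectrum (𝓞 M) | below E w ∈ S} with hSM
  have hfin : Finite SM := finite_below_preimage S
  have hunr : ∀ w : HeightOneSpectrum (𝓞 M), w ∉ SM → ∀ x : E,
      vord w (algebraMap E M x) = vord (below E w) x := fun w hw x =>
    h.unramified_of_even (hS2 _ hw) (hSa _ hw) x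
  have hconj : ∀ w : HeightOneSpectrum (𝓞 M), w ∉ SM → conj σ w ∉ SM := by
    intro w hw
    show below E (conj σ w) ∉ S
    rwa [below_conj]
  let i : S.unit E →* SM.unit M :=
    { toFun := fun x => ⟨Units.map (algebraMap E M) x.1, by
        rw [mem_unit_iff]
        intro w hw
        show vord w (algebraMap E M x.1) = 0
        rw [vord_algebraMap_eq_zero_iff]
        exact (mem_unit_iff S x.1).1 x.2 _ hw⟩
      map_one' := by ext; simp
      map_mul' := fun x y => by ext; simp }
  have hi_val : ∀ x, ((i x : Mˣ) : M) = algebraMap E M (x : Eˣ) := fun _ => rfl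
  let s : SM.unit M →* SM.unit M :=
    { toFun := fun x => ⟨Units.map (σ : M →* M) x.1, by
        rw [mem_unit_iff]
        intro w hw
        show vord w (σ (x.1 : M)) = 0
        rw [h.vord_map]
        exact (mem_unit_iff SM x.1).1 x.2 _ (hconj w hw)⟩
      map_one' := by ext; simp
      map_mul' := fun x y => by ext; simp }
  have hs_val : ∀ x, ((s x : Mˣ) : M) = σ (x : Mˣ) := fun _ => rfl
  let N : SM.unit M →* S.unit E :=
    { toFun := fun x => ⟨h.nm x.1, by
        rw [mem_unit_iff]
        intro v hv
        obtain ⟨w, rfl⟩ := exists_below_eq M v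
        rw [← vord_algebraMap_eq_zero_iff, h.algebraMap_nm,
          vord_mul w x.1.ne_zero (h.map_ne_zero x.1.ne_zero), h.vord_map,
          (mem_unit_iff SM x.1).1 x.2 w hv, (mem_unit_iff SM x.1).1 x.2 _ (hconj w hv), add_zero]⟩
      map_one' := by ext; simp
      map_mul' := fun x y => by ext; simp }
  have hN_val : ∀ x, algebraMap E M ((N x : Eˣ) : E) = (x : Mˣ) * σ (x : Mˣ) := fun x =>
    h.algebraMap_nm x.1
  have := sUnit_finite SM
  have hN : ∀ g, i (N g) = g * s g := fun g => by
    ext; rw [hi_val, hN_val]; rfl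
  have main := norm_range_index_mul i
    (fun x y hxy => by
      ext; apply (algebraMap E M).injective
      rw [← hi_val, hxy, hi_val]) s N hN
    (fun g => by ext; rw [hs_val, hs_val, h.map_map])
    (fun g hg => by
      have hg' : σ ((g : Mˣ) : M) = (g : Mˣ) := by rw [← hs_val, hg]
      obtain ⟨x, hx⟩ := h.exists_of_map_eq hg'
      have hx0 : x ≠ 0 := by
        rintro rfl
        rw [map_zero] at hx
        exact (g : Mˣ).ne_zero hx.symm
      refine ⟨⟨Units.mk0 x hx0, ?_⟩, ?_⟩
      · rw [mem_unit_iff]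
        intro v hv
        obtain ⟨w, rfl⟩ := exists_below_eq M v
        rw [← vord_algebraMap_eq_zero_iff, Units.val_mk0, hx]
        exact (mem_unit_iff SM g.1).1 g.2 w hv
      · ext; rw [hi_val]; exact hx)
    (fun a => by ext; rw [hs_val, hi_val, AlgEquiv.commutes])
    (fun b hb => by
      have hb1 : ((b : Mˣ) : M) * σ (b : Mˣ) = 1 := by
        rw [← hN_val, MonoidHom.mem_ker.1 hb]; simp
      obtain ⟨y, hy0, hy⟩ := h.hilbert90 (b : Mˣ) hb1
      have hinv : ∀ w ∉ SM, vord (conj σ w) y = vord w y := by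
        intro w hw
        have h1 := (mem_unit_iff SM b.1).1 b.2 w hw
        rw [hy, vord_div w hy0 (h.map_ne_zero hy0), h.vord_map] at h1
        omega
      choose p hp using exists_below_eq (E := E) M
      obtain ⟨x, hx0, hx⟩ := hcl (fun v => vord (p v) y) (by
        have hinj : Function.Injective p := fun v v' hv => by rw [← hp v, hv, hp]
        exact (finite_vord_ne_zero (R := 𝓞 M) hy0).preimage (hinj.injOn))
      have hx0' : algebraMap E M x ≠ 0 := by simpa using hx0
      have hxy : ∀ w ∉ SM, vord w (algebraMap E M x) = vord w y := by
        intro w hw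
        rw [hunr w hw, hx _ hw]
        rcases h.eq_or_eq_conj (hp (below E w)) with e | e
        · rw [e]
        · rw [e, hinv w hw]
      have hg0 : y / algebraMap E M x ≠ 0 := div_ne_zero hy0 hx0'
      refine ⟨⟨Units.mk0 _ hg0, ?_⟩, ?_⟩
      · rw [mem_unit_iff]
        intro w hw
        rw [Units.val_mk0, vord_div w hy0 hx0', hxy w hw, sub_self]
      · ext
        rw [Subgroup.coe_div, Units.val_div_eq_div_val, hs_val, Units.val_mk0, map_div₀,
          AlgEquiv.commutes, hy]
        have := h.map_ne_zero hy0
        field_simp)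
    (card_sqHom_ker _ (by
      rw [mem_unit_iff]; intro v _; simp))
    (by
      let e : N.ker ≃* N.ker.map (SM.unit M).subtype :=
        N.ker.equivMapOfInjective _ (Subgroup.subtype_injective _)
      have h1 := card_sqHom_ker (N.ker.map (SM.unit M).subtype) (by
        refine ⟨⟨-1, ?_⟩, ?_, rfl⟩
        · rw [mem_unit_iff]; intro v _; simp
        · rw [SetLike.mem_coe, MonoidHom.mem_ker]
          ext
          apply (algebraMap E M).injective
          rw [hN_val]; simp)
      rw [← h1]
      refine Nat.card_congr (Equiv.subtypeEquiv e.toEquiv fun g => ?_)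
      simp only [MonoidHom.mem_ker, powMonoidHom_apply]
      show _ ↔ (e g) ^ 2 = 1
      rw [← map_pow, MulEquiv.map_eq_one_iff])
  refine ⟨N.range, ?_, ?_⟩
  · rintro _ ⟨m, rfl⟩
    exact h.exists_of_norm (hN_val m)
  · have : IsTotallyComplex M := isTotallyComplex_of_algebra E M
    rw [sUnit_finrank, sUnit_finrank] at main
    have hc : Nat.card SM + Nat.card {v : S // Nonsplit M v.1} = 2 * Nat.card S :=
      h.card_preimage S
    have hE := IsTotallyComplex.finrank (K := E)
    have hM := IsTotallyComplex.finrank (K := M)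
    have hEM := Module.finrank_mul_finrank ℚ E M
    rw [h.finrank_eq] at hEM
    have rE : Units.rank E + 1 = InfinitePlace.nrComplexPlaces E := by
      have := InfinitePlace.card_eq_nrRealPlaces_add_nrComplexPlaces (K := E)
      have h0 := IsTotallyComplex.nrRealPlaces_eq_zero (K := E)
      have h1 : 0 < Fintype.card (InfinitePlace E) := Fintype.card_pos
      unfold Units.rank; omega
    have rM : Units.rank M + 1 = InfinitePlace.nrComplexPlaces M := by
      have := InfinitePlace.card_eq_nrRealPlaces_add_nrComplexPlaces (K := M)
      have h0 := IsTotallyComplex.nrRealPlaces_eq_zero (K := M)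
      have h1 : 0 < Fintype.card (InfinitePlace M) := Fintype.card_pos
      unfold Units.rank; omega
    have hr : 2 * (Units.rank E + Nat.card S) + 1 =
        (Units.rank M + Nat.card SM) + Nat.card {v : S // Nonsplit M v.1} := by omega
    apply Nat.eq_of_mul_eq_mul_right (show 0 < 2 ^ (Units.rank M + Nat.card SM) by positivity)
    rw [mul_assoc, main, ← pow_add, add_comm (Nat.card _) _, ← hr, pow_succ, mul_comm]

end IsQuadExt

section Zeta

open scoped ENNReal Topology

section FinsuppZeta

/-- The weight `n ^ (-s)` as an extended nonnegative real. -/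
def zwt (s : ℝ) : ℕ →* ℝ≥0∞ where
  toFun n := ENNReal.ofReal ((n : ℝ) ^ (-s))
  map_one' := by simp
  map_mul' m n := by
    rw [Nat.cast_mul, Real.mul_rpow (Nat.cast_nonneg _) (Nat.cast_nonneg _),
      ENNReal.ofReal_mul (by positivity)]

theorem zwt_apply (s : ℝ) (n : ℕ) : zwt s n = ENNReal.ofReal ((n : ℝ) ^ (-s)) := rfl

/-- The norm of a formal product of elements of `P`. -/
def fnorm {P : Type*} (N : P → ℕ) (n : P →₀ ℕ) : ℕ := n.prod fun v k => N v ^ k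

/-- The zeta function of a set of generalized primes `P` with norm `N`. -/
def fzeta {P : Type*} (N : P → ℕ) (s : ℝ) : ℝ≥0∞ :=
  ∑' n : P →₀ ℕ, zwt s (fnorm N n)

variable {P Q : Type*}

theorem fnorm_mapDomain (N : Q → ℕ) (f : P → Q) (n : P →₀ ℕ) :
    fnorm N (n.mapDomain f) = fnorm (N ∘ f) n :=
  Finsupp.prod_mapDomain_index (fun _ => pow_zero _) (fun _ _ _ => pow_add _ _ _)

theorem fzeta_le (N : Q → ℕ) (f : P → Q) (hf : Function.Injective f) (s : ℝ) :
    fzeta (N ∘ f) s ≤ fzeta N s := by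
  unfold fzeta
  simp_rw [← fnorm_mapDomain]
  exact ENNReal.tsum_comp_le_tsum_of_injective (Finsupp.mapDomain_injective hf)
    (fun n => zwt s (fnorm N n))

theorem fzeta_equiv (N : Q → ℕ) (e : P ≃ Q) (s : ℝ) : fzeta (N ∘ e) s = fzeta N s := by
  refine le_antisymm (fzeta_le N e e.injective s) ?_
  have := fzeta_le (N ∘ e) e.symm e.symm.injective s
  rwa [Function.comp_assoc, Equiv.self_comp_symm, Function.comp_id] at this

theorem fzeta_sum (N : P ⊕ Q → ℕ) (s : ℝ) :
    fzeta N s = fzeta (N ∘ Sum.inl) s * fzeta (N ∘ Sum.inr) s := by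
  unfold fzeta
  rw [← Finsupp.sumFinsuppEquivProdFinsupp.symm.tsum_eq, ENNReal.tsum_prod', ← ENNReal.tsum_mul_right]
  congr 1; ext m
  rw [← ENNReal.tsum_mul_left]
  congr 1; ext n
  rw [← map_mul]
  congr 1
  have : Finsupp.sumFinsuppEquivProdFinsupp.symm (m, n) =
      m.mapDomain Sum.inl + n.mapDomain Sum.inr := by
    ext x
    rcases x with x | x
    · simp [Finsupp.mapDomain_apply Sum.inl_injective, Finsupp.mapDomain_of_notMem_range]
    · simp [Finsupp.mapDomain_apply Sum.inr_injective, Finsupp.mapDomain_of_notMem_range]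
  rw [this, fnorm, Finsupp.prod_add_index' (fun _ => pow_zero _) (fun _ _ _ => pow_add _ _ _)]
  exact congrArg₂ _ (fnorm_mapDomain _ _ _) (fnorm_mapDomain _ _ _)

theorem fzeta_unit_le (N : Unit → ℕ) (hN : 2 ≤ N ()) {s : ℝ} (hs : 1 ≤ s) : fzeta N s ≤ 2 := by
  unfold fzeta
  rw [← (Finsupp.uniqueEquiv (M := ℕ) ()).symm.tsum_eq]
  have h1 : ∀ k : ℕ, zwt s (fnorm N ((Finsupp.uniqueEquiv ()).symm k)) = zwt s (N ()) ^ k := by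
    intro k
    rw [← map_pow]
    congr 1
    unfold fnorm
    rw [Finsupp.prod_fintype _ _ (fun _ => pow_zero _)]
    simp
  simp_rw [h1]
  rw [ENNReal.tsum_geometric]
  have h2 : zwt s (N ()) ≤ 2⁻¹ := by
    rw [zwt_apply]
    have : ((N () : ℕ) : ℝ) ^ (-s) ≤ 2⁻¹ := by
      rw [Real.rpow_neg (Nat.cast_nonneg _)]
      apply inv_anti₀ two_pos
      have h3 : (2 : ℝ) ≤ N () := by exact_mod_cast hN
      calc (2 : ℝ) ≤ N () := h3
        _ = (N () : ℝ) ^ (1 : ℝ) := (Real.rpow_one _).symm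
        _ ≤ (N () : ℝ) ^ s := Real.rpow_le_rpow_of_exponent_le (by linarith) hs
    calc ENNReal.ofReal _ ≤ ENNReal.ofReal (2⁻¹ : ℝ) := ENNReal.ofReal_le_ofReal this
      _ = 2⁻¹ := by rw [ENNReal.ofReal_inv_of_pos two_pos]; simp
  rw [ENNReal.inv_le_iff_inv_le]
  rw [← ENNReal.one_sub_inv_two]
  exact tsub_le_tsub_left h2 1

theorem fzeta_finite_le [Finite P] (N : P → ℕ) (hN : ∀ v, 2 ≤ N v) {s : ℝ} (hs : 1 ≤ s) :
    fzeta N s ≤ 2 ^ Nat.card P := by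
  induction P using Finite.induction_empty_option with
  | of_equiv e ih =>
    rw [← fzeta_equiv N e, ← Nat.card_congr e]
    exact ih _ (fun v => hN _)
  | h_empty =>
    unfold fzeta
    rw [tsum_eq_single 0 (fun b hb => absurd (Subsingleton.elim _ _) hb)]
    simp [fnorm]
  | h_option ih =>
    rename_i α _
    rw [← fzeta_equiv N (Equiv.optionEquivSumPUnit α).symm, fzeta_sum]
    have h1 := ih (fun v => N (some v)) (fun v => hN _)
    have h2 := fzeta_unit_le (fun _ => N none) (hN _) hs
    have : Nat.card (Option α) = Nat.card α + 1 := Finite.card_option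
    rw [this, pow_succ]
    exact mul_le_mul' h1 h2

end FinsuppZeta

section Dedekind

variable (E : Type*) [Field E] [NumberField E]

/-- The norm of a prime. -/
def pnorm (v : HeightOneSpectrum (𝓞 E)) : ℕ := Ideal.absNorm v.asIdeal

/-- The ideal with given exponents. -/
def idealOf (n : HeightOneSpectrum (𝓞 E) →₀ ℕ) : Ideal (𝓞 E) :=
  n.prod fun v k => v.asIdeal ^ k

theorem idealOf_injective : Function.Injective (idealOf E) := by
  intro m n hmn
  have key : ∀ m : HeightOneSpectrum (𝓞 E) →₀ ℕ, ∀ v,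
      FractionalIdeal.count E v (idealOf E m : FractionalIdeal (nonZeroDivisors (𝓞 E)) E) = m v := by
    intro m v
    have := FractionalIdeal.count_finsuppProd E v (m.mapRange (Nat.cast : ℕ → ℤ) (by simp))
    rw [Finsupp.mapRange_apply] at this
    rw [← this]
    congr 1
    rw [Finsupp.prod_mapRange_index (by simp)]
    unfold idealOf Finsupp.prod
    rw [← FractionalIdeal.coeIdealHom_apply, map_prod]
    simp only [FractionalIdeal.coeIdealHom_apply, FractionalIdeal.coeIdeal_pow]
    rw [Finset.prod_congr rfl]
    intro x _
    exact (zpow_natCast _ _).symm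
  ext v
  have := key m v
  rw [hmn, key n v] at this
  exact_mod_cast this.symm

theorem exists_idealOf_eq {I : Ideal (𝓞 E)} (hI : I ≠ ⊥) : ∃ n, idealOf E n = I := by
  induction I using UniqueFactorizationMonoid.induction_on_prime with
  | h₁ => exact absurd rfl hI
  | h₂ I hu => exact ⟨0, by rw [Ideal.isUnit_iff.1 hu]; simp [idealOf]⟩
  | h₃ I p h0 hp ih =>
    obtain ⟨n, hn⟩ := ih h0
    refine ⟨Finsupp.single ⟨p, Ideal.isPrime_of_prime hp, hp.ne_zero⟩ 1 + n, ?_⟩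
    rw [← hn]
    have h1 := Finsupp.prod_single_index (a := (⟨p, Ideal.isPrime_of_prime hp, hp.ne_zero⟩ :
      HeightOneSpectrum (𝓞 E))) (b := 1) (h := fun v k => v.asIdeal ^ k) (pow_zero _)
    unfold idealOf
    rw [Finsupp.prod_add_index' (fun _ => pow_zero _) (fun _ _ _ => pow_add _ _ _), h1, pow_one]

theorem absNorm_idealOf (n : HeightOneSpectrum (𝓞 E) →₀ ℕ) :
    Ideal.absNorm (idealOf E n) = fnorm (pnorm E) n := by
  unfold idealOf fnorm Finsupp.prod pnorm
  simp [map_prod, map_pow]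

theorem fzeta_eq_tsum_ideal {s : ℝ} (hs : s ≠ 0) :
    fzeta (pnorm E) s = ∑' I : Ideal (𝓞 E), zwt s (Ideal.absNorm I) := by
  unfold fzeta
  simp_rw [← absNorm_idealOf]
  refine (idealOf_injective E).tsum_eq (f := fun I => zwt s (Ideal.absNorm I)) ?_
  intro I hI
  apply exists_idealOf_eq
  rintro rfl
  apply hI
  simp [zwt_apply, Real.zero_rpow (neg_ne_zero.2 hs)]

theorem fzeta_eq_tsum_nat {s : ℝ} (hs : s ≠ 0) :
    fzeta (pnorm E) s = ∑' n : ℕ, ENNReal.ofReal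
      (Nat.card {I : Ideal (𝓞 E) // Ideal.absNorm I = n} * (n : ℝ) ^ (-s)) := by
  rw [fzeta_eq_tsum_ideal E hs, ← ENNReal.tsum_fiberwise _ (fun I : Ideal (𝓞 E) => Ideal.absNorm I)]
  congr 1; ext n
  have h1 : ∀ b : (fun I : Ideal (𝓞 E) => Ideal.absNorm I) ⁻¹' {n},
      zwt s (Ideal.absNorm b.1) = zwt s n := fun b => congrArg _ b.2
  rw [tsum_congr h1, ENNReal.tsum_const, ENNReal.ofReal_mul (Nat.cast_nonneg _),
    ENNReal.ofReal_natCast, zwt_apply]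
  by_cases hn : n = 0
  · subst hn; simp [Real.zero_rpow (neg_ne_zero.2 hs)]
  congr 1
  have : Finite ((fun I : Ideal (𝓞 E) => Ideal.absNorm I) ⁻¹' {n}) :=
    (Ideal.finite_setOfPred_absNorm_eq n).to_subtype
  rw [ENat.card_eq_coe_natCard]
  rfl

theorem dedekindZeta_eq_fzeta {s : ℝ} (hs : 0 < s) (h0 : dedekindZeta E s ≠ 0) :
    0 ≤ (dedekindZeta E s).re ∧ ((dedekindZeta E s).re : ℂ) = dedekindZeta E s ∧
      fzeta (pnorm E) s = ENNReal.ofReal (dedekindZeta E s).re := by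
  have hsum : Summable (LSeries.term
      (fun n ↦ (Nat.card {I : Ideal (𝓞 E) // Ideal.absNorm I = n} : ℂ)) s) := by
    by_contra hns
    exact h0 (tsum_eq_zero_of_not_summable hns)
  have hterm : ∀ n : ℕ, LSeries.term
      (fun n ↦ (Nat.card {I : Ideal (𝓞 E) // Ideal.absNorm I = n} : ℂ)) s n =
      (((Nat.card {I : Ideal (𝓞 E) // Ideal.absNorm I = n} * (n : ℝ) ^ (-s) : ℝ)) : ℂ) := by
    intro n
    rcases eq_or_ne n 0 with rfl | hn
    · simp [Real.zero_rpow (neg_ne_zero.2 hs.ne')]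
    · rw [LSeries.term_of_ne_zero hn, Complex.ofReal_mul, Complex.ofReal_cpow (Nat.cast_nonneg _),
        Complex.ofReal_neg, Complex.cpow_neg, div_eq_mul_inv]
      simp
  have hz : dedekindZeta E s = ((∑' n : ℕ, (Nat.card {I : Ideal (𝓞 E) // Ideal.absNorm I = n} *
      (n : ℝ) ^ (-s)) : ℝ) : ℂ) := by
    rw [Complex.ofReal_tsum]
    exact tsum_congr hterm
  rw [funext hterm] at hsum
  have hsum' := Complex.summable_ofReal.1 hsum
  rw [hz, Complex.ofReal_re]
  have hnn : ∀ n : ℕ, 0 ≤ (Nat.card {I : Ideal (𝓞 E) // Ideal.absNorm I = n} : ℝ) *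
      (n : ℝ) ^ (-s) := fun n => by positivity
  exact ⟨tsum_nonneg hnn, rfl,
    (fzeta_eq_tsum_nat E hs.ne').trans (ENNReal.ofReal_tsum_of_nonneg hnn hsum').symm⟩

open Filter in
theorem tendsto_zeta_re : Tendsto (fun s : ℝ => (s - 1) * (dedekindZeta E s).re) (𝓝[>] 1)
    (𝓝 (dedekindZeta_residue E)) := by
  have := (Complex.continuous_re.tendsto _).comp (tendsto_sub_one_mul_dedekindZeta_nhdsGT E)
  refine (this.congr fun s => ?_)
  simp only [Function.comp_apply]
  rw [← Complex.ofReal_one, ← Complex.ofReal_sub, Complex.re_ofReal_mul]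

open Filter in
theorem eventually_zeta_ne_zero : ∀ᶠ s : ℝ in 𝓝[>] 1, dedekindZeta E s ≠ 0 := by
  have := (tendsto_sub_one_mul_dedekindZeta_nhdsGT E).eventually_ne
    (Complex.ofReal_ne_zero.2 (dedekindZeta_residue_ne_zero E))
  filter_upwards [this] with s hs h0
  rw [h0, mul_zero] at hs
  exact hs rfl

end Dedekind

open Filter in
/-- Almost all primes cannot split in a proper way: comparing poles of zeta functions. -/
theorem not_exists_two_embeddings (E M : Type*) [Field E] [NumberField E] [Field M]
    [NumberField M] (T : Finset (HeightOneSpectrum (𝓞 E)))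
    (f : {v // v ∉ T} ⊕ {v // v ∉ T} → HeightOneSpectrum (𝓞 M)) (hf : Function.Injective f)
    (hl : ∀ v, pnorm M (f (Sum.inl v)) = pnorm E v.1)
    (hr : ∀ v, pnorm M (f (Sum.inr v)) = pnorm E v.1) : False := by
  classical
  have hle : ∀ s : ℝ, 1 ≤ s →
      fzeta (pnorm E) s ^ 2 ≤ 4 ^ T.card * fzeta (pnorm M) s := by
    intro s hs
    have h1 : fzeta (pnorm E) s ≤ 2 ^ T.card * fzeta (fun v : {v // v ∉ T} => pnorm E v.1) s := by
      rw [← fzeta_equiv (pnorm E) (Equiv.sumCompl (· ∈ T)), fzeta_sum]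
      have h2 := fzeta_finite_le (fun v : {v // v ∈ T} => pnorm E v.1) (fun v => by
        have h3 : pnorm E v.1 ≠ 0 := by
          unfold pnorm; rw [Ne, Ideal.absNorm_eq_zero_iff]; exact v.1.ne_bot
        have h4 : pnorm E v.1 ≠ 1 := by
          unfold pnorm; rw [Ne, Ideal.absNorm_eq_one_iff]; exact v.1.isPrime.ne_top
        omega) hs
      rw [Nat.card_eq_fintype_card, Fintype.card_coe] at h2
      exact mul_le_mul' h2 le_rfl
    have h2 : fzeta (fun v : {v // v ∉ T} => pnorm E v.1) s ^ 2 ≤ fzeta (pnorm M) s := by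
      refine le_trans (le_of_eq ?_) (fzeta_le (pnorm M) f hf s)
      rw [fzeta_sum, sq]
      congr 2
      · ext v; exact (hl v).symm
      · ext v; exact (hr v).symm
    calc fzeta (pnorm E) s ^ 2 ≤ (2 ^ T.card * fzeta (fun v : {v // v ∉ T} => pnorm E v.1) s) ^ 2 := by
          gcongr
      _ = 4 ^ T.card * fzeta (fun v : {v // v ∉ T} => pnorm E v.1) s ^ 2 := by
          rw [mul_pow, ← pow_mul, mul_comm T.card, pow_mul]; norm_num
      _ ≤ _ := by gcongr
  have hE := tendsto_zeta_re E
  have hM := tendsto_zeta_re M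
  have h0 : Tendsto (fun s : ℝ => s - 1) (𝓝[>] 1) (𝓝 0) := by
    have : Tendsto (fun s : ℝ => s - 1) (𝓝 1) (𝓝 (1 - 1)) := (continuous_sub_right 1).tendsto 1
    rw [sub_self] at this
    exact this.mono_left nhdsWithin_le_nhds
  have hlim := (h0.mul hM).const_mul ((4 : ℝ) ^ T.card)
  rw [zero_mul, mul_zero] at hlim
  have hfin := le_of_tendsto_of_tendsto (hE.pow 2) hlim (by
    filter_upwards [eventually_zeta_ne_zero E, eventually_zeta_ne_zero M, self_mem_nhdsWithin]
      with s h1 h2 h3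
    have h3' : 1 < s := h3
    obtain ⟨e0, -, e1⟩ := dedekindZeta_eq_fzeta E (by linarith) h1
    obtain ⟨m0, -, m1⟩ := dedekindZeta_eq_fzeta M (by linarith) h2
    have := hle s h3'.le
    rw [e1, m1, ← ENNReal.ofReal_pow e0] at this
    have h4 : (4 : ℝ≥0∞) ^ T.card = ENNReal.ofReal (4 ^ T.card) := by
      rw [ENNReal.ofReal_pow (by norm_num)]; norm_num
    rw [h4, ← ENNReal.ofReal_mul (by positivity), ENNReal.ofReal_le_ofReal_iff (by positivity)] at this
    have h5 : 0 ≤ (s - 1) ^ 2 := sq_nonneg _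
    calc _ = (s - 1) ^ 2 * (dedekindZeta E s).re ^ 2 := by ring
      _ ≤ (s - 1) ^ 2 * (4 ^ T.card * (dedekindZeta M s).re) := by gcongr
      _ = _ := by ring)
  have := dedekindZeta_residue_pos E
  nlinarith

end Zeta

section Near

variable {R : Type*} [CommRing R] [IsDedekindDomain R] {K : Type*} [Field K] [Algebra R K]
  [IsFractionRing R K]

/-- `x` is a square modulo `v` (up to multiplication by squares). -/
def IsSqNear (v : HeightOneSpectrum R) (x : K) : Prop :=
  ∃ t : K, t ≠ 0 ∧ (x = t ^ 2 ∨ 0 < vord v (x / t ^ 2 - 1))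

variable (v : HeightOneSpectrum R)

theorem isSqNear_mul_sq {s : K} (hs : s ≠ 0) (x : K) : IsSqNear v (x * s ^ 2) ↔ IsSqNear v x := by
  constructor
  · rintro ⟨t, ht, h⟩
    refine ⟨t / s, div_ne_zero ht hs, ?_⟩
    rcases h with h | h
    · left; rw [div_pow, ← h]; field_simp
    · right; convert h using 3; field_simp
  · rintro ⟨t, ht, h⟩
    refine ⟨t * s, mul_ne_zero ht hs, ?_⟩
    rcases h with h | h
    · left; rw [h]; ring
    · right; convert h using 3; field_simp

theorem isSqNear_sq {s : K} (hs : s ≠ 0) : IsSqNear v (s ^ 2) := ⟨s, hs, Or.inl rfl⟩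

theorem isSqNear_of_pos {x : K} (hx : 0 < vord v (x - 1)) : IsSqNear v x :=
  ⟨1, one_ne_zero, Or.inr (by simpa using hx)⟩

end Near

section Split

variable {E M : Type*} [Field E] [NumberField E] [Field M] [NumberField M] [Algebra E M]

theorem pnorm_of_conj_ne {a : E} {r : M} {σ : M ≃ₐ[E] M} (h : IsQuadExt a r σ)
    {w : HeightOneSpectrum (𝓞 M)} (hw : conj σ w ≠ w) : pnorm M w = pnorm E (below E w) := by
  classical
  obtain ⟨e, he⟩ := exists_sub_mem_pow ({w, conj σ w} : Finset (HeightOneSpectrum (𝓞 M)))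
    (fun v => if v = w then 1 else 0) (fun _ => 1)
  have he1 : e - 1 ∈ w.asIdeal := by simpa using he w (by simp)
  have he2 : e ∈ (conj σ w).asIdeal := by simpa [hw] using he (conj σ w) (by simp)
  have hker : RingHom.ker ((Ideal.Quotient.mk w.asIdeal).comp (algebraMap (𝓞 E) (𝓞 M))) =
      (below E w).asIdeal := by
    ext x
    rw [RingHom.mem_ker, RingHom.comp_apply, Ideal.Quotient.eq_zero_iff_mem, mem_below]
  have hsurj : Function.Surjective
      ((Ideal.Quotient.mk w.asIdeal).comp (algebraMap (𝓞 E) (𝓞 M))) := by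
    intro q
    obtain ⟨m, rfl⟩ := Ideal.Quotient.mk_surjective q
    let σ' := RingOfIntegers.mapRingEquiv (σ : M ≃+* M)
    have hσ' : ∀ x : 𝓞 M, ((σ' x : 𝓞 M) : M) = σ x := fun x => rfl
    obtain ⟨x, hx⟩ := h.exists_of_map_eq (m := ((m * e : 𝓞 M) : M) + ((σ' (m * e) : 𝓞 M) : M)) (by
      rw [map_add, hσ', h.map_map, add_comm])
    have hxint : IsIntegral ℤ x := by
      rw [← isIntegral_algebraMap_iff (algebraMap E M).injective, hx]
      exact (RingOfIntegers.isIntegral_coe _).add (RingOfIntegers.isIntegral_coe _)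
    obtain ⟨x, rfl⟩ : ∃ y : 𝓞 E, algebraMap (𝓞 E) E y = x := ⟨⟨x, hxint⟩, rfl⟩
    refine ⟨x, ?_⟩
    have hx' : algebraMap (𝓞 E) (𝓞 M) x = m * e + σ' (m * e) := by
      apply RingOfIntegers.ext
      exact hx
    rw [RingHom.comp_apply, hx', Ideal.Quotient.eq]
    have h1 : σ' (m * e) ∈ w.asIdeal := by
      rw [← h.conj_conj w, map_mem_conj]
      exact Ideal.mul_mem_left _ _ he2
    have h2 : m * e + σ' (m * e) - m = m * (e - 1) + σ' (m * e) := by ring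
    rw [h2]
    exact Ideal.add_mem _ (Ideal.mul_mem_left _ _ he1) h1
  have := Nat.card_congr (RingHom.quotientKerEquivOfSurjective hsurj).toEquiv
  unfold pnorm
  rw [Ideal.absNorm_apply, Ideal.absNorm_apply, Submodule.cardQuot_apply, Submodule.cardQuot_apply]
  rw [← hker]
  exact this.symm

theorem exists_not_isSqNear {E : Type u} [Field E] [NumberField E] {a : E} (ha : ¬ IsSquare a)
    (T : Finset (HeightOneSpectrum (𝓞 E))) : ∃ v ∉ T, ¬ IsSqNear v a := by
  classical
  obtain ⟨M, _, _, _, r, σ, h⟩ := exists_isQuadExt ha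
  by_contra! hall
  let T' := T ∪ (finite_vord_ne_zero (R := 𝓞 E) (x := (4 : E)) (by norm_num)).toFinset
  choose p hp using exists_below_eq (E := E) M
  have hT : ∀ v ∉ T', conj σ (p v) ≠ p v := by
    intro v hv
    simp only [T', Finset.mem_union, not_or, Set.Finite.mem_toFinset, Set.mem_ofPred_eq,
      not_not] at hv
    obtain ⟨t, ht, h1⟩ := hall v hv.1
    refine h.conj_ne_of_close ht ?_
    rw [hp, hv.2]
    rcases h1 with h1 | h1
    · exact absurd ⟨t, by rw [h1, sq]⟩ ha
    · exact h1
  refine not_exists_two_embeddings E M T'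
    (Sum.elim (fun v => p v.1) (fun v => conj σ (p v.1))) ?_ ?_ ?_
  · have hb : ∀ x, below E (Sum.elim (fun v : {v // v ∉ T'} => p v.1)
        (fun v : {v // v ∉ T'} => conj σ (p v.1)) x) = (Sum.elim id id x).1 := by
      rintro (x | x)
      · exact hp _
      · exact (below_conj _ _).trans (hp _)
    intro x y hxy
    have h1 := congrArg (below E) hxy
    rw [hb, hb] at h1
    have h2 := Subtype.ext h1
    rcases x with x | x <;> rcases y with y | y <;>
      simp only [Sum.elim_inl, Sum.elim_inr, id] at h2 hxy
    · rw [h2]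
    · subst h2; exact absurd hxy.symm (hT _ x.2)
    · subst h2; exact absurd hxy (hT _ x.2)
    · rw [h2]
  · intro v
    simp only [Sum.elim_inl]
    rw [pnorm_of_conj_ne h (hT _ v.2), hp]
  · intro v
    simp only [Sum.elim_inr]
    rw [pnorm_of_conj_ne h (w := conj σ (p v.1)), below_conj, hp]
    rw [h.conj_conj]
    exact (hT _ v.2).symm

end Split

section NearUnits

variable {R : Type*} [CommRing R] [IsDedekindDomain R] {K : Type*} [Field K] [Algebra R K]
  [IsFractionRing R K] (v : HeightOneSpectrum R)

/-- An element integral at `v` is a quotient of integers with denominator prime to `v`. -/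
theorem exists_div_of_vord_nonneg {x : K} (h : 0 ≤ vord v x) :
    ∃ p q : R, q ∉ v.asIdeal ∧ x = algebraMap R K p / algebraMap R K q := by
  classical
  by_cases hx : x = 0
  · exact ⟨0, 1, v.isPrime.one_notMem, by simp [hx]⟩
  obtain ⟨q, hq0, hq⟩ := exists_vord_eq_nat K
    (insert v (finite_vord_ne_zero (R := R) hx).toFinset)
    (fun w => if w = v then 0 else (-(vord w x)).toNat)
  have hqK : algebraMap R K q ≠ 0 := by simpa using hq0
  obtain ⟨p, hp⟩ := exists_integer_of_vord_nonneg (R := R) (x := x * algebraMap R K q) (by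
    intro w
    rw [vord_mul w hx hqK]
    by_cases hw : w ∈ insert v (finite_vord_ne_zero (R := R) hx).toFinset
    · rw [hq w hw]
      by_cases hwv : w = v
      · subst hwv; simpa using h
      · simp only [hwv, if_false]; omega
    · simp only [Finset.mem_insert, Set.Finite.mem_toFinset, Set.mem_ofPred_eq, not_or,
        not_not] at hw
      rw [hw.2, zero_add]; exact vord_nonneg w q)
  refine ⟨p, q, ?_, by rw [hp]; field_simp⟩
  rw [← vord_eq_zero_iff_notMem (K := K) v hq0, hq v (by simp)]
  simp

theorem exists_div_of_vord_eq_zero {x : K} (hx : x ≠ 0) (h : vord v x = 0) :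
    ∃ p q : R, p ∉ v.asIdeal ∧ q ∉ v.asIdeal ∧ x = algebraMap R K p / algebraMap R K q := by
  obtain ⟨p, q, hq, rfl⟩ := exists_div_of_vord_nonneg v h.ge
  refine ⟨p, q, ?_, hq, rfl⟩
  have hp : algebraMap R K p ≠ 0 := fun h0 => hx (by rw [h0, zero_div])
  have hp0 : p ≠ 0 := by rintro rfl; simp at hp
  have hq0 : q ≠ 0 := by rintro rfl; exact hq (zero_mem _)
  rw [vord_div v hp (by simpa using hq0), (vord_eq_zero_iff_notMem v hq0).2 hq, sub_zero] at h
  rwa [← vord_eq_zero_iff_notMem (K := K) v hp0]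

theorem vord_eq_zero_of_near {x : K} (h : 0 < vord v (x - 1)) : vord v x = 0 := by
  have := (vord_add_eq_left v (x := (1 : K)) (y := x - 1) one_ne_zero (Or.inr (by simpa using h))).2
  simpa using this

theorem isSqNear_even {x : K} (h : IsSqNear v x) : Even (vord v x) := by
  obtain ⟨t, ht, rfl | h⟩ := h
  · simp
  · have h1 := vord_eq_zero_of_near v h
    have hx : x ≠ 0 := by rintro rfl; simp at h
    rw [vord_div v hx (pow_ne_zero 2 ht), vord_pow] at h1
    exact ⟨vord v t, by push_cast at h1; omega⟩

theorem isSqNear_algebraMap_iff {p : R} (hp : p ∉ v.asIdeal) :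
    IsSqNear v (algebraMap R K p) ↔ IsSquare (Ideal.Quotient.mk v.asIdeal p) := by
  have := v.isMaximal
  let := Ideal.Quotient.field v.asIdeal
  have hp0 : p ≠ 0 := by rintro rfl; exact hp (zero_mem _)
  have hpK : algebraMap R K p ≠ 0 := by simpa using hp0
  have hvp : vord v (algebraMap R K p) = 0 := (vord_eq_zero_iff_notMem v hp0).2 hp
  constructor
  · rintro ⟨t, ht, h⟩
    have hvt : vord v t = 0 := by
      rcases h with h | h
      · rw [h, vord_pow] at hvp; simpa using hvp
      · have h1 := vord_eq_zero_of_near v h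
        rw [vord_div v hpK (pow_ne_zero 2 ht), hvp, vord_pow] at h1
        push_cast at h1; omega
    obtain ⟨c, d, hc, hd, rfl⟩ := exists_div_of_vord_eq_zero v ht hvt
    have hd0 : d ≠ 0 := by rintro rfl; exact hd (zero_mem _)
    have hdK : algebraMap R K d ≠ 0 := by simpa using hd0
    have hc0 : c ≠ 0 := by rintro rfl; exact hc (zero_mem _)
    have hcK : algebraMap R K c ≠ 0 := by simpa using hc0
    have key : p * d ^ 2 - c ^ 2 ∈ v.asIdeal := by
      by_cases h0 : p * d ^ 2 - c ^ 2 = 0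
      · rw [h0]; exact zero_mem _
      rw [← vord_pos_iff_mem (K := K) v h0]
      have h2 : algebraMap R K (p * d ^ 2 - c ^ 2) =
          (algebraMap R K p / (algebraMap R K c / algebraMap R K d) ^ 2 - 1) *
            algebraMap R K c ^ 2 := by
        simp only [map_sub, map_mul, map_pow]; field_simp
      have h3 : algebraMap R K (p * d ^ 2 - c ^ 2) ≠ 0 :=
        (map_ne_zero_iff _ (IsFractionRing.injective R K)).2 h0
      rw [h2] at h3 ⊢
      rw [vord_mul v (left_ne_zero_of_mul h3) (right_ne_zero_of_mul h3), vord_pow,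
        (vord_eq_zero_iff_notMem v hc0).2 hc]
      rcases h with h | h
      · exfalso; apply h3; rw [h, div_self (by positivity), sub_self, zero_mul]
      · simpa using h
    rw [← Ideal.Quotient.eq_zero_iff_mem, map_sub, map_mul, map_pow, map_pow, sub_eq_zero] at key
    have hd' : Ideal.Quotient.mk v.asIdeal d ≠ 0 := by rwa [Ne, Ideal.Quotient.eq_zero_iff_mem]
    refine ⟨Ideal.Quotient.mk v.asIdeal c / Ideal.Quotient.mk v.asIdeal d, ?_⟩
    field_simp
    exact key
  · rintro ⟨z, hz⟩
    obtain ⟨c, rfl⟩ := Ideal.Quotient.mk_surjective z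
    have hc : c ∉ v.asIdeal := by
      intro hc
      rw [Ideal.Quotient.eq_zero_iff_mem.2 hc, zero_mul, Ideal.Quotient.eq_zero_iff_mem] at hz
      exact hp hz
    have hc0 : c ≠ 0 := by rintro rfl; exact hc (zero_mem _)
    have hcK : algebraMap R K c ≠ 0 := by simpa using hc0
    refine ⟨algebraMap R K c, hcK, ?_⟩
    rw [← map_mul, Ideal.Quotient.eq] at hz
    by_cases h0 : p - c * c = 0
    · left; rw [sub_eq_zero.1 h0, map_mul, sq]
    · right
      have h1 : algebraMap R K p / algebraMap R K c ^ 2 - 1 =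
          algebraMap R K (p - c * c) / algebraMap R K c ^ 2 := by
        simp only [map_sub, map_mul]; field_simp
      have h3 : algebraMap R K (p - c * c) ≠ 0 :=
        (map_ne_zero_iff _ (IsFractionRing.injective R K)).2 h0
      rw [h1, vord_div v h3 (pow_ne_zero 2 hcK), vord_pow, (vord_eq_zero_iff_notMem v hc0).2 hc]
      simpa using (vord_pos_iff_mem (K := K) v h0).2 hz

theorem exists_unit_mul_sq {x : K} (hx : x ≠ 0) (h : Even (vord v x)) :
    ∃ (p : R) (s : K), p ∉ v.asIdeal ∧ s ≠ 0 ∧ x = algebraMap R K p * s ^ 2 := by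
  obtain ⟨n, hn⟩ := h
  obtain ⟨π, hπ0, hπ⟩ := exists_vord_eq_one (K := K) v
  have hπK : algebraMap R K π ≠ 0 := by simpa using hπ0
  have hvz : vord v ((algebraMap R K π) ^ n) = n := by
    have := map_zsmul (vordHom K v) n (Additive.ofMul (Units.mk0 _ hπK))
    simpa [vordHom, hπ] using this
  have h0 : algebraMap R K π ^ n ≠ 0 := zpow_ne_zero _ hπK
  obtain ⟨p, q, hp, hq, hpq⟩ := exists_div_of_vord_eq_zero v
    (x := x / (algebraMap R K π ^ n) ^ 2) (div_ne_zero hx (pow_ne_zero 2 h0)) (by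
      rw [vord_div v hx (pow_ne_zero 2 h0), vord_pow, hvz]; push_cast; omega)
  have hq0 : q ≠ 0 := by rintro rfl; exact hq (zero_mem _)
  have hqK : algebraMap R K q ≠ 0 := by simpa using hq0
  refine ⟨p * q, algebraMap R K π ^ n / algebraMap R K q, ?_, div_ne_zero h0 hqK, ?_⟩
  · exact fun hm => (v.isPrime.mem_or_mem hm).elim hp hq
  · rw [div_eq_iff (pow_ne_zero 2 h0)] at hpq
    rw [hpq, map_mul]; field_simp

end NearUnits

section Legendre

variable {E : Type*} [Field E] [NumberField E] (v : HeightOneSpectrum (𝓞 E))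

open Classical in
/-- The Legendre symbol at `v`, for elements of even order. -/
def leg (x : E) : ℤˣ := if IsSqNear v x then 1 else -1

theorem leg_eq_one_iff (x : E) : leg v x = 1 ↔ IsSqNear v x := by
  unfold leg; split_ifs with h
  · simp [h]
  · simp only [h, iff_false]; decide

theorem leg_mul_sq (x : E) {s : E} (hs : s ≠ 0) : leg v (x * s ^ 2) = leg v x := by
  unfold leg; rw [isSqNear_mul_sq v hs]

theorem leg_sq {s : E} (hs : s ≠ 0) : leg v (s ^ 2) = 1 :=
  (leg_eq_one_iff v _).2 (isSqNear_sq v hs)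

theorem two_notMem (h2 : vord v (2 : E) = 0) : (2 : 𝓞 E) ∉ v.asIdeal := by
  rw [← vord_eq_zero_iff_notMem (K := E) v two_ne_zero, map_ofNat]
  exact h2

open Classical in
theorem ringChar_ne_two (h2 : vord v (2 : E) = 0) : ringChar (𝓞 E ⧸ v.asIdeal) ≠ 2 := by
  intro h
  apply two_notMem v h2
  rw [← Ideal.Quotient.eq_zero_iff_mem, map_ofNat]
  have := ringChar.Nat.cast_ringChar (R := 𝓞 E ⧸ v.asIdeal)
  rw [h] at this
  simpa using this

theorem leg_mul {x y : E} (hx : x ≠ 0) (hy : y ≠ 0)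
    (hvx : Even (vord v x)) (hvy : Even (vord v y)) : leg v (x * y) = leg v x * leg v y := by
  classical
  obtain ⟨p, s, hp, hs, rfl⟩ := exists_unit_mul_sq v hx hvx
  obtain ⟨q, t, hq, ht, rfl⟩ := exists_unit_mul_sq v hy hvy
  rw [show algebraMap (𝓞 E) E p * s ^ 2 * (algebraMap (𝓞 E) E q * t ^ 2) =
    algebraMap (𝓞 E) E (p * q) * (s * t) ^ 2 by rw [map_mul]; ring, leg_mul_sq v _ hs,
    leg_mul_sq v _ ht, leg_mul_sq v _ (mul_ne_zero hs ht)]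
  have := v.isMaximal
  let := Ideal.Quotient.field v.asIdeal
  have : Finite (𝓞 E ⧸ v.asIdeal) := Ideal.finiteQuotientOfFreeOfNeBot _ v.ne_bot
  have := Fintype.ofFinite (𝓞 E ⧸ v.asIdeal)
  have hpq : p * q ∉ v.asIdeal := fun hm => (v.isPrime.mem_or_mem hm).elim hp hq
  have key : ∀ p : 𝓞 E, p ∉ v.asIdeal →
      ((leg v (algebraMap (𝓞 E) E p) : ℤˣ) : ℤ) =
        quadraticChar (𝓞 E ⧸ v.asIdeal) (Ideal.Quotient.mk _ p) := by
    intro p hp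
    have hp0 : Ideal.Quotient.mk v.asIdeal p ≠ 0 := by rwa [Ne, Ideal.Quotient.eq_zero_iff_mem]
    unfold leg
    rw [isSqNear_algebraMap_iff v hp]
    split_ifs with h
    · rw [(quadraticChar_one_iff_isSquare hp0).2 h]; rfl
    · rw [quadraticChar_neg_one_iff_not_isSquare.2 h]; rfl
  ext
  rw [Units.val_mul, key _ hpq, key _ hp, key _ hq, map_mul, map_mul]

theorem exists_unit_leg_eq (h2 : vord v (2 : E) = 0) (ε : ℤˣ) :
    ∃ p : 𝓞 E, p ∉ v.asIdeal ∧ leg v (algebraMap (𝓞 E) E p) = ε := by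
  classical
  rcases Int.units_eq_one_or ε with rfl | rfl
  · exact ⟨1, v.isPrime.one_notMem, by simpa using leg_sq v (E := E) one_ne_zero⟩
  have := v.isMaximal
  let := Ideal.Quotient.field v.asIdeal
  have : Finite (𝓞 E ⧸ v.asIdeal) := Ideal.finiteQuotientOfFreeOfNeBot _ v.ne_bot
  obtain ⟨z, hz⟩ := FiniteField.exists_nonsquare (ringChar_ne_two v h2)
  obtain ⟨p, rfl⟩ := Ideal.Quotient.mk_surjective z
  have hp : p ∉ v.asIdeal := by
    intro hm
    rw [Ideal.Quotient.eq_zero_iff_mem.2 hm] at hz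
    exact hz (IsSquare.zero)
  refine ⟨p, hp, ?_⟩
  unfold leg
  rw [isSqNear_algebraMap_iff v hp, if_neg hz]

theorem vord_zpow (x : E) (n : ℤ) : vord v (x ^ n) = n * vord v x := by
  rcases n with n | n
  · simp
  · rw [zpow_negSucc, vord_inv, vord_pow, Int.negSucc_eq]; push_cast; ring

theorem even_vord_tame {a x : E} (ha : a ≠ 0) (hx : x ≠ 0) :
    vord v ((-1) ^ (vord v a * vord v x) * x ^ vord v a / a ^ vord v x : E) = 0 := by
  have h1 : ((-1 : E)) ^ (vord v a * vord v x) ≠ 0 := zpow_ne_zero _ (by simp)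
  rw [vord_div v (mul_ne_zero h1 (zpow_ne_zero _ hx)) (zpow_ne_zero _ ha),
    vord_mul v h1 (zpow_ne_zero _ hx), vord_zpow, vord_zpow, vord_zpow]
  simp; ring

/-- The tame symbol `(a, ·)` at an odd prime `v`. -/
def tame {a : E} (ha : a ≠ 0) : Eˣ →* ℤˣ :=
  MonoidHom.mk' (fun x => leg v ((-1) ^ (vord v a * vord v (x : E)) * (x : E) ^ vord v a /
    a ^ vord v (x : E))) (by
    intro x y
    have hx := x.ne_zero
    have hy := y.ne_zero
    have h1 : ((-1 : E)) ≠ 0 := by simp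
    have e : ∀ z : E, z ≠ 0 → (-1) ^ (vord v a * vord v z) * z ^ vord v a / a ^ vord v z ≠ 0 :=
      fun z hz => div_ne_zero (mul_ne_zero (zpow_ne_zero _ h1) (zpow_ne_zero _ hz))
        (zpow_ne_zero _ ha)
    rw [← leg_mul v (e _ hx) (e _ hy) (by simp [even_vord_tame v ha hx])
      (by simp [even_vord_tame v ha hy])]
    congr 1
    rw [Units.val_mul, vord_mul v hx hy, mul_add, zpow_add₀ h1, zpow_add₀ ha, mul_zpow]
    field_simp)

theorem tame_apply {a : E} (ha : a ≠ 0) (x : Eˣ) :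
    tame v ha x = leg v ((-1) ^ (vord v a * vord v (x : E)) * (x : E) ^ vord v a /
    a ^ vord v (x : E)) := rfl

theorem leg_zpow_even {x : E} (hx : x ≠ 0) {n : ℤ} (hn : Even n) : leg v (x ^ n) = 1 := by
  obtain ⟨m, rfl⟩ := hn
  rw [zpow_add₀ hx, ← sq]
  exact leg_sq v (zpow_ne_zero _ hx)

theorem leg_zpow_odd {x : E} (hx : x ≠ 0) {n : ℤ} (hn : Odd n) : leg v (x ^ n) = leg v x := by
  obtain ⟨m, rfl⟩ := hn
  rw [zpow_add₀ hx, mul_comm 2 m, zpow_mul, zpow_one, mul_comm, zpow_ofNat]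
  exact leg_mul_sq v _ (zpow_ne_zero _ hx)

variable {a : E} (ha : a ≠ 0)

theorem tame_sq (x : Eˣ) : tame v ha (x ^ 2) = 1 := by
  rw [map_pow, Int.units_sq]

theorem tame_neg_self (x : Eˣ) (hx : (x : E) = -a) : tame v ha x = 1 := by
  rw [tame_apply, hx, vord_neg, neg_eq_neg_one_mul a, mul_zpow, ← mul_assoc, mul_div_assoc,
    div_self (zpow_ne_zero _ ha), mul_one, ← zpow_add₀ (by simp)]
  exact leg_zpow_even v (by simp) (by rw [← mul_add_one]; exact Int.even_mul_succ_self _)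

theorem tame_near (x : Eˣ) (hx : 0 < vord v ((x : E) - 1)) : tame v ha x = 1 := by
  have h0 := vord_eq_zero_of_near v hx
  rw [tame_apply, h0]
  simp only [mul_zero, zpow_zero, one_mul, div_one]
  rcases Int.even_or_odd (vord v a) with h | h
  · exact leg_zpow_even v x.ne_zero h
  · rw [leg_zpow_odd v x.ne_zero h, leg_eq_one_iff]; exact isSqNear_of_pos v hx

theorem tame_isSqNear (x : Eˣ) (hx : IsSqNear v (x : E)) : tame v ha x = 1 := by
  obtain ⟨t, ht, h⟩ := hx
  rcases h with h | h
  · have : x = (Units.mk0 t ht) ^ 2 := by ext; simpa using h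
    rw [this, tame_sq]
  · have h1 := tame_near v ha (x / (Units.mk0 t ht) ^ 2) (by simpa using h)
    rwa [map_div, tame_sq, div_one] at h1

/-- For `a` of even order the tame symbol only depends on the order. -/
theorem tame_of_even (hev : Even (vord v a)) (x : Eˣ) :
    tame v ha x = if Even (vord v (x : E)) then 1 else leg v a := by
  rw [tame_apply, Even.neg_one_zpow (hev.mul_right _), one_mul]
  have : leg v ((x : E) ^ vord v a / a ^ vord v (x : E)) = leg v (a ^ vord v (x : E)) := by
    obtain ⟨n, hn⟩ := hev
    rw [hn, zpow_add₀ x.ne_zero]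
    have h3 : (x : E) ^ n * (x : E) ^ n / a ^ vord v (x : E) =
        a ^ vord v (x : E) * ((x : E) ^ n / a ^ vord v (x : E)) ^ 2 := by
      have := zpow_ne_zero (vord v (x : E)) ha
      field_simp
    rw [h3, leg_mul_sq v _ (div_ne_zero (zpow_ne_zero _ x.ne_zero) (zpow_ne_zero _ ha))]
  rw [this]
  split_ifs with h
  · exact leg_zpow_even v ha h
  · exact leg_zpow_odd v ha (Int.not_even_iff_odd.1 h)

/-- For `a` of odd order the tame symbol of a unit is its Legendre symbol. -/
theorem tame_of_odd (hodd : Odd (vord v a)) (x : Eˣ) (hx : vord v (x : E) = 0) :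
    tame v ha x = leg v (x : E) := by
  rw [tame_apply, hx]
  simp only [mul_zero, zpow_zero, one_mul, div_one]
  exact leg_zpow_odd v x.ne_zero hodd

/-- The tame symbol is trivial on norms. -/
theorem tame_norm (x : Eˣ) (p q : E) (hx : (x : E) = p ^ 2 - a * q ^ 2) :
    tame v ha x = 1 := by
  by_cases hq : q = 0
  · subst hq
    have hp : p ≠ 0 := by rintro rfl; simp at hx
    exact tame_isSqNear v ha x ⟨p, hp, Or.inl (by simpa using hx)⟩
  have hq2 : a * q ^ 2 ≠ 0 := mul_ne_zero ha (pow_ne_zero 2 hq)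
  have hnq : tame v ha (Units.mk0 (-a) (neg_ne_zero.2 ha) * (Units.mk0 q hq) ^ 2) = 1 := by
    rw [map_mul, tame_sq, mul_one]; exact tame_neg_self v ha _ rfl
  by_cases hp : p = 0
  · rw [← hnq]; congr 1; ext; simp [hx, hp]
  have hp2 : p ^ 2 ≠ 0 := pow_ne_zero 2 hp
  rcases lt_trichotomy (vord v (p ^ 2)) (vord v (a * q ^ 2)) with h | h | h
  · refine tame_isSqNear v ha x ⟨p, hp, Or.inr ?_⟩
    have : (x : E) / p ^ 2 - 1 = -(a * q ^ 2 / p ^ 2) := by rw [hx]; field_simp; ring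
    rw [this, vord_neg, vord_div v hq2 hp2]
    omega
  · have hev : Even (vord v a) := by
      rw [vord_mul v ha (pow_ne_zero 2 hq), vord_pow, vord_pow] at h
      exact ⟨vord v p - vord v q, by push_cast at h; omega⟩
    rw [tame_of_even v ha hev]
    split_ifs with hodd
    · rfl
    rw [leg_eq_one_iff]
    have hle : vord v (p ^ 2) ≤ vord v (x : E) := by
      rw [hx, sub_eq_add_neg]
      refine le_vord_add v ?_ _ (Or.inr le_rfl) (Or.inr (by rw [vord_neg, h]))
      rw [← sub_eq_add_neg, ← hx]; exact x.ne_zero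
    have hlt : vord v (p ^ 2) < vord v (x : E) := by
      refine lt_of_le_of_ne hle fun he => hodd ?_
      rw [← he, vord_pow]; simp
    refine ⟨p / q, div_ne_zero hp hq, Or.inr ?_⟩
    have : a / (p / q) ^ 2 - 1 = -((x : E) / p ^ 2) := by rw [hx]; field_simp; ring
    rw [this, vord_neg, vord_div v x.ne_zero hp2]
    omega
  · have h1 := tame_near v ha
      (x / (Units.mk0 (-a) (neg_ne_zero.2 ha) * (Units.mk0 q hq) ^ 2)) (by
        have : ((x / ((Units.mk0 (-a) (neg_ne_zero.2 ha)) * (Units.mk0 q hq) ^ 2) : Eˣ) : E) - 1 =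
          -(p ^ 2 / (a * q ^ 2)) := by
          simp only [Units.val_div_eq_div_val, Units.val_mul, Units.val_pow_eq_pow_val,
            Units.val_mk0, hx]
          field_simp; ring
        rw [this, vord_neg, vord_div v hp2 hq2]
        omega)
    rwa [map_div, hnq, div_one] at h1

end Legendre

section Generic

variable {R : Type*} [CommRing R] [IsDedekindDomain R] {K : Type*} [Field K] [Algebra R K]
  [IsFractionRing R K]

theorem exists_div_of_forall_vord_eq_zero (T : Finset (HeightOneSpectrum R)) {x : K} (hx : x ≠ 0)
    (h : ∀ v ∈ T, vord v x = 0) : ∃ p q : R, p ≠ 0 ∧ q ≠ 0 ∧ (∀ v ∈ T, p ∉ v.asIdeal) ∧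
      (∀ v ∈ T, q ∉ v.asIdeal) ∧ x = algebraMap R K p / algebraMap R K q := by
  classical
  obtain ⟨q, hq0, hq⟩ := exists_vord_eq_nat K
    (T ∪ (finite_vord_ne_zero (R := R) hx).toFinset) (fun w => (-(vord w x)).toNat)
  have hqK : algebraMap R K q ≠ 0 := by simpa using hq0
  obtain ⟨p, hp⟩ := exists_integer_of_vord_nonneg (R := R) (x := x * algebraMap R K q) (by
    intro w
    rw [vord_mul w hx hqK]
    by_cases hw : w ∈ T ∪ (finite_vord_ne_zero (R := R) hx).toFinset
    · rw [hq w hw]; omega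
    · simp only [Finset.mem_union, Set.Finite.mem_toFinset, Set.mem_ofPred_eq, not_or,
        not_not] at hw
      rw [hw.2, zero_add]; exact vord_nonneg w q)
  have hpK : algebraMap R K p ≠ 0 := by rw [hp]; exact mul_ne_zero hx hqK
  have hp0 : p ≠ 0 := by rintro rfl; simp at hpK
  have hqv : ∀ v ∈ T, vord v (algebraMap R K q) = 0 := fun v hv => by
    rw [hq v (Finset.mem_union_left _ hv), h v hv]; simp
  refine ⟨p, q, hp0, hq0, fun v hv => ?_, fun v hv => ?_, by rw [hp]; field_simp⟩
  · rw [← vord_eq_zero_iff_notMem (K := K) v hp0, hp, vord_mul v hx hqK, h v hv, hqv v hv, zero_add]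
  · rw [← vord_eq_zero_iff_notMem (K := K) v hq0, hqv v hv]

/-- Elements of `Kˣ` close to `1` at all primes in `S`. -/
def nearOne (K : Type*) [Field K] [Algebra R K] [IsFractionRing R K]
    (S : Finset (HeightOneSpectrum R)) : Subgroup Kˣ where
  carrier := {x | ∀ v ∈ S, (x : K) = 1 ∨ vord v (4 : K) < vord v ((x : K) - 1)}
  one_mem' := fun v _ => Or.inl rfl
  mul_mem' := by
    intro x y hx hy v hv
    have h4 : 0 ≤ vord v (4 : K) := by
      have := vord_nonneg (K := K) v 4; rwa [map_ofNat] at this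
    rcases hx v hv with h1 | h1
    · rw [Units.val_mul, h1, one_mul]; exact hy v hv
    · rcases hy v hv with h2 | h2
      · rw [Units.val_mul, h2, mul_one]; exact Or.inr h1
      · by_cases h0 : ((x * y : Kˣ) : K) = 1
        · exact Or.inl h0
        right
        have e : ((x * y : Kˣ) : K) - 1 = ((x : K) - 1) * y + ((y : K) - 1) := by
          rw [Units.val_mul]; ring
        have hx1 : (x : K) - 1 ≠ 0 := by rintro h; rw [h] at h1; simp at h1; omega
        have := le_vord_add v (x := ((x : K) - 1) * y) (y := (y : K) - 1)
          (by rw [← e]; exact sub_ne_zero.2 h0) (vord v (4 : K) + 1)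
          (Or.inr (by
            rw [vord_mul v hx1 y.ne_zero, vord_eq_zero_of_near v (x := (y : K)) (by omega)]
            omega)) (Or.inr (by omega))
        rw [e]; omega
  inv_mem' := by
    intro x hx v hv
    have h4 : 0 ≤ vord v (4 : K) := by
      have := vord_nonneg (K := K) v 4; rwa [map_ofNat] at this
    rcases hx v hv with h1 | h1
    · left; rw [Units.val_inv_eq_inv_val, h1, inv_one]
    · right
      have hx1 : (x : K) - 1 ≠ 0 := by rintro h; rw [h] at h1; simp at h1; omega
      have e : ((x⁻¹ : Kˣ) : K) - 1 = -(((x : K) - 1) / x) := by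
        rw [Units.val_inv_eq_inv_val]; have := x.ne_zero; field_simp; ring
      rw [e, vord_neg, vord_div v hx1 x.ne_zero,
        vord_eq_zero_of_near v (x := (x : K)) (by omega)]
      omega

/-- Elements of `Kˣ` close to a common square at all primes in `S`. -/
def nearSq (K : Type*) [Field K] [Algebra R K] [IsFractionRing R K]
    (S : Finset (HeightOneSpectrum R)) : Subgroup Kˣ := nearOne K S ⊔ (sqHom Kˣ).range

theorem mem_nearSq_iff (S : Finset (HeightOneSpectrum R)) (x : Kˣ) :
    x ∈ nearSq K S ↔ ∃ t : Kˣ, ∀ v ∈ S,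
      (x : K) / (t : K) ^ 2 = 1 ∨ vord v (4 : K) < vord v ((x : K) / (t : K) ^ 2 - 1) := by
  unfold nearSq
  rw [Subgroup.mem_sup]
  constructor
  · rintro ⟨y, hy, z, ⟨t, rfl⟩, rfl⟩
    refine ⟨t, ?_⟩
    have : ((y * sqHom Kˣ t : Kˣ) : K) / (t : K) ^ 2 = y := by simp [sqHom]
    rw [this]; exact hy
  · rintro ⟨t, ht⟩
    refine ⟨x / t ^ 2, ?_, t ^ 2, ⟨t, rfl⟩, by simp⟩
    intro v hv
    have : ((x / t ^ 2 : Kˣ) : K) = x / (t : K) ^ 2 := by simp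
    rw [this]; exact ht v hv

end Generic

section Local

variable (E : Type*) [Field E] [NumberField E] (S : Finset (HeightOneSpectrum (𝓞 E)))

/-- The product of the primes in `S` times the integer `m`. -/
def modulus (m : 𝓞 E) : Ideal (𝓞 E) := Ideal.span {m} * S.inf fun v => v.asIdeal

theorem inf_ne_bot : (S.inf fun v => v.asIdeal) ≠ ⊥ := by
  intro h
  have : ∏ v ∈ S, v.asIdeal = ⊥ := le_bot_iff.1 (h ▸ Ideal.prod_le_inf)
  rw [← Ideal.zero_eq_bot, Finset.prod_eq_zero_iff] at this
  obtain ⟨v, _, hv⟩ := this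
  exact v.ne_bot hv

theorem modulus_ne_bot {m : 𝓞 E} (hm : m ≠ 0) : modulus E S m ≠ ⊥ :=
  mul_ne_zero (by simpa using hm) (inf_ne_bot E S)

variable {E S}

theorem modulus_le {v : HeightOneSpectrum (𝓞 E)} (hv : v ∈ S) (m : 𝓞 E) :
    modulus E S m ≤ v.asIdeal := Ideal.mul_le_right.trans (Finset.inf_le hv)

theorem lt_vord_of_mem_modulus {v : HeightOneSpectrum (𝓞 E)} (hv : v ∈ S) {m x : 𝓞 E}
    (hx0 : x ≠ 0) (hx : x ∈ modulus E S m) :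
    vord v (algebraMap (𝓞 E) E m) < vord v (algebraMap (𝓞 E) E x) := by
  obtain ⟨z, hz, rfl⟩ := Ideal.mem_span_singleton_mul.1 hx
  have hz' : z ∈ v.asIdeal := Finset.inf_le (f := fun v : HeightOneSpectrum (𝓞 E) => v.asIdeal) hv hz
  have hm0 := left_ne_zero_of_mul hx0
  have hz0 := right_ne_zero_of_mul hx0
  rw [map_mul, vord_mul v (by simpa using hm0) (by simpa using hz0)]
  have := (vord_pos_iff_mem (K := E) v hz0).2 hz'
  omega

theorem mem_modulus_of_lt_vord {m x : 𝓞 E} (hm0 : m ≠ 0)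
    (hm : ∀ v ∉ S, vord v (algebraMap (𝓞 E) E m) = 0)
    (hx : ∀ v ∈ S, x = 0 ∨ vord v (algebraMap (𝓞 E) E m) < vord v (algebraMap (𝓞 E) E x)) :
    x ∈ modulus E S m := by
  by_cases hx0 : x = 0
  · rw [hx0]; exact zero_mem _
  have hmE : algebraMap (𝓞 E) E m ≠ 0 := by simpa using hm0
  have hxE : algebraMap (𝓞 E) E x ≠ 0 := by simpa using hx0
  obtain ⟨y, hy⟩ := exists_integer_of_vord_nonneg (R := 𝓞 E)
    (x := algebraMap (𝓞 E) E x / algebraMap (𝓞 E) E m) (by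
      intro v
      rw [vord_div v hxE hmE]
      by_cases hv : v ∈ S
      · have := (hx v hv).resolve_left hx0; omega
      · rw [hm v hv, sub_zero]; exact vord_nonneg v x)
  refine Ideal.mem_span_singleton_mul.2 ⟨y, ?_, ?_⟩
  · rw [Submodule.mem_finsetInf]
    intro v hv
    have hy0 : y ≠ 0 := by
      rintro rfl; rw [map_zero] at hy; exact div_ne_zero hxE hmE hy.symm
    rw [← vord_pos_iff_mem (K := E) v hy0, hy, vord_div v hxE hmE]
    have := (hx v hv).resolve_left hx0; omega
  · apply RingOfIntegers.ext
    change algebraMap (𝓞 E) E (m * y) = algebraMap (𝓞 E) E x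
    rw [map_mul, hy]; field_simp

theorem isUnit_mk_modulus {m : 𝓞 E} (hm0 : m ≠ 0)
    (hm : ∀ v ∉ S, vord v (algebraMap (𝓞 E) E m) = 0) {p : 𝓞 E} (hp : ∀ v ∈ S, p ∉ v.asIdeal) :
    IsUnit (Ideal.Quotient.mk (modulus E S m) p) := by
  have htop : Ideal.span {p} ⊔ modulus E S m = ⊤ := by
    by_contra hne
    obtain ⟨P, hP, hle⟩ := Ideal.exists_le_maximal _ hne
    have hmP : modulus E S m ≤ P := le_sup_right.trans hle
    have hpP : p ∈ P := hle (Ideal.mem_sup_left (Ideal.mem_span_singleton_self p))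
    let w : HeightOneSpectrum (𝓞 E) := ⟨P, hP.isPrime, fun h =>
      modulus_ne_bot E S hm0 (le_bot_iff.1 (h ▸ hmP))⟩
    have hw : w ∈ S := by
      rcases hP.isPrime.mul_le.1 hmP with h | h
      · by_contra hw
        exact (vord_eq_zero_iff_notMem (K := E) w hm0).1 (hm w hw)
          (h (Ideal.mem_span_singleton_self m))
      · obtain ⟨v, hv, hvP⟩ := (Ideal.IsPrime.inf_le' hP.isPrime).1 h
        have : v = w := HeightOneSpectrum.ext (v.isMaximal.eq_of_le hP.ne_top hvP)
        rwa [← this]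
    exact hp w hw hpP
  have h1 : (1 : 𝓞 E) ∈ Ideal.span {p} ⊔ modulus E S m := by rw [htop]; trivial
  obtain ⟨a, ha, b, hb, hab⟩ := Submodule.mem_sup.1 h1
  obtain ⟨c, rfl⟩ := Ideal.mem_span_singleton'.1 ha
  refine IsUnit.of_mul_eq_one (Ideal.Quotient.mk _ c) ?_
  rw [← map_mul, ← map_one (Ideal.Quotient.mk _), Ideal.Quotient.eq, ← hab]
  have : p * c - (c * p + b) = -b := by ring
  rw [this]; exact neg_mem hb

theorem notMem_of_isUnit_mk {m : 𝓞 E} {p : 𝓞 E} (h : IsUnit (Ideal.Quotient.mk (modulus E S m) p))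
    (v) (hv : v ∈ S) : p ∉ v.asIdeal := by
  intro hpv
  obtain ⟨c, hc⟩ := h.exists_right_inv
  obtain ⟨c, rfl⟩ := Ideal.Quotient.mk_surjective c
  rw [← map_mul, ← map_one (Ideal.Quotient.mk _), Ideal.Quotient.eq] at hc
  have h1 := modulus_le hv m hc
  refine v.isPrime.one_notMem ?_
  have : (1 : 𝓞 E) = p * c - (p * c - 1) := by ring
  rw [this]
  exact sub_mem (Ideal.mul_mem_right _ _ hpv) h1

end Local

section Count

variable {E : Type*} [Field E] [NumberField E] (S : Finset (HeightOneSpectrum (𝓞 E)))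
  (hS : ∀ v ∉ S, vord v (2 : E) = 0)
include hS

theorem vord_two_pow_eq_zero (n : ℕ) (v) (hv : v ∉ S) :
    vord v (algebraMap (𝓞 E) E (2 ^ n)) = 0 := by
  rw [map_pow, map_ofNat, vord_pow, hS v hv, mul_zero]

theorem finite_quot_modulus (n : ℕ) : Finite (𝓞 E ⧸ modulus E S (2 ^ n)) :=
  Ideal.finiteQuotientOfFreeOfNeBot _ (modulus_ne_bot E S (pow_ne_zero n two_ne_zero))

/-- Square roots of one modulo `8J` are close to `±1` locally. -/
theorem near_sign {p : 𝓞 E} (hp : p ^ 2 - 1 ∈ modulus E S (2 ^ 3)) {v} (hv : v ∈ S) :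
    (p - 1 = 0 ∨ vord v (algebraMap (𝓞 E) E (2 ^ 2)) < vord v (algebraMap (𝓞 E) E (p - 1))) ∨
    (p + 1 = 0 ∨ vord v (algebraMap (𝓞 E) E (2 ^ 2)) < vord v (algebraMap (𝓞 E) E (p + 1))) := by
  by_cases h1 : p - 1 = 0
  · exact Or.inl (Or.inl h1)
  by_cases h2 : p + 1 = 0
  · exact Or.inr (Or.inl h2)
  have h3 : p ^ 2 - 1 = (p - 1) * (p + 1) := by ring
  have h30 : p ^ 2 - 1 ≠ 0 := by rw [h3]; exact mul_ne_zero h1 h2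
  have h4 := lt_vord_of_mem_modulus hv h30 hp
  have h1E : algebraMap (𝓞 E) E (p - 1) ≠ 0 := (map_ne_zero_iff _ (IsFractionRing.injective _ _)).2 h1
  have h2E : algebraMap (𝓞 E) E (p + 1) ≠ 0 := (map_ne_zero_iff _ (IsFractionRing.injective _ _)).2 h2
  rw [h3, map_mul, vord_mul v h1E h2E, map_pow, map_ofNat, vord_pow] at h4
  rw [map_pow, map_ofNat, vord_pow]
  simp only [Nat.cast_ofNat] at h4 ⊢
  by_contra! hcon
  have h5 : vord v (2 : E) + 1 ≤ vord v (2 : E) := by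
    have e : (2 : E) = algebraMap (𝓞 E) E (p + 1) + -algebraMap (𝓞 E) E (p - 1) := by
      rw [map_add, map_sub, map_one]; ring
    have := le_vord_add v (x := algebraMap (𝓞 E) E (p + 1)) (y := -algebraMap (𝓞 E) E (p - 1))
      (by rw [← e]; exact two_ne_zero) (vord v (2 : E) + 1) (Or.inr (by omega))
      (Or.inr (by rw [vord_neg]; omega))
    rwa [← e] at this
  omega

omit hS in
theorem modulus_le_modulus : modulus E S (2 ^ 3) ≤ modulus E S (2 ^ 2) :=
  Ideal.mul_mono_left (by
    rw [Ideal.span_singleton_le_span_singleton]; exact Dvd.intro 2 (by ring))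

omit hS in
theorem card_quot_modulus (n : ℕ) : Nat.card (𝓞 E ⧸ modulus E S (2 ^ n)) =
    (2 ^ finrank ℚ E) ^ n * Ideal.absNorm (S.inf fun v => v.asIdeal) := by
  have h1 : Nat.card (𝓞 E ⧸ modulus E S (2 ^ n)) = Ideal.absNorm (modulus E S (2 ^ n)) := by
    rw [Ideal.absNorm_apply, Submodule.cardQuot_apply]
  have h2 : Algebra.norm ℤ (2 : 𝓞 E) = 2 ^ finrank ℚ E := by
    have := Algebra.norm_algebraMap (S := 𝓞 E) (2 : ℤ)
    rw [map_ofNat] at this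
    rw [this, RingOfIntegers.rank]
  rw [h1, modulus, map_mul, ← Ideal.span_singleton_pow, map_pow, Ideal.absNorm_span_singleton, h2,
    Int.natAbs_pow]
  rfl

omit hS in
theorem card_ker_mul (I J : Ideal (𝓞 E)) (h : I ≤ J) :
    Nat.card (RingHom.ker (Ideal.Quotient.factor h)) * Nat.card (𝓞 E ⧸ J) = Nat.card (𝓞 E ⧸ I) := by
  have hsurj := Ideal.Quotient.factor_surjective h
  have h1 := AddSubgroup.card_mul_index (Ideal.Quotient.factor h).toAddMonoidHom.ker
  have h0 : (Ideal.Quotient.factor h).toAddMonoidHom.range = ⊤ :=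
    AddMonoidHom.range_eq_top.2 hsurj
  rw [AddSubgroup.index_ker, h0, AddSubgroup.card_top] at h1
  exact h1

omit hS in
theorem card_factor_ker :
    Nat.card (RingHom.ker (Ideal.Quotient.factor (modulus_le_modulus S))) = 2 ^ finrank ℚ E := by
  have h1 := card_ker_mul _ _ (modulus_le_modulus S)
  rw [card_quot_modulus, card_quot_modulus] at h1
  have hpos : 0 < Ideal.absNorm (S.inf fun v => v.asIdeal) := by
    rw [Nat.pos_iff_ne_zero, Ne, Ideal.absNorm_eq_zero_iff]; exact inf_ne_bot E S
  have h2 : 0 < 2 ^ finrank ℚ E := by positivity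
  generalize 2 ^ finrank ℚ E = N at *
  generalize Ideal.absNorm (S.inf fun v => v.asIdeal) = A at *
  refine Nat.eq_of_mul_eq_mul_right (show 0 < N ^ 2 * A by positivity) ?_
  rw [h1]; ring

theorem card_two_torsion_le :
    Nat.card (sqHom (𝓞 E ⧸ modulus E S (2 ^ 3))ˣ).ker ≤ 2 ^ (S.card + finrank ℚ E) := by
  classical
  have hfin := finite_quot_modulus S hS 3
  set f := Ideal.Quotient.factor (modulus_le_modulus S) with hf
  let G := (sqHom (𝓞 E ⧸ modulus E S (2 ^ 3))ˣ).ker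
  have hlift : ∀ z : G, ∃ p : 𝓞 E, Ideal.Quotient.mk _ p = (z.1 : 𝓞 E ⧸ modulus E S (2 ^ 3)) :=
    fun z => Ideal.Quotient.mk_surjective _
  choose lift hlift using hlift
  have hmem : ∀ z : G, lift z ^ 2 - 1 ∈ modulus E S (2 ^ 3) := by
    intro z
    rw [← Ideal.Quotient.eq_zero_iff_mem, map_sub, map_pow, hlift, map_one, sub_eq_zero]
    have := z.2
    rw [MonoidHom.mem_ker] at this
    have h2 := congrArg Units.val this
    simpa [sqHom] using h2
  let sgn : G → (S → Bool) := fun z v => decide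
    (lift z - 1 = 0 ∨ vord v.1 (algebraMap (𝓞 E) E (2 ^ 2)) <
      vord v.1 (algebraMap (𝓞 E) E (lift z - 1)))
  have key : ∀ z z' : G, sgn z = sgn z' →
      f ((z.1 : 𝓞 E ⧸ modulus E S (2 ^ 3)) - z'.1) = 0 := by
    intro z z' h
    rw [← hlift, ← hlift, ← map_sub, hf, Ideal.Quotient.factor_mk, Ideal.Quotient.eq_zero_iff_mem]
    refine mem_modulus_of_lt_vord (pow_ne_zero _ two_ne_zero) (vord_two_pow_eq_zero S hS 2) ?_
    intro v hv
    have h1 := congrFun h ⟨v, hv⟩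
    have hsub : ∀ x y : 𝓞 E,
        (x = 0 ∨ vord v (algebraMap (𝓞 E) E (2 ^ 2)) < vord v (algebraMap (𝓞 E) E x)) →
        (y = 0 ∨ vord v (algebraMap (𝓞 E) E (2 ^ 2)) < vord v (algebraMap (𝓞 E) E y)) →
        (x - y = 0 ∨ vord v (algebraMap (𝓞 E) E (2 ^ 2)) < vord v (algebraMap (𝓞 E) E (x - y))) := by
      intro x y hx hy
      by_cases h0 : x - y = 0
      · exact Or.inl h0
      right
      have := le_vord_add v (x := algebraMap (𝓞 E) E x) (y := -algebraMap (𝓞 E) E y)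
        (by rw [← sub_eq_add_neg, ← map_sub]
            exact (map_ne_zero_iff _ (IsFractionRing.injective _ _)).2 h0)
        (vord v (algebraMap (𝓞 E) E (2 ^ 2)) + 1)
        (hx.imp (fun h => by rw [h, map_zero]) (fun h => by omega))
        (hy.imp (fun h => by rw [h, map_zero, neg_zero]) (fun h => by rw [vord_neg]; omega))
      rw [← sub_eq_add_neg, ← map_sub] at this
      omega
    simp only [sgn, decide_eq_decide] at h1
    by_cases h2 : lift z - 1 = 0 ∨ vord v (algebraMap (𝓞 E) E (2 ^ 2)) <
      vord v (algebraMap (𝓞 E) E (lift z - 1))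
    · have := hsub _ _ h2 (h1.1 h2)
      rwa [sub_sub_sub_cancel_right] at this
    · have h3 := (near_sign S hS (hmem z) hv).resolve_left h2
      have h4 := (near_sign S hS (hmem z') hv).resolve_left (fun h => h2 (h1.2 h))
      have := hsub _ _ h3 h4
      rwa [add_sub_add_right_eq_sub] at this
  let base : (S → Bool) → G := fun e => if h : ∃ z, sgn z = e then h.choose else 1
  have hbase : ∀ z, sgn (base (sgn z)) = sgn z := by
    intro z
    have h : ∃ z', sgn z' = sgn z := ⟨z, rfl⟩
    simp only [base, dif_pos h]
    exact h.choose_spec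
  let F : G → (S → Bool) × RingHom.ker f := fun z =>
    (sgn z, ⟨(z.1 : 𝓞 E ⧸ modulus E S (2 ^ 3)) - (base (sgn z)).1, key _ _ (hbase z).symm⟩)
  have hF : Function.Injective F := by
    intro z z' h
    have h1 : sgn z = sgn z' := congrArg Prod.fst h
    have h2 := congrArg (fun x => (x.2 : 𝓞 E ⧸ modulus E S (2 ^ 3))) h
    simp only [F, h1] at h2
    exact Subtype.ext (Units.ext (sub_left_injective h2))
  have := Nat.card_le_card_of_injective F hF
  rw [Nat.card_prod, card_factor_ker S] at this
  refine this.trans (le_of_eq ?_)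
  rw [pow_add]; simp

theorem index_sqHom_range_le :
    (sqHom (𝓞 E ⧸ modulus E S (2 ^ 3))ˣ).range.index ≤ 2 ^ (S.card + finrank ℚ E) := by
  have hfin := finite_quot_modulus S hS 3
  refine le_of_eq_of_le ?_ (card_two_torsion_le S hS)
  have h1 := Subgroup.card_mul_index (sqHom (𝓞 E ⧸ modulus E S (2 ^ 3))ˣ).ker
  have h2 := Subgroup.card_mul_index (sqHom (𝓞 E ⧸ modulus E S (2 ^ 3))ˣ).range
  rw [Subgroup.index_ker] at h1
  have h3 : 0 < Nat.card (sqHom (𝓞 E ⧸ modulus E S (2 ^ 3))ˣ).range := Nat.card_pos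
  refine Nat.eq_of_mul_eq_mul_left h3 ?_
  rw [h2, ← h1, mul_comm]

theorem index_nearSq_le : (nearSq E S).index ≠ 0 ∧
    (nearSq E S).index ≤ 2 ^ (2 * S.card + finrank ℚ E) := by
  classical
  have hfin := finite_quot_modulus S hS 3
  -- the local units map onto the kernel of the parity map
  have hlift : ∀ β : (𝓞 E ⧸ modulus E S (2 ^ 3))ˣ, ∃ p : 𝓞 E, p ≠ 0 ∧
      Ideal.Quotient.mk _ p = (β : 𝓞 E ⧸ modulus E S (2 ^ 3)) := by
    intro β
    obtain ⟨p, hp⟩ := Ideal.Quotient.mk_surjective (β : 𝓞 E ⧸ modulus E S (2 ^ 3))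
    by_cases hp0 : p = 0
    · obtain ⟨m, hm, hm0⟩ := Submodule.exists_mem_ne_zero_of_ne_bot
        (modulus_ne_bot E S (m := 2 ^ 3) (pow_ne_zero _ two_ne_zero))
      refine ⟨m, hm0, ?_⟩
      rw [← hp, hp0, map_zero, Ideal.Quotient.eq_zero_iff_mem]
      exact hm
    · exact ⟨p, hp0, hp⟩
  have hcong : ∀ p q : 𝓞 E, ∀ (hp : p ≠ 0) (hq : q ≠ 0),
      Ideal.Quotient.mk (modulus E S (2 ^ 3)) p = Ideal.Quotient.mk _ q →
      IsUnit (Ideal.Quotient.mk (modulus E S (2 ^ 3)) q) →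
      Units.mk0 (algebraMap (𝓞 E) E p) (by simpa using hp) /
        Units.mk0 (algebraMap (𝓞 E) E q) (by simpa using hq) ∈ nearOne E S := by
    intro p q hp hq h hu v hv
    by_cases hpq : p - q = 0
    · left; rw [sub_eq_zero] at hpq; subst hpq; simp
    right
    rw [Ideal.Quotient.eq] at h
    have h1 := lt_vord_of_mem_modulus hv hpq h
    have hqE : algebraMap (𝓞 E) E q ≠ 0 := by simpa using hq
    have e : ((Units.mk0 (algebraMap (𝓞 E) E p) (by simpa using hp) /
        Units.mk0 (algebraMap (𝓞 E) E q) (by simpa using hq) : Eˣ) : E) - 1 =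
        algebraMap (𝓞 E) E (p - q) / algebraMap (𝓞 E) E q := by
      simp only [Units.val_div_eq_div_val, Units.val_mk0, map_sub]; field_simp
    have h2 : vord v (algebraMap (𝓞 E) E q) = 0 :=
      (vord_eq_zero_iff_notMem v hq).2 (notMem_of_isUnit_mk hu v hv)
    rw [e, vord_div v ((map_ne_zero_iff _ (IsFractionRing.injective _ _)).2 hpq) hqE, h2, sub_zero]
    refine lt_of_le_of_lt ?_ h1
    have h20 : 0 ≤ vord v (2 : E) := by
      have := vord_nonneg (K := E) v 2; rwa [map_ofNat] at this
    rw [map_pow, map_ofNat, vord_pow, show (4 : E) = 2 ^ 2 by norm_num, vord_pow]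
    push_cast; omega
  choose lift hl0 hl using hlift
  let g : (𝓞 E ⧸ modulus E S (2 ^ 3))ˣ → Eˣ := fun β =>
    Units.mk0 (algebraMap (𝓞 E) E (lift β)) (by simpa using hl0 β)
  let φ : (𝓞 E ⧸ modulus E S (2 ^ 3))ˣ →* Eˣ ⧸ nearSq E S :=
    MonoidHom.mk' (fun β => QuotientGroup.mk (g β)) (by
      intro β γ
      rw [← QuotientGroup.mk_mul, QuotientGroup.eq, ← inv_mem_iff]
      refine Subgroup.mem_sup_left ?_
      have := hcong (lift (β * γ)) (lift β * lift γ) (hl0 _) (mul_ne_zero (hl0 _) (hl0 _))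
        (by rw [map_mul, hl, hl, hl, Units.val_mul])
        (by rw [map_mul, hl, hl]; exact (β * γ).isUnit)
      convert this using 1
      rw [mul_inv_rev, inv_inv, div_eq_inv_mul]
      congr 1
      congr 1
      ext; simp [g])
  have hφ : ∀ p : 𝓞 E, ∀ hp : p ≠ 0, (∀ v ∈ S, p ∉ v.asIdeal) →
      (QuotientGroup.mk (Units.mk0 (algebraMap (𝓞 E) E p) (by simpa using hp)) :
        Eˣ ⧸ nearSq E S) ∈ φ.range := by
    intro p hp hpS
    obtain ⟨β, hβ⟩ := isUnit_mk_modulus (m := 2 ^ 3) (pow_ne_zero _ two_ne_zero)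
      (vord_two_pow_eq_zero S hS 3) hpS
    refine ⟨β, ?_⟩
    change QuotientGroup.mk (g β) = _
    rw [QuotientGroup.eq, ← div_eq_inv_mul]
    refine Subgroup.mem_sup_left ?_
    exact hcong p (lift β) hp (hl0 β) (by rw [hl, hβ]) (by rw [hl]; exact β.isUnit)
  -- the parity map
  let par : Eˣ →* (S → ℤˣ) := MonoidHom.mk' (fun x v => (vord v.1 (x : E)).negOnePow) (by
    intro x y; ext v
    rw [Units.val_mul, vord_mul v.1 x.ne_zero y.ne_zero, Int.negOnePow_add]; rfl)
  have hpar : ∀ x ∈ nearSq E S, par x = 1 := by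
    intro x hx
    obtain ⟨t, ht⟩ := (mem_nearSq_iff S x).1 hx
    funext v
    change (vord v.1 (x : E)).negOnePow = 1
    rw [Int.negOnePow_eq_one_iff]
    refine isSqNear_even v.1 ⟨t, t.ne_zero, ?_⟩
    have h4 : 0 ≤ vord v.1 (4 : E) := by
      have := vord_nonneg (K := E) v.1 4; rwa [map_ofNat] at this
    rcases ht v.1 v.2 with h | h
    · left; rwa [div_eq_one_iff_eq (pow_ne_zero 2 t.ne_zero)] at h
    · right; omega
  let ψ := QuotientGroup.lift (nearSq E S) par hpar
  have hker : ψ.ker ≤ φ.range := by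
    intro q hq
    obtain ⟨x, rfl⟩ := QuotientGroup.mk_surjective q
    have hev : ∀ v ∈ S, Even (vord v (x : E)) := by
      intro v hv
      have h1 : par x = 1 := hq
      rw [← Int.negOnePow_eq_one_iff]
      exact congrFun h1 ⟨v, hv⟩
    obtain ⟨t, ht0, ht⟩ := exists_vord_eq_int (K := E) S (fun v => vord v (x : E) / 2)
    obtain ⟨p, q, hp0, hq0, hp, hq, hpq⟩ := exists_div_of_forall_vord_eq_zero S
      (x := (x : E) / t ^ 2) (div_ne_zero x.ne_zero (pow_ne_zero 2 ht0)) (by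
        intro v hv
        rw [vord_div v x.ne_zero (pow_ne_zero 2 ht0), vord_pow, ht v hv]
        have := (hev v hv).two_dvd
        push_cast; omega)
    have hqE : algebraMap (𝓞 E) E q ≠ 0 := by simpa using hq0
    convert hφ (p * q) (mul_ne_zero hp0 hq0) (fun v hv hm =>
      (v.isPrime.mem_or_mem hm).elim (hp v hv) (hq v hv)) using 1
    rw [QuotientGroup.eq]
    refine Subgroup.mem_sup_right ⟨Units.mk0 (algebraMap (𝓞 E) E q / t) (div_ne_zero hqE ht0), ?_⟩
    rw [eq_inv_mul_iff_mul_eq]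
    ext
    rw [div_eq_iff (pow_ne_zero 2 ht0)] at hpq
    simp only [sqHom, powMonoidHom_apply, Units.val_mul, Units.val_pow_eq_pow_val, Units.val_mk0,
      map_mul]
    rw [hpq]; field_simp
  have hsq : (sqHom (𝓞 E ⧸ modulus E S (2 ^ 3))ˣ).range ≤ φ.ker := by
    rintro _ ⟨β, rfl⟩
    rw [MonoidHom.mem_ker, sqHom, powMonoidHom_apply, map_pow]
    change (QuotientGroup.mk (g β) : Eˣ ⧸ nearSq E S) ^ 2 = 1
    rw [← QuotientGroup.mk_pow, QuotientGroup.eq_one_iff]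
    exact Subgroup.mem_sup_right ⟨_, rfl⟩
  have hφcard : Nat.card φ.range ≤ 2 ^ (S.card + finrank ℚ E) := by
    rw [← Subgroup.index_ker]
    exact (Nat.le_of_dvd (Nat.pos_of_ne_zero Subgroup.index_ne_zero_of_finite)
      (Subgroup.index_dvd_of_le hsq)).trans (index_sqHom_range_le S hS)
  have hφfin : Finite φ.range := by
    have := Finite.of_surjective _ φ.rangeRestrict_surjective
    exact this
  have hkfin : Finite ψ.ker := Finite.of_injective _ (Subgroup.inclusion_injective hker)
  have hkcard : Nat.card ψ.ker ≤ 2 ^ (S.card + finrank ℚ E) :=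
    (Nat.card_le_card_of_injective _ (Subgroup.inclusion_injective hker)).trans hφcard
  have hrange : Nat.card ψ.range ≤ 2 ^ S.card := by
    refine (Nat.card_le_card_of_injective _ Subtype.val_injective).trans (le_of_eq ?_)
    simp [Nat.card_eq_fintype_card]
  have hcard := Subgroup.card_mul_index ψ.ker
  rw [Subgroup.index_ker] at hcard
  have hindex : (nearSq E S).index = Nat.card ψ.ker * Nat.card ψ.range := hcard.symm
  constructor
  · rw [hindex]
    have h1 : 0 < Nat.card ψ.ker := Nat.card_pos
    have h2 : 0 < Nat.card ψ.range := Nat.card_pos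
    positivity
  · rw [hindex]
    calc _ ≤ 2 ^ (S.card + finrank ℚ E) * 2 ^ S.card := Nat.mul_le_mul hkcard hrange
      _ = _ := by rw [← pow_add]; congr 1; ring

end Count

/-- If every element of `ker f` lies in `N ∪ c N`, then `N` has index at most `2 |A|`. -/
theorem index_le_two_mul_card {G A : Type*} [CommGroup G] [CommGroup A] [Finite A] (N : Subgroup G)
    (f : G →* A) (hN : N ≤ f.ker) (c : G) (h : ∀ g ∈ f.ker, g ∈ N ∨ c⁻¹ * g ∈ N) :
    N.index ≤ 2 * Nat.card A := by
  rw [← Subgroup.relIndex_mul_index hN, Subgroup.index_ker]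
  refine Nat.mul_le_mul ?_ (Subgroup.card_le_card_group _)
  by_cases hc : c ∈ f.ker
  · let g : Bool → f.ker ⧸ N.subgroupOf f.ker := fun b =>
      QuotientGroup.mk (if b then ⟨c, hc⟩ else 1)
    have hg : Function.Surjective g := by
      intro x
      obtain ⟨y, rfl⟩ := QuotientGroup.mk_surjective x
      rcases h y y.2 with h | h
      · refine ⟨false, ?_⟩
        simp only [g, Bool.false_eq_true, if_false]
        rw [QuotientGroup.eq, Subgroup.mem_subgroupOf]
        simpa using h
      · refine ⟨true, ?_⟩
        simp only [g, if_true]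
        rw [QuotientGroup.eq, Subgroup.mem_subgroupOf]
        simpa using h
    have := Nat.card_le_card_of_surjective g hg
    simpa [Subgroup.relIndex, Subgroup.index] using this
  · have : f.ker ≤ N := fun x hx => by
      rcases h x hx with h | h
      · exact h
      · exfalso
        have h1 := hN h
        rw [Subgroup.mul_mem_cancel_right _ hx, inv_mem_iff] at h1
        exact hc h1
    rw [Subgroup.relIndex_eq_one.2 this]; norm_num

section Select

variable {E : Type u} [Field E] [NumberField E]

theorem isSquare_or_of_isSquare_algebraMap {M : Type*} [Field M] [NumberField M] [Algebra E M]
    {a : E} {r : M} {σ : M ≃ₐ[E] M} (h : IsQuadExt a r σ) {u : E} (hu : IsSquare (algebraMap E M u)) :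
    IsSquare u ∨ IsSquare (u / a) := by
  obtain ⟨x, hx⟩ := hu
  have inj := (algebraMap E M).injective
  have h1 : σ x * σ x = x * x := by rw [← map_mul, ← hx, AlgEquiv.commutes]
  rcases mul_self_eq_mul_self_iff.1 h1 with h2 | h2
  · obtain ⟨y, rfl⟩ := h.exists_of_map_eq h2
    exact Or.inl ⟨y, inj (by rw [hx, map_mul])⟩
  · obtain ⟨y, hy⟩ := h.exists_of_map_eq (m := x * r) (by rw [map_mul, h2, h.map_r]; ring)
    refine Or.inr ⟨y / a, ?_⟩
    have h3 : u * a = y * y := inj (by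
      rw [map_mul, map_mul, hy, hx, ← h.sq]; ring)
    have ha := h.a_ne_zero
    field_simp
    linear_combination h3

theorem isSqNear_algebraMap {M : Type*} [Field M] [NumberField M] [Algebra E M]
    (w : HeightOneSpectrum (𝓞 M)) {u : E} (h : IsSqNear (below E w) u) :
    IsSqNear w (algebraMap E M u) := by
  obtain ⟨t, ht, h⟩ := h
  refine ⟨algebraMap E M t, by simpa using ht, ?_⟩
  rcases h with h | h
  · left; rw [h, map_pow]
  · right
    rw [← map_pow, ← map_div₀, ← map_one (algebraMap E M), ← map_sub]
    exact (vord_algebraMap_pos_iff w _).2 h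

/-- The Legendre symbols at places outside `S`, on `S`-units. -/
def legHom (S T : Finset (HeightOneSpectrum (𝓞 E))) (hST : Disjoint S T) :
    (S : Set (HeightOneSpectrum (𝓞 E))).unit E →* (T → ℤˣ) where
  toFun x w := leg w.1 ((x : Eˣ) : E)
  map_one' := by
    funext w
    simpa using leg_sq w.1 (E := E) one_ne_zero
  map_mul' x y := by
    funext w
    have hw : (w : HeightOneSpectrum (𝓞 E)) ∉ (S : Set (HeightOneSpectrum (𝓞 E))) := fun h =>
      (Finset.disjoint_left.1 hST) h w.2
    have h1 := (mem_unit_iff _ _).1 x.2 _ hw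
    have h2 := (mem_unit_iff _ _).1 y.2 _ hw
    exact leg_mul w.1 x.1.ne_zero y.1.ne_zero (by rw [h1]; exact Even.zero)
      (by rw [h2]; exact Even.zero)

theorem legHom_apply (S T : Finset (HeightOneSpectrum (𝓞 E))) (hST : Disjoint S T) (x) (w : T) :
    legHom S T hST x w = leg w.1 ((x : Eˣ) : E) := rfl

/-- Auxiliary places splitting in `E(√c)` at which the `S`-units have independent Legendre
symbols. -/
theorem exists_auxiliary_places (S : Finset (HeightOneSpectrum (𝓞 E)))
    {c : E} (hc : ¬ IsSquare c) (hcS : ∀ v ∉ S, vord v c = 0) (j : ℕ)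
    (hj : j ≤ Units.rank E + S.card) :
    ∃ (T : Finset (HeightOneSpectrum (𝓞 E))) (hST : Disjoint S T), T.card = j ∧
      (∀ w ∈ T, IsSqNear w c) ∧ Function.Surjective (legHom S T hST) := by
  classical
  have hc0 : c ≠ 0 := by rintro rfl; exact hc ⟨0, by simp⟩
  induction j with
  | zero =>
    refine ⟨∅, Finset.disjoint_empty_right _, rfl, by simp, fun ε => ⟨1, ?_⟩⟩
    funext w; exact absurd w.2 (Finset.notMem_empty _)
  | succ j ih =>
    obtain ⟨T, hST, hTj, hTc, hTs⟩ := ih (by omega)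
    set U := (S : Set (HeightOneSpectrum (𝓞 E))).unit E with hU
    let cU : U := ⟨Units.mk0 c hc0, (mem_unit_iff _ _).2 fun v hv => hcS v hv⟩
    obtain ⟨u, hu1, hu2, hu3⟩ : ∃ u ∈ (legHom S T hST).ker, u ∉ (sqHom U).range ∧
        cU⁻¹ * u ∉ (sqHom U).range := by
      by_contra! hcon
      have hN : (sqHom U).range ≤ (legHom S T hST).ker := by
        rintro _ ⟨x, rfl⟩
        rw [MonoidHom.mem_ker]
        funext w
        exact leg_sq w.1 x.1.ne_zero
      have h1 := index_le_two_mul_card _ _ hN cU (fun g hg => by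
        by_contra! h; exact h.2 (hcon g hg h.1))
      rw [index_sqHom_range_sUnit, Nat.card_fun, Nat.card_eq_fintype_card (α := T),
        Fintype.card_coe, hTj, Nat.card_eq_fintype_card (α := ℤˣ), Fintype.card_units_int] at h1
      have h2 : Nat.card (S : Set (HeightOneSpectrum (𝓞 E))) = S.card := by simp
      rw [h2, ← pow_succ', Nat.pow_le_pow_iff_right (by norm_num)] at h1
      omega
    have hsqU : ∀ x : U, IsSquare ((x : Eˣ) : E) → x ∈ (sqHom U).range := by
      rintro x ⟨y, hy⟩
      have hy0 : y ≠ 0 := by rintro rfl; simp at hy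
      refine ⟨⟨Units.mk0 y hy0, (mem_unit_iff _ _).2 fun v hv => ?_⟩, ?_⟩
      · have h1 := (mem_unit_iff _ _).1 x.2 v hv
        rw [hy, vord_mul v hy0 hy0] at h1
        rw [Units.val_mk0]; omega
      · apply Subtype.ext; apply Units.ext
        simp [sqHom, hy, sq]
    obtain ⟨M, _, _, _, r, σ, h⟩ := exists_isQuadExt hc
    have huM : ¬ IsSquare (algebraMap E M ((u : Eˣ) : E)) := by
      intro h1
      rcases isSquare_or_of_isSquare_algebraMap h h1 with h1 | h1
      · exact hu2 (hsqU _ h1)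
      · refine hu3 (hsqU _ ?_)
        convert h1 using 1
        simp [cU, div_eq_inv_mul]
    have hfin := finite_below_preimage (E := E) (M := M) ((S ∪ T : Finset _) : Set _)
    obtain ⟨W, hW1, hW2⟩ := exists_not_isSqNear huM (Set.toFinite
      {w : HeightOneSpectrum (𝓞 M) | below E w ∈ ((S ∪ T : Finset _) : Set _)}).toFinset
    set w := below E W with hw
    have hwST : w ∉ S ∪ T := by simpa using hW1
    have hwS : w ∉ S := fun h => hwST (Finset.mem_union_left _ h)
    have hwT : w ∉ T := fun h => hwST (Finset.mem_union_right _ h)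
    have hU0 : ∀ x : U, vord w ((x : Eˣ) : E) = 0 := fun x => (mem_unit_iff _ _).1 x.2 _ hwS
    have hwu : leg w ((u : Eˣ) : E) = -1 := by
      rcases Int.units_eq_one_or (leg w ((u : Eˣ) : E)) with h1 | h1
      · exact absurd (isSqNear_algebraMap W ((leg_eq_one_iff _ _).1 h1)) hW2
      · exact h1
    have hwc : leg w c = 1 := by
      rcases Int.units_eq_one_or (leg w c) with h1 | h1
      · exact h1
      · exfalso
        have h2 : leg w (((u : Eˣ) : E) * c) = 1 := by
          rw [leg_mul w u.1.ne_zero hc0 (by rw [hU0]; exact Even.zero)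
            (by rw [hcS w hwS]; exact Even.zero), hwu, h1]; rfl
        have h3 := isSqNear_algebraMap W ((leg_eq_one_iff _ _).1 h2)
        rw [map_mul, ← h.sq, isSqNear_mul_sq W h.r_ne_zero] at h3
        exact hW2 h3
    have hST' : Disjoint S (insert w T) := Finset.disjoint_insert_right.2 ⟨hwS, hST⟩
    refine ⟨insert w T, hST', by rw [Finset.card_insert_of_notMem hwT, hTj], ?_, ?_⟩
    · intro w' hw'
      rcases Finset.mem_insert.1 hw' with rfl | hw'
      · exact (leg_eq_one_iff _ _).1 hwc
      · exact hTc w' hw'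
    · intro ε
      obtain ⟨x, hx⟩ := hTs fun t => ε ⟨t, Finset.mem_insert_of_mem t.2⟩
      have hx' : ∀ t (ht : t ∈ T), leg t ((x : Eˣ) : E) = ε ⟨t, Finset.mem_insert_of_mem ht⟩ :=
        fun t ht => congrFun hx ⟨t, ht⟩
      have hu' : ∀ t (ht : t ∈ T), leg t ((u : Eˣ) : E) = 1 := fun t ht =>
        congrFun (MonoidHom.mem_ker.1 hu1) ⟨t, ht⟩
      by_cases hxw : leg w ((x : Eˣ) : E) = ε ⟨w, Finset.mem_insert_self _ _⟩
      · refine ⟨x, ?_⟩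
        funext ⟨t, ht⟩
        rw [legHom_apply]
        rcases Finset.mem_insert.1 ht with rfl | ht'
        · exact hxw
        · exact hx' t ht'
      · refine ⟨u * x, ?_⟩
        rw [map_mul]
        funext ⟨t, ht⟩
        rw [Pi.mul_apply, legHom_apply, legHom_apply]
        rcases Finset.mem_insert.1 ht with rfl | ht'
        · rw [hwu]
          rcases Int.units_eq_one_or (leg w ((x : Eˣ) : E)) with h1 | h1 <;>
          rcases Int.units_eq_one_or (ε ⟨w, Finset.mem_insert_self _ _⟩) with h2 | h2 <;>
          simp_all
        · rw [hu' t ht', one_mul]; exact hx' t ht'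

end Select

section Hasse

variable {E : Type u} [Field E] [NumberField E]

/-- At an odd nonsplit place of even order, the radicand is a nonsquare. -/
theorem leg_eq_neg_one_of_nonsplit {M : Type*} [Field M] [NumberField M] [Algebra E M] {a : E}
    {r : M} {σ : M ≃ₐ[E] M} (h : IsQuadExt a r σ) {v : HeightOneSpectrum (𝓞 E)}
    (hv2 : vord v (2 : E) = 0) (hv : Nonsplit M v) : leg v a = -1 := by
  rcases Int.units_eq_one_or (leg v a) with h1 | h1
  · exfalso
    obtain ⟨t, ht, h2⟩ := (leg_eq_one_iff _ _).1 h1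
    rcases h2 with h2 | h2
    · exact h.not_isSquare ⟨t, by rw [h2]; ring⟩
    · obtain ⟨w, rfl⟩ := exists_below_eq (E := E) M v
      have h4 : vord (below E w) (4 : E) = 0 := by
        rw [show (4 : E) = 2 ^ 2 by norm_num, vord_pow, hv2, mul_zero]
      exact h.conj_ne_of_close ht (by rwa [h4]) ((h.nonsplit_iff w).1 hv)
  · exact h1

/-- Tame symbols at finitely many places. -/
def tameHom {a : E} (ha : a ≠ 0) (ι : Type*) (p : ι → HeightOneSpectrum (𝓞 E)) :
    Eˣ →* (ι → ℤˣ) where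
  toFun x i := tame (p i) ha x
  map_one' := by funext i; exact map_one _
  map_mul' x y := by funext i; exact map_mul _ _ _

theorem tameHom_apply {a : E} (ha : a ≠ 0) (ι : Type*) (p : ι → HeightOneSpectrum (𝓞 E)) (x : Eˣ)
    (i : ι) : tameHom ha ι p x i = tame (p i) ha x := rfl

/-- An element has the prescribed tame symbols as soon as its orders and Legendre symbols are
as prescribed. -/
theorem tame_eq_of_nonsplit {M : Type*} [Field M] [NumberField M] [Algebra E M] {a : E}
    {r : M} {σ : M ≃ₐ[E] M} (h : IsQuadExt a r σ) {v : HeightOneSpectrum (𝓞 E)}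
    (hv2 : vord v (2 : E) = 0) (hv : Nonsplit M v) (ε : ℤˣ) (x : Eˣ)
    (hx1 : vord v (x : E) = if Even (vord v a) ∧ ε = -1 then 1 else 0)
    (hx2 : Odd (vord v a) → leg v (x : E) = ε) : tame v h.a_ne_zero x = ε := by
  by_cases hev : Even (vord v a)
  · rw [tame_of_even v _ hev, leg_eq_neg_one_of_nonsplit h hv2 hv, hx1]
    rcases Int.units_eq_one_or ε with rfl | rfl <;> simp [hev]
  · rw [tame_of_odd v _ (Int.not_even_iff_odd.1 hev) _ (by rw [hx1, if_neg]; exact fun h => hev h.1)]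
    exact hx2 (Int.not_even_iff_odd.1 hev)

theorem tameHom_surjective {M : Type*} [Field M] [NumberField M] [Algebra E M] {a : E}
    {r : M} {σ : M ≃ₐ[E] M} (h : IsQuadExt a r σ) (S : Finset (HeightOneSpectrum (𝓞 E)))
    (hS : ∀ v ∈ S, vord v (2 : E) = 0 ∧ Nonsplit M v) :
    Function.Surjective (tameHom h.a_ne_zero S fun v => v.1) := by
  classical
  intro ε
  let ε' : HeightOneSpectrum (𝓞 E) → ℤˣ := fun v => if hv : v ∈ S then ε ⟨v, hv⟩ else 1
  obtain ⟨y, hy0, hy⟩ := exists_vord_eq_int (K := E) S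
    (fun v => if Even (vord v a) ∧ ε' v = -1 then 1 else 0)
  have hp : ∀ v, ∃ p : 𝓞 E, v ∈ S → p ∉ v.asIdeal ∧
      leg v (algebraMap (𝓞 E) E p) = ε' v * leg v y := fun v => by
    by_cases hv : v ∈ S
    · obtain ⟨p, hp⟩ := exists_unit_leg_eq v (hS v hv).1 (ε' v * leg v y)
      exact ⟨p, fun _ => hp⟩
    · exact ⟨0, fun h => absurd h hv⟩
  choose p hp using hp
  rcases S.eq_empty_or_nonempty with rfl | ⟨v0, hv0⟩
  · exact ⟨1, by funext v; exact absurd v.2 (Finset.notMem_empty _)⟩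
  obtain ⟨q, hq⟩ := exists_sub_mem_pow S p (fun _ => 1)
  have hqv : ∀ v ∈ S, q ∉ v.asIdeal := fun v hv hq' => (hp v hv).1 (by
    have := sub_mem hq' (by simpa using hq v hv : q - p v ∈ v.asIdeal)
    simpa using this)
  have hq0 : q ≠ 0 := by rintro rfl; exact hqv v0 hv0 (zero_mem _)
  have hqE : algebraMap (𝓞 E) E q ≠ 0 := (map_ne_zero_iff _ (IsFractionRing.injective _ _)).2 hq0
  have hqo : ∀ v ∈ S, vord v (algebraMap (𝓞 E) E q) = 0 := fun v hv =>
    (vord_eq_zero_iff_notMem v hq0).2 (hqv v hv)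
  have hlq : ∀ v ∈ S, leg v (algebraMap (𝓞 E) E q) = ε' v * leg v y := fun v hv => by
    rw [← (hp v hv).2]
    have h1 : Ideal.Quotient.mk v.asIdeal q = Ideal.Quotient.mk v.asIdeal (p v) :=
      Ideal.Quotient.eq.2 (by simpa using hq v hv)
    unfold leg
    rw [isSqNear_algebraMap_iff v (hqv v hv), isSqNear_algebraMap_iff v (hp v hv).1, h1]
  refine ⟨Units.mk0 _ (mul_ne_zero hqE hy0), ?_⟩
  funext ⟨v, hv⟩
  have hε : ε ⟨v, hv⟩ = ε' v := by simp [ε', hv]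
  rw [tameHom_apply, hε]
  apply tame_eq_of_nonsplit h (hS v hv).1 (hS v hv).2
  · rw [Units.val_mk0, vord_mul v hqE hy0, hqo v hv, zero_add, hy v hv]
  · intro hodd
    have hy1 : vord v y = 0 := by
      rw [hy v hv, if_neg]; exact fun h => Int.not_even_iff_odd.2 hodd h.1
    rw [Units.val_mk0, leg_mul v hqE hy0 (by rw [hqo v hv]; exact Even.zero)
      (by rw [hy1]; exact Even.zero), hlq v hv, mul_assoc, ← sq, Int.units_sq, mul_one]

variable (S T : Finset (HeightOneSpectrum (𝓞 E))) (hST : Disjoint S T)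
  (hS2 : ∀ v ∉ S, vord v (2 : E) = 0)
  (hcl : ∀ n : HeightOneSpectrum (𝓞 E) → ℤ, (Function.support n).Finite →
      ∃ x : E, x ≠ 0 ∧ ∀ v ∉ S, vord v x = n v)
  (hTs : Function.Surjective (legHom S T hST))
include hS2 hcl hTs

/-- A quadratic extension unramified outside `T` and split over `S` is trivial. -/
theorem isSquare_of_nearSq [IsTotallyComplex E] {a : E} (ha0 : a ≠ 0)
    (ha : ∀ v ∉ S, v ∉ T → vord v a = 0)
    (hn : Units.mk0 a ha0 ∈ nearSq E S) : IsSquare a := by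
  classical
  by_contra hsq
  obtain ⟨M, _, _, _, r, σ, h⟩ := exists_isQuadExt hsq
  let W := T.filter (Nonsplit M)
  have hW : ∀ v ∈ S ∪ T, Nonsplit M v → v ∈ W := by
    intro v hv hv'
    refine Finset.mem_filter.2 ⟨(Finset.mem_union.1 hv).resolve_left fun hvS => ?_, hv'⟩
    obtain ⟨t, ht⟩ := (mem_nearSq_iff S _).1 hn
    rcases ht v hvS with h1 | h1
    · rw [Units.val_mk0, div_eq_one_iff_eq (pow_ne_zero 2 t.ne_zero)] at h1
      exact hsq ⟨t, by rw [h1]; ring⟩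
    · obtain ⟨w, rfl⟩ := exists_below_eq (E := E) M v
      exact h.conj_ne_of_close t.ne_zero h1 ((h.nonsplit_iff w).1 hv')
  obtain ⟨H, hH1, hH2⟩ := h.exists_norm_subgroup ((S ∪ T : Finset _) : Set _)
    (fun v hv => hS2 v fun h => hv (by simp [h]))
    (fun v hv => by
      rw [ha v (fun h => hv (by simp [h])) (fun h => hv (by simp [h]))]; exact Even.zero)
    (fun n hn => by
      obtain ⟨x, hx0, hx⟩ := hcl n hn
      exact ⟨x, hx0, fun v hv => hx v fun h => hv (by simp [h])⟩)
  have hWcard : Nat.card {v : ((S ∪ T : Finset _) : Set (HeightOneSpectrum (𝓞 E))) //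
      Nonsplit M v.1} = W.card := by
    rw [← Fintype.card_coe, ← Nat.card_eq_fintype_card]
    refine Nat.card_congr ⟨fun v => ⟨v.1.1, hW _ v.1.2 v.2⟩, fun v => ⟨⟨v.1, ?_⟩, ?_⟩, ?_, ?_⟩
    · exact Finset.mem_coe.2 (Finset.mem_union_right _ (Finset.mem_filter.1 v.2).1)
    · exact (Finset.mem_filter.1 v.2).2
    · intro v; rfl
    · intro v; rfl
  rw [hWcard] at hH2
  let U' := ((S ∪ T : Finset _) : Set (HeightOneSpectrum (𝓞 E))).unit E
  let τ : U' →* (W → ℤˣ) := (tameHom h.a_ne_zero W fun v => v.1).comp U'.subtype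
  have hτH : H ≤ τ.ker := by
    intro z hz
    obtain ⟨x, y, hxy⟩ := hH1 z hz
    rw [MonoidHom.mem_ker]
    funext w
    exact tame_norm w.1 h.a_ne_zero _ x y hxy
  have hWT : ∀ w ∈ W, w ∈ T := fun w hw => (Finset.mem_filter.1 hw).1
  have hTS : ∀ w ∈ T, w ∉ S := fun w hw h => Finset.disjoint_left.1 hST h hw
  have hτs : Function.Surjective τ := by
    intro ε
    let ε' : HeightOneSpectrum (𝓞 E) → ℤˣ := fun v => if hv : v ∈ W then ε ⟨v, hv⟩ else 1
    obtain ⟨y, hy0, hy⟩ := hcl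
      (fun v => if v ∈ W then (if Even (vord v a) ∧ ε' v = -1 then 1 else 0) else 0)
      (W.finite_toSet.subset fun v hv => by
        by_contra h; exact hv (if_neg (by simpa using h)))
    obtain ⟨u, hu⟩ := hTs fun w => ε' w * leg w.1 y
    have hu0 : ∀ v ∉ S, vord v ((u : Eˣ) : E) = 0 := fun v hv => (mem_unit_iff _ _).1 u.2 v hv
    refine ⟨⟨u.1 * Units.mk0 y hy0, (mem_unit_iff _ _).2 fun v hv => ?_⟩, ?_⟩
    · have hv' : v ∉ S ∪ T := by simpa using hv
      have hvS : v ∉ S := fun h => hv' (Finset.mem_union_left _ h)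
      rw [Units.val_mul, Units.val_mk0, vord_mul v u.1.ne_zero hy0, hu0 v hvS, hy v hvS, if_neg]
      · rfl
      · exact fun h => hv' (Finset.mem_union_right _ (hWT v h))
    · funext ⟨w, hw⟩
      have hε : ε ⟨w, hw⟩ = ε' w := by simp [ε', hw]
      rw [hε]
      have hwS := hTS w (hWT w hw)
      apply tame_eq_of_nonsplit h (hS2 w hwS) (Finset.mem_filter.1 hw).2
      · simp only [Subgroup.subtype_apply, Units.val_mul, Units.val_mk0]
        rw [vord_mul w u.1.ne_zero hy0, hu0 w hwS, hy w hwS, if_pos hw, zero_add]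
      · intro hodd
        have hy1 : vord w y = 0 := by
          rw [hy w hwS, if_pos hw, if_neg]; exact fun h => Int.not_even_iff_odd.2 hodd h.1
        have hlu : leg w ((u : Eˣ) : E) = ε' w * leg w y := congrFun hu ⟨w, hWT w hw⟩
        simp only [Subgroup.subtype_apply, Units.val_mul, Units.val_mk0]
        rw [leg_mul w u.1.ne_zero hy0 (by rw [hu0 w hwS]; exact Even.zero)
          (by rw [hy1]; exact Even.zero), hlu, mul_assoc, ← sq, Int.units_sq, mul_one]
  have h1 : τ.ker.index = 2 ^ W.card := by
    rw [Subgroup.index_ker, MonoidHom.range_eq_top.2 hτs, Subgroup.card_top, Nat.card_fun,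
      Nat.card_eq_fintype_card (α := W), Fintype.card_coe, Nat.card_eq_fintype_card (α := ℤˣ),
      Fintype.card_units_int]
  have h2 := Subgroup.index_dvd_of_le hτH
  have h3 : H.index ≠ 0 := by
    intro h0; rw [h0, mul_zero] at hH2; exact pow_ne_zero _ two_ne_zero hH2.symm
  have h4 := Nat.le_of_dvd (Nat.pos_of_ne_zero h3) h2
  rw [h1] at h4
  have := Nat.pos_of_ne_zero h3
  omega

end Hasse

section Hasse

variable {E : Type u} [Field E] [NumberField E]

/-- The norm theorem for `E(√c)/E`, when `c` is close to a square at all dyadic places. -/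
theorem exists_norm_of_tame [IsTotallyComplex E] (S : Finset (HeightOneSpectrum (𝓞 E)))
    (hS2 : ∀ v ∉ S, vord v (2 : E) = 0)
    (hcl : ∀ n : HeightOneSpectrum (𝓞 E) → ℤ, (Function.support n).Finite →
      ∃ x : E, x ≠ 0 ∧ ∀ v ∉ S, vord v x = n v)
    {c : E} (hc : ¬ IsSquare c) (hc0 : c ≠ 0) (hcS : ∀ v ∉ S, vord v c = 0)
    (hcd : ∀ v ∈ S, vord v (2 : E) ≠ 0 → ∃ t : E, t ≠ 0 ∧ vord v (4 : E) < vord v (c / t ^ 2 - 1))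
    (z : Eˣ) (hz : ∀ v ∉ S, vord v (z : E) = 0)
    (hzt : ∀ v ∈ S, vord v (2 : E) = 0 → tame v hc0 z = 1) :
    ∃ x y : E, (z : E) = x ^ 2 - c * y ^ 2 := by
  classical
  obtain ⟨T, hST, hTcard, hTc, hTs⟩ := exists_auxiliary_places S hc hcS _ le_rfl
  obtain ⟨M, _, _, _, r, σ, h⟩ := exists_isQuadExt hc
  let S' := S.filter (Nonsplit M)
  have hTS : ∀ w ∈ T, w ∉ S := fun w hw h => Finset.disjoint_left.1 hST h hw
  have hS' : ∀ v ∈ S ∪ T, Nonsplit M v → v ∈ S' := by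
    intro v hv hv'
    refine Finset.mem_filter.2 ⟨(Finset.mem_union.1 hv).resolve_right fun hvT => ?_, hv'⟩
    have h1 := leg_eq_neg_one_of_nonsplit h (hS2 v (hTS v hvT)) hv'
    rw [(leg_eq_one_iff _ _).2 (hTc v hvT)] at h1
    exact absurd h1 (by decide)
  have hS'2 : ∀ v ∈ S', vord v (2 : E) = 0 ∧ Nonsplit M v := by
    intro v hv
    obtain ⟨hvS, hv'⟩ := Finset.mem_filter.1 hv
    refine ⟨?_, hv'⟩
    by_contra h2
    obtain ⟨t, ht, h1⟩ := hcd v hvS h2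
    obtain ⟨w, rfl⟩ := exists_below_eq (E := E) M v
    exact h.conj_ne_of_close ht h1 ((h.nonsplit_iff w).1 hv')
  let U' := ((S ∪ T : Finset _) : Set (HeightOneSpectrum (𝓞 E))).unit E
  obtain ⟨H, hH1, hH2⟩ := h.exists_norm_subgroup ((S ∪ T : Finset _) : Set _)
    (fun v hv => hS2 v fun h => hv (by simp [h]))
    (fun v hv => by rw [hcS v fun h => hv (by simp [h])]; exact Even.zero)
    (fun n hn => by
      obtain ⟨x, hx0, hx⟩ := hcl n hn
      exact ⟨x, hx0, fun v hv => hx v fun h => hv (by simp [h])⟩)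
  have hcard : Nat.card {v : ((S ∪ T : Finset _) : Set (HeightOneSpectrum (𝓞 E))) //
      Nonsplit M v.1} = S'.card := by
    rw [← Fintype.card_coe, ← Nat.card_eq_fintype_card]
    refine Nat.card_congr ⟨fun v => ⟨v.1.1, hS' _ v.1.2 v.2⟩, fun v => ⟨⟨v.1, ?_⟩, ?_⟩, ?_, ?_⟩
    · exact Finset.mem_coe.2 (Finset.mem_union_left _ (Finset.mem_filter.1 v.2).1)
    · exact (Finset.mem_filter.1 v.2).2
    · intro v; rfl
    · intro v; rfl
  rw [hcard] at hH2
  let τ := tameHom h.a_ne_zero S' fun v => v.1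
  have hτH : H ≤ τ.ker.subgroupOf U' := by
    intro z hz
    obtain ⟨x, y, hxy⟩ := hH1 z hz
    rw [Subgroup.mem_subgroupOf, MonoidHom.mem_ker]
    funext w
    exact tame_norm w.1 h.a_ne_zero _ x y hxy
  have hτi : τ.ker.index = 2 ^ S'.card := by
    rw [Subgroup.index_ker, MonoidHom.range_eq_top.2 (tameHom_surjective h S' hS'2),
      Subgroup.card_top, Nat.card_fun, Nat.card_eq_fintype_card (α := S'), Fintype.card_coe,
      Nat.card_eq_fintype_card (α := ℤˣ), Fintype.card_units_int]
  have hX : nearSq E S ≤ τ.ker := by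
    intro x hx
    obtain ⟨t, ht⟩ := (mem_nearSq_iff S x).1 hx
    rw [MonoidHom.mem_ker]
    funext ⟨v, hv⟩
    refine tame_isSqNear v h.a_ne_zero x ⟨t, t.ne_zero, ?_⟩
    refine (ht v (Finset.mem_filter.1 hv).1).imp (fun h1 => ?_) fun h1 => ?_
    · rwa [div_eq_one_iff_eq (pow_ne_zero 2 t.ne_zero)] at h1
    · rwa [show (4 : E) = 2 ^ 2 by norm_num, vord_pow, (hS'2 v hv).1, mul_zero] at h1
  have hsub : (nearSq E S).subgroupOf U' ≤ (sqHom U').range := by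
    intro x hx
    have hx' : ∀ v ∉ S ∪ T, vord v ((x : Eˣ) : E) = 0 := fun v hv =>
      (mem_unit_iff _ _).1 x.2 v (by simpa using hv)
    obtain ⟨y, hy⟩ := isSquare_of_nearSq S T hST hS2 hcl hTs x.1.ne_zero
      (fun v h1 h2 => hx' v (by simp [h1, h2]))
      (by simpa using Subgroup.mem_subgroupOf.1 hx)
    have hy0 : y ≠ 0 := by rintro rfl; simp at hy
    refine ⟨⟨Units.mk0 y hy0, (mem_unit_iff _ _).2 fun v hv => ?_⟩, ?_⟩
    · have h1 := hx' v (by simpa using hv)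
      rw [hy, vord_mul v hy0 hy0] at h1
      rw [Units.val_mk0]; omega
    · apply Subtype.ext; apply Units.ext
      simp [sqHom, hy, sq]
  set s := Units.rank E + S.card + 1 with hs
  have hUi : (sqHom U').range.index = 2 ^ (2 * s - 1) := by
    rw [index_sqHom_range_sUnit]
    congr 1
    have : Nat.card ((S ∪ T : Finset _) : Set (HeightOneSpectrum (𝓞 E))) = S.card + T.card := by
      rw [← Finset.card_union_of_disjoint hST]; simp
    rw [this, hTcard]; omega
  obtain ⟨hn0, hn1⟩ := index_nearSq_le S hS2
  have hn2 : 2 * S.card + finrank ℚ E = 2 * s := by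
    have h1 := Units.rank E
    rw [IsTotallyComplex.finrank, hs, Units.rank, InfinitePlace.card_eq_nrRealPlaces_add_nrComplexPlaces,
      IsTotallyComplex.nrRealPlaces_eq_zero]
    have : 0 < InfinitePlace.nrComplexPlaces E := by
      have := finrank_pos (R := ℚ) (M := E)
      rw [IsTotallyComplex.finrank] at this; omega
    omega
  rw [hn2] at hn1
  have e1 : (nearSq E S).relIndex U' * (U' ⊔ nearSq E S).index = (nearSq E S).index := by
    rw [← Subgroup.relIndex_sup_right, sup_comm]
    exact Subgroup.relIndex_mul_index le_sup_left
  have e2 : 2 ^ (2 * s - 1) ≤ (nearSq E S).relIndex U' := by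
    rw [← hUi]
    refine Nat.le_of_dvd (Nat.pos_of_ne_zero fun h0 => hn0 ?_) (Subgroup.index_dvd_of_le hsub)
    rw [← e1]; change (nearSq E S).relIndex U' = 0 at h0; rw [h0, zero_mul]
  have e3 : (U' ⊔ nearSq E S).index ≤ 2 := by
    have h1 : 2 ^ (2 * s - 1) * (U' ⊔ nearSq E S).index ≤ 2 ^ (2 * s - 1) * 2 := by
      rw [← pow_succ, show 2 * s - 1 + 1 = 2 * s by omega]
      exact (Nat.mul_le_mul_right _ e2).trans (e1.le.trans hn1)
    exact Nat.le_of_mul_le_mul_left h1 (by positivity)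
  have e4 : (U' ⊔ nearSq E S).index ≠ 0 := fun h0 => hn0 (by rw [← e1, h0, mul_zero])
  have e5 : (U' ⊔ τ.ker).index ≤ 2 :=
    (Nat.le_of_dvd (Nat.pos_of_ne_zero e4) (Subgroup.index_dvd_of_le (sup_le_sup_left hX _))).trans e3
  have e6 : τ.ker.relIndex U' * (U' ⊔ τ.ker).index = τ.ker.index := by
    rw [← Subgroup.relIndex_sup_right, sup_comm]
    exact Subgroup.relIndex_mul_index le_sup_left
  have e7 : H.index ≤ (τ.ker.subgroupOf U').index := by
    have : 2 * H.index ≤ 2 * (τ.ker.subgroupOf U').index := by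
      rw [hH2, ← hτi, ← e6, mul_comm]
      exact Nat.mul_le_mul_right _ e5
    omega
  have e8 : H.index ≠ 0 := by
    intro h0; rw [h0, mul_zero] at hH2; exact pow_ne_zero _ two_ne_zero hH2.symm
  have e9 : τ.ker.subgroupOf U' ≤ H := by
    rw [← Subgroup.relIndex_eq_one]
    have h1 := Subgroup.relIndex_mul_index hτH
    have h2 : (τ.ker.subgroupOf U').index ≠ 0 := fun h0 => e8 (by rw [← h1, h0, mul_zero])
    have h3 : H.relIndex (τ.ker.subgroupOf U') * (τ.ker.subgroupOf U').index ≤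
        1 * (τ.ker.subgroupOf U').index := by rw [h1, one_mul]; exact e7
    have h4 := Nat.le_of_mul_le_mul_right h3 (Nat.pos_of_ne_zero h2)
    have h5 : H.relIndex (τ.ker.subgroupOf U') ≠ 0 := fun h0 => e8 (by rw [← h1, h0, zero_mul])
    omega
  have hzU : z ∈ U' := (mem_unit_iff _ _).2 fun v hv => hz v fun h => hv (by simp [h])
  refine hH1 ⟨z, hzU⟩ (e9 ?_)
  rw [Subgroup.mem_subgroupOf, MonoidHom.mem_ker]
  funext ⟨v, hv⟩
  exact hzt v (Finset.mem_filter.1 hv).1 (hS'2 v hv).1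

end Hasse

section ClassGroup

variable {R : Type*} [CommRing R] [IsDedekindDomain R] (K : Type*) [Field K] [Algebra R K]
  [IsFractionRing R K]

theorem vord_eq_of_span_eq_mul (v : HeightOneSpectrum R) {x : R} (hx : x ≠ 0) {n : ℕ} {Q : Ideal R}
    (h : Ideal.span {x} = v.asIdeal ^ n * Q) (hQ : ¬ v.asIdeal ∣ Q) :
    vord v (algebraMap R K x) = n := by
  refine le_antisymm ?_ ?_
  · by_contra! hlt
    have h1 : ((n + 1 : ℕ) : ℤ) ≤ vord v (algebraMap R K x) := by push_cast; omega
    rw [le_vord_iff_mem v hx, ← Ideal.dvd_span_singleton, h, pow_succ] at h1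
    exact hQ ((mul_dvd_mul_iff_left (pow_ne_zero n v.ne_bot)).1 h1)
  · rw [le_vord_iff_mem v hx, ← Ideal.dvd_span_singleton, h]
    exact dvd_mul_right _ _

variable (R) in
theorem exists_finset_generating [Finite (ClassGroup R)] :
    ∃ S : Finset (HeightOneSpectrum R), ∀ n : HeightOneSpectrum R → ℤ, (Function.support n).Finite →
      ∃ x : K, x ≠ 0 ∧ ∀ v ∉ S, vord v x = n v := by
  classical
  choose A hA using (ClassGroup.mk0_surjective (R := R))
  have hfin : ∀ C, {v : HeightOneSpectrum R | v.asIdeal ∣ (A C : Ideal R)}.Finite := fun C =>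
    Ideal.finite_factors (nonZeroDivisors.coe_ne_zero (A C))
  have := Set.finite_iUnion hfin
  refine ⟨this.toFinset, ?_⟩
  have key : ∀ n : HeightOneSpectrum R → ℕ, (Function.support n).Finite →
      ∃ x : K, x ≠ 0 ∧ ∀ v ∉ this.toFinset, vord v x = n v := by
    intro n hn
    set I : Ideal R := ∏ v ∈ hn.toFinset, v.asIdeal ^ n v with hI
    have hI0 : I ≠ 0 := Finset.prod_ne_zero_iff.2 fun v _ => pow_ne_zero _ v.ne_bot
    let I' : nonZeroDivisors (Ideal R) := ⟨I, mem_nonZeroDivisors_of_ne_zero hI0⟩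
    set B := A (ClassGroup.mk0 I')⁻¹ with hB
    have h1 : ClassGroup.mk0 (B * I') = 1 := by rw [map_mul, hB, hA, inv_mul_cancel]
    rw [ClassGroup.mk0_eq_one_iff] at h1
    obtain ⟨x, hx⟩ := h1.principal
    rw [Ideal.submodule_span_eq] at hx
    have hx' : Ideal.span {x} = (B : Ideal R) * I := hx.symm
    have hx0 : x ≠ 0 := by
      rintro rfl
      rw [Ideal.span_singleton_eq_bot.2 rfl] at hx'
      exact mul_ne_zero (nonZeroDivisors.coe_ne_zero B) hI0 hx'.symm
    refine ⟨algebraMap R K x, (map_ne_zero_iff _ (IsFractionRing.injective _ _)).2 hx0,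
      fun v hv => ?_⟩
    have hvB : ¬ v.asIdeal ∣ (B : Ideal R) := fun h => hv (by
      rw [Set.Finite.mem_toFinset]; exact Set.mem_iUnion.2 ⟨_, h⟩)
    have hvp := v.prime
    refine vord_eq_of_span_eq_mul K v hx0 (Q := B * ∏ w ∈ hn.toFinset.erase v, w.asIdeal ^ n w) ?_ ?_
    · rw [hx', hI]
      by_cases hv' : v ∈ hn.toFinset
      · rw [← Finset.mul_prod_erase _ _ hv', mul_left_comm]
      · have : n v = 0 := by simpa using hv'
        rw [this, pow_zero, one_mul, Finset.erase_eq_of_notMem hv']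
    · intro h
      rcases hvp.dvd_or_dvd h with h | h
      · exact hvB h
      · obtain ⟨w, hw, h⟩ := (hvp.dvd_finsetProd_iff _).1 h
        have h2 := hvp.dvd_of_dvd_pow h
        have h3 := w.isMaximal.eq_of_le v.isPrime.ne_top (Ideal.dvd_iff_le.1 h2)
        exact (Finset.mem_erase.1 hw).1 (HeightOneSpectrum.ext h3)
  intro n hn
  obtain ⟨x, hx0, hx⟩ := key (fun v => (n v).toNat) (hn.subset fun v hv h => hv (by simp [h]))
  obtain ⟨y, hy0, hy⟩ := key (fun v => (-n v).toNat) (hn.subset fun v hv h => hv (by simp [h]))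
  refine ⟨x / y, div_ne_zero hx0 hy0, fun v hv => ?_⟩
  rw [vord_div v hx0 hy0, hx v hv, hy v hv]
  omega

end ClassGroup

theorem level_le_two_of_three {E : Type*} [Field E] {a b c : E} (h : a ^ 2 + b ^ 2 + c ^ 2 = -1) :
    ∃ x y : E, -1 = x ^ 2 + y ^ 2 := by
  by_cases h0 : b ^ 2 + c ^ 2 = 0
  · exact ⟨a, 0, by linear_combination -h + h0⟩
  · refine ⟨(b + a * c) / (b ^ 2 + c ^ 2), (c - a * b) / (b ^ 2 + c ^ 2), ?_⟩
    field_simp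
    linear_combination -(b ^ 2 + c ^ 2) * h

/-- If `c ≡ 1 mod 8` and `-c` is a sum of two squares in a totally complex number field, then so
is `-1`. -/
theorem level_le_two_of_neg {E : Type u} [Field E] [NumberField E] [IsTotallyComplex E]
    {c : E} (hc0 : c ≠ 0) (d : 𝓞 E) (hcd : c = 1 + 8 * algebraMap (𝓞 E) E d) {X Y : E}
    (hXY : -c = X ^ 2 + Y ^ 2) : ∃ x y : E, -1 = x ^ 2 + y ^ 2 := by
  classical
  by_cases hc : IsSquare c
  · obtain ⟨e, rfl⟩ := hc
    have he : e ≠ 0 := by rintro rfl; simp at hc0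
    refine ⟨X / e, Y / e, ?_⟩
    field_simp
    linear_combination hXY
  obtain ⟨S0, hS0⟩ := exists_finset_generating (𝓞 E) E
  have hf2 := finite_vord_ne_zero (R := 𝓞 E) (x := (2 : E)) two_ne_zero
  have hfc := finite_vord_ne_zero (R := 𝓞 E) hc0
  let S := S0 ∪ hf2.toFinset ∪ hfc.toFinset
  obtain ⟨p, q, hpq⟩ := exists_norm_of_tame S
    (fun v hv => by by_contra h; exact hv (by simp [S, h]))
    (fun n hn => by
      obtain ⟨x, hx0, hx⟩ := hS0 n hn
      exact ⟨x, hx0, fun v hv => hx v fun h => hv (by simp [S, h])⟩)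
    hc hc0 (fun v hv => by by_contra h; exact hv (by simp [S, h]))
    (fun v _ hv2 => by
      refine ⟨1, one_ne_zero, ?_⟩
      have hd : d ≠ 0 := by rintro rfl; exact hc ⟨1, by simp [hcd]⟩
      have hdE : algebraMap (𝓞 E) E d ≠ 0 :=
        (map_ne_zero_iff _ (IsFractionRing.injective _ _)).2 hd
      have e : c / 1 ^ 2 - 1 = 2 ^ 3 * algebraMap (𝓞 E) E d := by rw [hcd]; ring
      have h2 : 0 ≤ vord v (2 : E) := by
        rw [← map_ofNat (algebraMap (𝓞 E) E) 2]; exact vord_nonneg v _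
      rw [e, vord_mul v (pow_ne_zero _ two_ne_zero) hdE, vord_pow,
        show (4 : E) = 2 ^ 2 by norm_num, vord_pow]
      have := vord_nonneg (K := E) v d
      push_cast
      omega)
    (-1) (fun v _ => by simp)
    (fun v _ hv2 => by
      by_cases hev : Even (vord v c)
      · rw [tame_of_even v _ hev, if_pos (by simp)]
      · have h1 : (-1 : E) ≠ 0 := by simp
        have h2 := tame_norm v h1 (Units.mk0 (-c) (neg_ne_zero.2 hc0)) X Y
          (by rw [Units.val_mk0, hXY]; ring)
        rw [tame_of_even v h1 (by simp), if_neg (by simpa using hev)] at h2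
        rw [tame_of_odd v _ (Int.not_even_iff_odd.1 hev) _ (by simp)]
        simpa using h2)
  refine level_le_two_of_three (a := p) (b := X * q) (c := Y * q) ?_
  have : (-1 : E) = p ^ 2 - c * q ^ 2 := by simpa using hpq
  linear_combination -this - q ^ 2 * hXY

section SumFourSq

variable (F : Type*) [Field F]

/-- The group of nonzero sums of four squares. -/
def sumFourSq : Subgroup Fˣ where
  carrier := {x | ∃ a b c d : F, (x : F) = a ^ 2 + b ^ 2 + c ^ 2 + d ^ 2}
  one_mem' := ⟨1, 0, 0, 0, by simp⟩
  mul_mem' := by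
    rintro x y ⟨a, b, c, d, hx⟩ ⟨a', b', c', d', hy⟩
    refine ⟨a * a' - b * b' - c * c' - d * d', a * b' + b * a' + c * d' - d * c',
      a * c' - b * d' + c * a' + d * b', a * d' + b * c' - c * b' + d * a', ?_⟩
    rw [Units.val_mul, hx, hy]; ring
  inv_mem' := by
    rintro x ⟨a, b, c, d, hx⟩
    have h0 := x.ne_zero
    refine ⟨a / x, b / x, c / x, d / x, ?_⟩
    rw [Units.val_inv_eq_inv_val]
    field_simp
    exact hx

variable {F}

theorem sq_mem_sumFourSq (x : Fˣ) : x ^ 2 ∈ sumFourSq F := ⟨x, 0, 0, 0, by simp⟩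

theorem map_mem_sumFourSq {F' : Type*} [Field F'] (f : F →+* F') {x : Fˣ} (hx : x ∈ sumFourSq F) :
    Units.map (f : F →* F') x ∈ sumFourSq F' := by
  obtain ⟨a, b, c, d, h⟩ := hx
  exact ⟨f a, f b, f c, f d, by simp [h]⟩

/-- Sums of four squares are anisotropic over a field of level at least four. -/
theorem eq_zero_of_sum_four_sq (h2 : ¬ ∃ x y : F, -1 = x ^ 2 + y ^ 2) {a b c d : F}
    (h : a ^ 2 + b ^ 2 + c ^ 2 + d ^ 2 = 0) : a = 0 ∧ b = 0 ∧ c = 0 ∧ d = 0 := by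
  have key : ∀ {x y : F}, x ^ 2 + y ^ 2 = 0 → x = 0 ∧ y = 0 := by
    intro x y hxy
    have hy : y = 0 := by
      by_contra hy
      refine h2 ⟨x / y, 0, ?_⟩
      field_simp
      linear_combination -hxy
    subst hy
    exact ⟨by simpa using hxy, rfl⟩
  by_cases hcd : c ^ 2 + d ^ 2 = 0
  · obtain ⟨rfl, rfl⟩ := key hcd
    obtain ⟨rfl, rfl⟩ := key (x := a) (y := b) (by linear_combination h)
    simp
  · exfalso
    refine h2 ⟨(a * c + b * d) / (c ^ 2 + d ^ 2), (a * d - b * c) / (c ^ 2 + d ^ 2), ?_⟩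
    field_simp
    linear_combination -(c ^ 2 + d ^ 2) * h

end SumFourSq

section Minkowski

variable (k : Type*) [Field k] [NumberField k]

theorem exists_neg_one_eq_sq_add_sq (v : HeightOneSpectrum (𝓞 k)) :
    ∃ α β : 𝓞 k, α ^ 2 + β ^ 2 + 1 ∈ v.asIdeal := by
  have : Finite (𝓞 k ⧸ v.asIdeal) := Ideal.finiteQuotientOfFreeOfNeBot _ v.ne_bot
  have : Fintype (𝓞 k ⧸ v.asIdeal) := Fintype.ofFinite _
  have := v.isPrime
  obtain ⟨p, hp⟩ := CharP.exists (𝓞 k ⧸ v.asIdeal)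
  have : NeZero p := ⟨CharP.char_ne_zero_of_finite (𝓞 k ⧸ v.asIdeal) p⟩
  obtain ⟨a, b, hab⟩ := CharP.sq_add_sq (𝓞 k ⧸ v.asIdeal) p (-1)
  refine ⟨a, b, ?_⟩
  rw [← Ideal.Quotient.eq_zero_iff_mem]
  simp only [map_add, map_pow, map_one, map_natCast, hab]
  push_cast; ring

theorem exists_pow_le_lt (m N : ℕ) (hm : m ≠ 0) : ∃ B : ℕ, B ^ m ≤ N ∧ N < (B + 1) ^ m := by
  have hex : ∃ B : ℕ, N < (B + 1) ^ m := ⟨N, by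
    calc N < N + 1 := Nat.lt_succ_self _
      _ ≤ (N + 1) ^ m := Nat.le_self_pow hm _⟩
  classical
  refine ⟨Nat.find hex, ?_, Nat.find_spec hex⟩
  rcases h : Nat.find hex with _ | B
  · simp [hm]
  · have := Nat.find_min hex (m := B) (by omega)
    exact not_lt.1 this

theorem exists_norm_bound {A ι : Type*} [CommRing A] [IsDomain A] [Fintype ι]
    (b : Basis ι ℤ A) : ∃ C : ℕ, 0 < C ∧ ∀ (B : ℕ) (z : Fin 4 → ι → ℤ), (∀ i j, |z i j| ≤ B) →
    (Algebra.norm ℤ (∑ i, (∑ j, z i j • b j) ^ 2)).natAbs ≤ C * B ^ (2 * Fintype.card ι) := by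
  classical
  have : Nonempty ι := by
    by_contra h
    rw [not_nonempty_iff] at h
    have := b.repr.injective.subsingleton
    exact zero_ne_one (Subsingleton.elim (0 : A) 1)
  set M : ℤ := ∑ j, ∑ l, ∑ m, |b.repr (b j * b l) m| with hM
  have hM0 : 0 ≤ M := by positivity
  let D := ClassGroup.normBound (AbsoluteValue.abs : AbsoluteValue ℤ ℤ) b
  have hD : 0 < D := ClassGroup.normBound_pos _ _
  refine ⟨(D * (4 * M + 1) ^ Fintype.card ι).toNat, ?_, fun B z hz => ?_⟩
  · have : 0 < D * (4 * M + 1) ^ Fintype.card ι := by positivity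
    omega
  have h1 : ∀ m, |b.repr (∑ i, (∑ j, z i j • b j) ^ 2) m| ≤ (4 * M + 1) * B ^ 2 := by
    intro m
    have e : b.repr (∑ i, (∑ j, z i j • b j) ^ 2) m =
        ∑ i, ∑ j, ∑ l, z i j * z i l * b.repr (b j * b l) m := by
      simp only [sq, Finset.sum_mul_sum, map_sum, Finsupp.coe_finsetSum, Finset.sum_apply,
        smul_mul_smul_comm, map_smul, Finsupp.smul_apply, smul_eq_mul]
    rw [e]
    calc _ ≤ ∑ i : Fin 4, ∑ j, ∑ l, |z i j * z i l * b.repr (b j * b l) m| := by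
          refine (Finset.abs_sum_le_sum_abs _ _).trans (Finset.sum_le_sum fun i _ => ?_)
          refine (Finset.abs_sum_le_sum_abs _ _).trans (Finset.sum_le_sum fun j _ => ?_)
          exact Finset.abs_sum_le_sum_abs _ _
      _ ≤ ∑ i : Fin 4, ∑ j, ∑ l, (B : ℤ) ^ 2 * ∑ m, |b.repr (b j * b l) m| := by
          refine Finset.sum_le_sum fun i _ => Finset.sum_le_sum fun j _ =>
            Finset.sum_le_sum fun l _ => ?_
          rw [abs_mul, abs_mul, sq]
          refine mul_le_mul (mul_le_mul (hz i j) (hz i l) (abs_nonneg _) (by positivity)) ?_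
            (abs_nonneg _) (by positivity)
          exact Finset.single_le_sum (f := fun m => |b.repr (b j * b l) m|)
            (fun _ _ => abs_nonneg _) (Finset.mem_univ m)
      _ = 4 * M * B ^ 2 := by
          simp only [← Finset.mul_sum, hM, Finset.sum_const, Finset.card_univ, Fintype.card_fin]
          simp; ring
      _ ≤ _ := by nlinarith [sq_nonneg (B : ℤ)]
  have h2 := ClassGroup.norm_le (AbsoluteValue.abs : AbsoluteValue ℤ ℤ) b _ h1
  have h3 : ((Algebra.norm ℤ (∑ i, (∑ j, z i j • b j) ^ 2)).natAbs : ℤ) ≤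
      D * (4 * M + 1) ^ Fintype.card ι * (B : ℤ) ^ (2 * Fintype.card ι) := by
    rw [Int.natCast_natAbs]
    refine h2.trans (le_of_eq ?_)
    rw [mul_pow, ← pow_mul, mul_assoc]
  have h4 : 0 ≤ D * (4 * M + 1) ^ Fintype.card ι := by positivity
  zify
  rw [Int.toNat_of_nonneg h4]
  rwa [Int.natCast_natAbs] at h3

/-- For almost all places `v`, some sum of four squares generates `v` up to a bounded ideal. -/
theorem exists_sum_four_sq_eq_mul (h2 : ¬ ∃ x y : k, -1 = x ^ 2 + y ^ 2) :
    ∃ C : ℕ, ∀ v : HeightOneSpectrum (𝓞 k), ∃ (y : 𝓞 k) (I : Ideal (𝓞 k)), y ≠ 0 ∧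
      Ideal.span {y} = v.asIdeal * I ∧ Ideal.absNorm I ≤ C ∧
      ∃ a b c d : 𝓞 k, y = a ^ 2 + b ^ 2 + c ^ 2 + d ^ 2 := by
  classical
  let bas := RingOfIntegers.basis k
  obtain ⟨C, hC0, hC⟩ := exists_norm_bound bas
  refine ⟨C, fun v => ?_⟩
  have : Finite (𝓞 k ⧸ v.asIdeal) := Ideal.finiteQuotientOfFreeOfNeBot _ v.ne_bot
  have : Fintype (𝓞 k ⧸ v.asIdeal) := Fintype.ofFinite _
  set n := Fintype.card (Free.ChooseBasisIndex ℤ (𝓞 k)) with hn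
  have hn0 : n ≠ 0 := by
    rw [hn, ← finrank_eq_card_basis bas]
    exact finrank_pos.ne'
  set N := Ideal.absNorm v.asIdeal with hN
  have hN0 : N ≠ 0 := by rw [hN, Ne, Ideal.absNorm_eq_zero_iff]; exact v.ne_bot
  have hNcard : Fintype.card (𝓞 k ⧸ v.asIdeal) = N := by
    rw [hN, Ideal.absNorm_apply, Submodule.cardQuot_apply, Nat.card_eq_fintype_card]
  obtain ⟨B, hB1, hB2⟩ := exists_pow_le_lt (2 * n) N (by omega)
  obtain ⟨α, β, hαβ⟩ := exists_neg_one_eq_sq_add_sq k v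
  let el : (Fin 4 → Free.ChooseBasisIndex ℤ (𝓞 k) → ℤ) → Fin 4 → 𝓞 k :=
    fun z i => ∑ j, z i j • bas j
  let f : (Fin 4 → Free.ChooseBasisIndex ℤ (𝓞 k) → Fin (B + 1)) →
      (𝓞 k ⧸ v.asIdeal) × (𝓞 k ⧸ v.asIdeal) := fun z =>
    let w := el fun i j => (z i j : ℕ)
    (Ideal.Quotient.mk _ (w 2 - (α * w 0 - β * w 1)), Ideal.Quotient.mk _ (w 3 - (β * w 0 + α * w 1)))
  obtain ⟨z, z', hzz, hf⟩ := Fintype.exists_ne_map_eq_of_card_lt f (by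
    rw [Fintype.card_prod, hNcard, Fintype.card_fun, Fintype.card_fun, Fintype.card_fin,
      Fintype.card_fin, ← hn]
    calc N * N < (B + 1) ^ (2 * n) * (B + 1) ^ (2 * n) :=
          Nat.mul_lt_mul_of_lt_of_lt hB2 hB2
      _ = _ := by ring)
  set u : Fin 4 → Free.ChooseBasisIndex ℤ (𝓞 k) → ℤ := fun i j => (z i j : ℕ) - (z' i j : ℕ) with hu
  have hub : ∀ i j, |u i j| ≤ B := fun i j => by
    have h1 := (z i j).2
    have h2 := (z' i j).2
    rw [hu, abs_le]; constructor <;> simp only <;> omega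
  have hel : ∀ i, el u i = el (fun i j => (z i j : ℕ)) i - el (fun i j => (z' i j : ℕ)) i := by
    intro i
    simp only [el, hu, sub_smul, Finset.sum_sub_distrib]
  set y := ∑ i, (el u i) ^ 2 with hy
  have hy4 : y = el u 0 ^ 2 + el u 1 ^ 2 + el u 2 ^ 2 + el u 3 ^ 2 := by
    rw [hy, Fin.sum_univ_four]
  have hy0 : y ≠ 0 := by
    intro h0
    have h3 := congrArg (algebraMap (𝓞 k) k) (hy4.symm.trans h0)
    simp only [map_add, map_pow, map_zero] at h3
    obtain ⟨e0, e1, e2, e3⟩ := eq_zero_of_sum_four_sq h2 h3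
    have hinj : ∀ x : 𝓞 k, algebraMap (𝓞 k) k x = 0 → x = 0 := fun x hx =>
      (map_eq_zero_iff _ (IsFractionRing.injective _ _)).1 hx
    have he : ∀ i, el u i = 0 := by
      intro i; fin_cases i
      · exact hinj _ e0
      · exact hinj _ e1
      · exact hinj _ e2
      · exact hinj _ e3
    apply hzz
    funext i j
    have h5 : u i j = 0 := by
      have h6 := Fintype.linearIndependent_iff.1 bas.linearIndependent (u i) (he i)
      exact h6 j
    apply Fin.ext
    rw [hu] at h5
    simp only at h5
    omega
  have hyv : y ∈ v.asIdeal := by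
    have h3 : el u 2 - (α * el u 0 - β * el u 1) ∈ v.asIdeal := by
      have := Ideal.Quotient.eq.1 (Prod.ext_iff.1 hf).1
      simp only [hel]
      convert this using 1
      ring
    have h4 : el u 3 - (β * el u 0 + α * el u 1) ∈ v.asIdeal := by
      have := Ideal.Quotient.eq.1 (Prod.ext_iff.1 hf).2
      simp only [hel]
      convert this using 1
      ring
    have e : y = (α ^ 2 + β ^ 2 + 1) * (el u 0 ^ 2 + el u 1 ^ 2) +
        (el u 2 - (α * el u 0 - β * el u 1)) * (el u 2 + (α * el u 0 - β * el u 1)) +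
        (el u 3 - (β * el u 0 + α * el u 1)) * (el u 3 + (β * el u 0 + α * el u 1)) := by
      rw [hy4]; ring
    rw [e]
    exact add_mem (add_mem (Ideal.mul_mem_right _ _ hαβ) (Ideal.mul_mem_right _ _ h3))
      (Ideal.mul_mem_right _ _ h4)
  obtain ⟨I, hI⟩ := (Ideal.dvd_span_singleton).2 hyv
  refine ⟨y, I, hy0, hI, ?_, _, _, _, _, hy4⟩
  have h3 := hC B u hub
  have h4 : Ideal.absNorm (Ideal.span {y}) ≤ C * N := by
    rw [Ideal.absNorm_span_singleton]
    exact h3.trans (Nat.mul_le_mul_left _ hB1)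
  rw [hI, map_mul, mul_comm] at h4
  exact Nat.le_of_mul_le_mul_right h4 (Nat.pos_of_ne_zero hN0)

/-- Sums of four squares have finite index. -/
theorem sumFourSq_index_ne_zero (h2 : ¬ ∃ x y : k, -1 = x ^ 2 + y ^ 2) :
    (sumFourSq k).index ≠ 0 := by
  classical
  obtain ⟨C, hC⟩ := exists_sum_four_sq_eq_mul k h2
  choose y I hy0 hyI hIC hsum using hC
  have hI0 : ∀ v, I v ≠ 0 := fun v h => hy0 v (by
    have := hyI v
    rw [h, mul_zero] at this
    exact Ideal.span_singleton_eq_bot.1 this)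
  have hfinI : {J : Ideal (𝓞 k) | Ideal.absNorm J ≤ C}.Finite := Ideal.finite_setOfPred_absNorm_le C
  have hfin : {w : HeightOneSpectrum (𝓞 k) | Ideal.absNorm w.asIdeal ≤ C}.Finite :=
    hfinI.preimage (f := fun w : HeightOneSpectrum (𝓞 k) => w.asIdeal)
      (fun _ _ _ _ h => HeightOneSpectrum.ext h)
  set S := hfin.toFinset with hS
  have hdvd : ∀ v, ∀ w ∉ S, ¬ w.asIdeal ∣ I v := by
    intro v w hw h
    apply hw
    rw [hS, Set.Finite.mem_toFinset]
    refine (Nat.le_of_dvd (Nat.pos_of_ne_zero ?_) (map_dvd Ideal.absNorm h)).trans (hIC v)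
    rw [Ne, Ideal.absNorm_eq_zero_iff]; exact hI0 v
  have hyE : ∀ v, algebraMap (𝓞 k) k (y v) ≠ 0 := fun v =>
    (map_ne_zero_iff _ (IsFractionRing.injective _ _)).2 (hy0 v)
  let Y : HeightOneSpectrum (𝓞 k) → kˣ := fun v => Units.mk0 _ (hyE v)
  have hYD : ∀ v, Y v ∈ sumFourSq k := fun v => by
    obtain ⟨a, b, c, d, h⟩ := hsum v
    exact ⟨algebraMap _ _ a, algebraMap _ _ b, algebraMap _ _ c, algebraMap _ _ d, by
      change algebraMap (𝓞 k) k (y v) = _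
      rw [h]; simp⟩
  have hYv : ∀ v, ∀ w ∉ S, vordHom k w (Additive.ofMul (Y v)) = if w = v then 1 else 0 := by
    intro v w hw
    change vord w (algebraMap (𝓞 k) k (y v)) = _
    split_ifs with h
    · subst h
      exact_mod_cast vord_eq_of_span_eq_mul k w (hy0 w) (n := 1) (by rw [hyI, pow_one]) (hdvd w w hw)
    · have := vord_eq_of_span_eq_mul k w (hy0 v) (n := 0) (Q := Ideal.span {y v})
        (by rw [pow_zero, one_mul]) (by
          rw [hyI]
          intro h3
          rcases w.prime.dvd_or_dvd h3 with h3 | h3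
          · exact h (HeightOneSpectrum.ext (v.isMaximal.eq_of_le w.isPrime.ne_top
              (Ideal.dvd_iff_le.1 h3)).symm)
          · exact hdvd v w hw h3)
      exact_mod_cast this
  let U := (S : Set (HeightOneSpectrum (𝓞 k))).unit k
  have htop : U ⊔ sumFourSq k = ⊤ := by
    rw [eq_top_iff]
    intro x _
    have hx := finite_vord_ne_zero (R := 𝓞 k) x.ne_zero
    set d : kˣ := ∏ v ∈ hx.toFinset, Y v ^ vord v (x : k) with hd
    have hdD : d ∈ sumFourSq k := Subgroup.prod_mem _ fun v _ => Subgroup.zpow_mem _ (hYD v) _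
    have hxd : x / d ∈ U := by
      refine (mem_unit_iff _ _).2 fun w hw => ?_
      change vordHom k w (Additive.ofMul (x / d)) = 0
      rw [ofMul_div, map_sub, sub_eq_zero, hd, ofMul_prod, map_sum]
      change vord w (x : k) = _
      have : ∀ v, vordHom k w (Additive.ofMul (Y v ^ vord v (x : k))) =
          if w = v then vord v (x : k) else 0 := by
        intro v
        rw [ofMul_zpow, map_zsmul, hYv v w (by simpa using hw)]
        split_ifs <;> simp
      simp only [this, Finset.sum_ite_eq]
      split_ifs with h
      · rfl
      · simpa using h
    rw [← div_mul_cancel x d]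
    exact mul_mem (Subgroup.mem_sup_left hxd) (Subgroup.mem_sup_right hdD)
  have h1 : (sumFourSq k).index = (sumFourSq k).relIndex U := by
    rw [← Subgroup.relIndex_sup_right, htop, Subgroup.relIndex_top_right]
  rw [h1]
  have h3 : (sqHom U).range ≤ (sumFourSq k).subgroupOf U := by
    rintro _ ⟨u, rfl⟩
    exact sq_mem_sumFourSq _
  intro h0
  have h4 := Subgroup.index_dvd_of_le h3
  rw [show ((sumFourSq k).subgroupOf U).index = 0 from h0, index_sqHom_range_sUnit,
    zero_dvd_iff] at h4
  exact pow_ne_zero _ two_ne_zero h4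

end Minkowski

section ConicMap

variable {k R : Type*} [Field k] [CommRing R] [Algebra k R]

/-- The map `(p, q) ↦ p(y) + q(y) x`. -/
def conicMap (x y : R) : (Polynomial k × Polynomial k) →ₗ[k] R :=
  (Polynomial.aeval y).toLinearMap ∘ₗ LinearMap.fst k _ _ +
    LinearMap.mulRight k x ∘ₗ (Polynomial.aeval y).toLinearMap ∘ₗ LinearMap.snd k _ _

@[simp] theorem conicMap_apply (x y : R) (p q : Polynomial k) :
    conicMap x y (p, q) = Polynomial.aeval y p + Polynomial.aeval y q * x := by
  simp [conicMap]

/-- `R = k[y] ⊕ k[y] x` with `x² = s(y)`. -/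
structure IsConicCoord (s : Polynomial k) (x y : R) : Prop where
  sq_eq : x ^ 2 = Polynomial.aeval y s
  bij : Function.Bijective (conicMap (k := k) x y)

theorem conicMap_mul {s : Polynomial k} {x y : R} (h : x ^ 2 = Polynomial.aeval y s)
    (p q p' q' : Polynomial k) : conicMap x y (p, q) * conicMap x y (p', q') =
      conicMap x y (p * p' + q * q' * s, p * q' + q * p') := by
  simp only [conicMap_apply, map_add, map_mul, ← h]
  ring

end ConicMap

section ConicRing

variable {k : Type*} [Field k] {a b : k}

/-- The polynomial `(1 - b y²) / a`. -/
def conicS (a b : k) : Polynomial k :=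
  Polynomial.C a⁻¹ * (1 - Polynomial.C b * Polynomial.X ^ 2)

theorem conicRing_rel : algebraMap k (ConicRing k a b) a *
      (Ideal.Quotient.mk _ (MvPolynomial.X 0) : ConicRing k a b) ^ 2 +
    algebraMap k (ConicRing k a b) b *
      (Ideal.Quotient.mk _ (MvPolynomial.X 1) : ConicRing k a b) ^ 2 = 1 := by
  have h : (Ideal.Quotient.mk (Ideal.span {conicPoly k a b})) (conicPoly k a b) = 0 :=
    Ideal.Quotient.eq_zero_iff_mem.2 (Ideal.mem_span_singleton_self _)
  rw [conicPoly, map_sub, map_one, sub_eq_zero, map_add, map_mul, map_mul, map_pow, map_pow] at h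
  exact h

theorem isConicCoord_conicRing (ha : a ≠ 0) :
    IsConicCoord (k := k) (R := ConicRing k a b) (conicS a b)
      (Ideal.Quotient.mk _ (MvPolynomial.X 0)) (Ideal.Quotient.mk _ (MvPolynomial.X 1)) := by
  set x : ConicRing k a b := Ideal.Quotient.mk _ (MvPolynomial.X 0) with hx
  set y : ConicRing k a b := Ideal.Quotient.mk _ (MvPolynomial.X 1) with hy
  have hrel := conicRing_rel (a := a) (b := b)
  rw [← hx, ← hy] at hrel
  have hsq : x ^ 2 = Polynomial.aeval y (conicS a b) := by
    have h1 : algebraMap k (ConicRing k a b) a⁻¹ * algebraMap k (ConicRing k a b) a = 1 := by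
      rw [← map_mul, inv_mul_cancel₀ ha, map_one]
    simp only [conicS, map_mul, map_sub, map_one, Polynomial.aeval_C, map_pow, Polynomial.aeval_X]
    linear_combination (-x ^ 2) * h1 + algebraMap k (ConicRing k a b) a⁻¹ * hrel
  refine ⟨hsq, ?_, ?_⟩
  · let F : Polynomial (Polynomial k) := Polynomial.X ^ 2 - Polynomial.C (conicS a b)
    have hF : F.Monic := Polynomial.monic_X_pow_sub_C _ two_ne_zero
    let φ₀ : MvPolynomial (Fin 2) k →+* AdjoinRoot F :=
      MvPolynomial.eval₂Hom ((AdjoinRoot.of F).comp Polynomial.C)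
        ![AdjoinRoot.root F, AdjoinRoot.of F Polynomial.X]
    have hroot : AdjoinRoot.root F ^ 2 = AdjoinRoot.of F (conicS a b) := by
      have := AdjoinRoot.eval₂_root F
      simpa [F, sub_eq_zero] using this
    have hφ₀ : φ₀ (conicPoly k a b) = 0 := by
      have h1 : (Polynomial.C a : Polynomial k) * Polynomial.C a⁻¹ = 1 := by
        rw [← Polynomial.C_mul, mul_inv_cancel₀ ha, Polynomial.C_1]
      have h2 : Polynomial.C a * conicS a b + Polynomial.C b * Polynomial.X ^ 2 - 1 = 0 := by
        rw [conicS]; linear_combination (1 - Polynomial.C b * Polynomial.X ^ 2) * h1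
      simp only [φ₀, conicPoly, map_sub, map_add, map_mul, map_pow, map_one,
        MvPolynomial.coe_eval₂Hom, MvPolynomial.eval₂_C, MvPolynomial.eval₂_X, RingHom.comp_apply,
        Matrix.cons_val_zero, Matrix.cons_val_one, hroot]
      rw [← map_mul, ← map_pow, ← map_mul, ← map_add, ← map_one (AdjoinRoot.of F), ← map_sub, h2,
        map_zero]
    let φ : ConicRing k a b →+* AdjoinRoot F := Ideal.Quotient.lift _ φ₀ (by
      intro z hz
      obtain ⟨w, rfl⟩ := Ideal.mem_span_singleton.1 hz
      rw [map_mul, hφ₀, zero_mul])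
    have hφy : ∀ p : Polynomial k, φ (Polynomial.aeval y p) = AdjoinRoot.of F p := by
      intro p
      have h1 : φ.comp (Polynomial.aeval y : Polynomial k →ₐ[k] _).toRingHom = AdjoinRoot.of F := by
        apply Polynomial.ringHom_ext
        · intro c
          simp only [AlgHom.toRingHom_eq_coe, RingHom.comp_apply, RingHom.coe_coe,
            Polynomial.aeval_C]
          change φ₀ (MvPolynomial.C c) = _
          simp [φ₀]
        · simp only [AlgHom.toRingHom_eq_coe, RingHom.comp_apply, RingHom.coe_coe,
            Polynomial.aeval_X]
          change φ₀ (MvPolynomial.X 1) = _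
          simp [φ₀]
      exact RingHom.congr_fun h1 p
    have hφx : φ x = AdjoinRoot.root F := by
      change φ₀ (MvPolynomial.X 0) = _
      simp [φ₀]
    rw [injective_iff_map_eq_zero]
    rintro ⟨p, q⟩ h0
    rw [conicMap_apply] at h0
    have h1 := congrArg φ h0
    rw [map_add, map_mul, hφy, hφy, hφx, map_zero] at h1
    have h2 : AdjoinRoot.mk F (Polynomial.C p + Polynomial.C q * Polynomial.X) = 0 := by
      rw [map_add, map_mul, AdjoinRoot.mk_C, AdjoinRoot.mk_C, AdjoinRoot.mk_X, h1]
    rw [AdjoinRoot.mk_eq_zero] at h2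
    have h3 : Polynomial.C p + Polynomial.C q * Polynomial.X = 0 := by
      by_contra hne
      refine hF.not_dvd_of_degree_lt hne ?_ h2
      rw [Polynomial.degree_X_pow_sub_C (by norm_num), add_comm]
      exact (Polynomial.degree_linear_le).trans_lt (by norm_num)
    have h4 := congrArg (fun f => Polynomial.coeff f 0) h3
    have h5 := congrArg (fun f => Polynomial.coeff f 1) h3
    simp [Polynomial.coeff_X, Polynomial.coeff_C] at h4 h5
    rw [h4, h5]; rfl
  · intro z
    obtain ⟨P, rfl⟩ := Ideal.Quotient.mk_surjective z
    induction P using MvPolynomial.induction_on with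
    | C c => exact ⟨(Polynomial.C c, 0), by simp; rfl⟩
    | add P Q hP hQ =>
      obtain ⟨u, hu⟩ := hP
      obtain ⟨v, hv⟩ := hQ
      exact ⟨u + v, by rw [map_add, hu, hv, map_add]⟩
    | mul_X P i hP =>
      obtain ⟨⟨p, q⟩, hu⟩ := hP
      rw [map_mul, ← hu]
      fin_cases i
      · refine ⟨_, ((conicMap_mul hsq p q 0 1).symm.trans ?_)⟩
        congr 1; simp [hx]
      · refine ⟨_, ((conicMap_mul hsq p q Polynomial.X 0).symm.trans ?_)⟩
        congr 1; simp [hy]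

end ConicRing

namespace IsConicCoord

variable {k R M : Type*} [Field k] [CommRing R] [Algebra k R] [Field M] [Algebra k M]
  {s : Polynomial k} {x y : R} (h : IsConicCoord s x y)

/-- The identification of `R` with `k[y] ⊕ k[y] x`. -/
def equiv : (Polynomial k × Polynomial k) ≃ₗ[k] R :=
  LinearEquiv.ofBijective _ h.bij

theorem equiv_apply (z : Polynomial k × Polynomial k) : h.equiv z = conicMap x y z := rfl

/-- The functions with poles of order at most `m` at infinity. -/
def filt (m : ℕ) : Submodule k R :=
  LinearMap.range ((h.equiv : (Polynomial k × Polynomial k) →ₗ[k] R) ∘ₗ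
    (Polynomial.degreeLT k (m + 1)).subtype.prodMap (Polynomial.degreeLT k m).subtype)

/-- The leading coefficient in degree `m`. -/
def lead (θ : M) (m : ℕ) : R →ₗ[k] M :=
  (Algebra.linearMap k M ∘ₗ Polynomial.lcoeff k m ∘ₗ LinearMap.fst k _ _ +
    LinearMap.mulRight k θ ∘ₗ Algebra.linearMap k M ∘ₗ Polynomial.lcoeff k m ∘ₗ
      LinearMap.mulLeft k Polynomial.X ∘ₗ LinearMap.snd k _ _) ∘ₗ
    (h.equiv.symm : R →ₗ[k] (Polynomial k × Polynomial k))

theorem lead_apply (θ : M) (m : ℕ) (p q : Polynomial k) : h.lead θ m (conicMap x y (p, q)) =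
    algebraMap k M (p.coeff m) + algebraMap k M ((Polynomial.X * q).coeff m) * θ := by
  rw [← h.equiv_apply]
  simp [lead]

include h in
theorem exists_rep (r : R) : ∃ p q : Polynomial k, r = conicMap x y (p, q) := by
  obtain ⟨⟨p, q⟩, e⟩ := h.bij.2 r
  exact ⟨p, q, e.symm⟩

theorem mem_filt {m : ℕ} {p q : Polynomial k} : conicMap x y (p, q) ∈ h.filt m ↔
    p.natDegree ≤ m ∧ (Polynomial.X * q).natDegree ≤ m := by
  have e : conicMap x y (p, q) ∈ h.filt m ↔
      p ∈ Polynomial.degreeLT k (m + 1) ∧ q ∈ Polynomial.degreeLT k m := by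
    constructor
    · rintro ⟨⟨u, v⟩, huv⟩
      have := h.equiv.injective huv
      simp only [LinearMap.prodMap_apply, Submodule.subtype_apply, Prod.mk.injEq] at this
      exact ⟨this.1 ▸ u.2, this.2 ▸ v.2⟩
    · rintro ⟨hp, hq⟩
      exact ⟨(⟨p, hp⟩, ⟨q, hq⟩), rfl⟩
  rw [e, Polynomial.mem_degreeLT, Polynomial.mem_degreeLT, Polynomial.degree_lt_iff_coeff_zero,
    Polynomial.degree_lt_iff_coeff_zero, Polynomial.natDegree_le_iff_coeff_eq_zero,
    Polynomial.natDegree_le_iff_coeff_eq_zero]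
  refine and_congr ⟨fun H N hN => H N hN, fun H N hN => H N hN⟩ ⟨fun H N hN => ?_, fun H N hN => ?_⟩
  · obtain ⟨N, rfl⟩ := Nat.exists_eq_succ_of_ne_zero (Nat.ne_zero_of_lt hN)
    rw [Nat.succ_eq_add_one, Polynomial.coeff_X_mul]
    exact H N (by omega)
  · rw [← Polynomial.coeff_X_mul]
    exact H (N + 1) (by omega)

theorem finiteDimensional_degreeLT (m : ℕ) : FiniteDimensional k (Polynomial.degreeLT k m) :=
  (Polynomial.degreeLTEquiv k m).symm.finiteDimensional

theorem finrank_degreeLT (m : ℕ) : finrank k (Polynomial.degreeLT k m) = m := by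
  rw [(Polynomial.degreeLTEquiv k m).finrank_eq, finrank_fin_fun]

theorem finiteDimensional_filt (m : ℕ) : FiniteDimensional k (h.filt m) := by
  have := finiteDimensional_degreeLT (k := k) (m + 1)
  have := finiteDimensional_degreeLT (k := k) m
  unfold filt
  infer_instance

theorem finrank_filt (m : ℕ) : finrank k (h.filt m) = 2 * m + 1 := by
  have := finiteDimensional_degreeLT (k := k) (m + 1)
  have := finiteDimensional_degreeLT (k := k) m
  unfold filt
  rw [LinearMap.finrank_range_of_inj, finrank_prod, finrank_degreeLT, finrank_degreeLT]
  · ring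
  · exact h.equiv.injective.comp (Prod.map_injective.2
      ⟨Subtype.val_injective, Subtype.val_injective⟩)

theorem filt_mono {m n : ℕ} (hmn : m ≤ n) : h.filt m ≤ h.filt n := by
  intro r hr
  obtain ⟨p, q, rfl⟩ := h.exists_rep r
  rw [mem_filt] at hr ⊢
  exact ⟨hr.1.trans hmn, hr.2.trans hmn⟩

theorem exists_mem_filt (r : R) : ∃ m, r ∈ h.filt m := by
  obtain ⟨p, q, rfl⟩ := h.exists_rep r
  exact ⟨max p.natDegree (Polynomial.X * q).natDegree, h.mem_filt.2 ⟨le_max_left _ _, le_max_right _ _⟩⟩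

theorem lead_eq_zero_of_lt (θ : M) {m n : ℕ} (hmn : n < m) {r : R} (hr : r ∈ h.filt n) :
    h.lead θ m r = 0 := by
  obtain ⟨p, q, rfl⟩ := h.exists_rep r
  rw [mem_filt] at hr
  rw [lead_apply, Polynomial.coeff_eq_zero_of_natDegree_lt (hr.1.trans_lt hmn),
    Polynomial.coeff_eq_zero_of_natDegree_lt (hr.2.trans_lt hmn)]
  simp

theorem mem_filt_zero {r : R} (hr : r ∈ h.filt 0) : ∃ c : k, r = algebraMap k R c := by
  obtain ⟨p, q, rfl⟩ := h.exists_rep r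
  rw [mem_filt] at hr
  have hq : q = 0 := by
    by_contra hq
    have := Polynomial.natDegree_X_mul hq
    omega
  refine ⟨p.coeff 0, ?_⟩
  rw [Polynomial.eq_C_of_natDegree_le_zero hr.1, hq]
  simp

theorem one_mem_filt (c : k) : algebraMap k R c ∈ h.filt 0 := by
  have : algebraMap k R c = conicMap x y (Polynomial.C c, 0) := by simp
  rw [this, mem_filt]; simp

section Quad

variable {e : k} {θ : M} {σ : M ≃ₐ[k] M} (hθ : IsQuadExt e θ σ) (hs2 : s.natDegree ≤ 2)
  (hse : s.coeff 2 = e)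

include hθ

theorem coeff_eq_zero_of_add {u v : k} (H : algebraMap k M u + algebraMap k M v * θ = 0) :
    u = 0 ∧ v = 0 := by
  have hv : v = 0 := by
    by_contra hv
    apply hθ.not_isSquare
    refine ⟨-u / v, ?_⟩
    apply (algebraMap k M).injective
    have hv' : algebraMap k M v ≠ 0 := by simpa using hv
    rw [← hθ.sq, map_mul, map_div₀, map_neg]
    field_simp
    linear_combination (algebraMap k M v * θ - algebraMap k M u) * H
  subst hv
  simpa using H

theorem mem_filt_of_lead_eq_zero {m : ℕ} {r : R} (hr : r ∈ h.filt (m + 1))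
    (h0 : h.lead θ (m + 1) r = 0) : r ∈ h.filt m := by
  obtain ⟨p, q, rfl⟩ := h.exists_rep r
  rw [mem_filt] at hr ⊢
  rw [lead_apply] at h0
  obtain ⟨h1, h2⟩ := coeff_eq_zero_of_add hθ h0
  have key : ∀ {f : Polynomial k}, f.natDegree ≤ m + 1 → f.coeff (m + 1) = 0 → f.natDegree ≤ m := by
    intro f hf hf0
    rw [Polynomial.natDegree_le_iff_coeff_eq_zero] at hf ⊢
    intro N hN
    rcases Nat.lt_or_ge (m + 1) N with h3 | h3
    · exact hf N h3
    · obtain rfl : N = m + 1 := by omega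
      exact hf0
  exact ⟨key hr.1 h1, key hr.2 h2⟩

theorem exists_lead_ne_zero {r : R} (hr : r ≠ 0) :
    ∃ m, r ∈ h.filt m ∧ h.lead θ m r ≠ 0 := by
  classical
  have hex := h.exists_mem_filt r
  refine ⟨Nat.find hex, Nat.find_spec hex, fun h0 => ?_⟩
  rcases hm : Nat.find hex with _ | m
  · have h1 := Nat.find_spec hex
    rw [hm] at h1 h0
    obtain ⟨c, rfl⟩ := h.mem_filt_zero h1
    have h2 : algebraMap k R c = conicMap x y (Polynomial.C c, 0) := by simp
    rw [h2, lead_apply] at h0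
    simp at h0
    simp [h0] at hr
  · have h1 := Nat.find_spec hex
    rw [hm] at h1 h0
    exact Nat.find_min hex (m := m) (by omega) (h.mem_filt_of_lead_eq_zero hθ h1 h0)

theorem exists_lead_eq {m : ℕ} (hm : m ≠ 0) (μ : M) : ∃ r ∈ h.filt m, h.lead θ m r = μ := by
  obtain ⟨m, rfl⟩ := Nat.exists_eq_succ_of_ne_zero hm
  obtain ⟨u, v, rfl⟩ := hθ.span μ
  refine ⟨conicMap x y (Polynomial.C u * Polynomial.X ^ (m + 1), Polynomial.C v * Polynomial.X ^ m),
    ?_, ?_⟩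
  · rw [mem_filt]
    refine ⟨Polynomial.natDegree_C_mul_X_pow_le _ _, ?_⟩
    rw [← mul_assoc, mul_comm Polynomial.X, mul_assoc, ← pow_succ']
    exact Polynomial.natDegree_C_mul_X_pow_le _ _
  · rw [lead_apply, Polynomial.coeff_X_mul]
    simp

include hs2 hse

theorem mul_mem_filt {m n : ℕ} {r t : R} (hr : r ∈ h.filt m) (ht : t ∈ h.filt n) :
    r * t ∈ h.filt (m + n) ∧ h.lead θ (m + n) (r * t) = h.lead θ m r * h.lead θ n t := by
  obtain ⟨p, q, rfl⟩ := h.exists_rep r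
  obtain ⟨p', q', rfl⟩ := h.exists_rep t
  rw [mem_filt] at hr ht
  obtain ⟨hp, hq⟩ := hr
  obtain ⟨hp', hq'⟩ := ht
  have e1 : Polynomial.X ^ 2 * (q * q' * s) = (Polynomial.X * q) * (Polynomial.X * q') * s := by ring
  have d1 : ((Polynomial.X * q) * (Polynomial.X * q') * s).natDegree ≤ m + n + 2 :=
    Polynomial.natDegree_mul_le_of_le (Polynomial.natDegree_mul_le_of_le hq hq') hs2
  have c1 : (q * q' * s).coeff (m + n) =
      (Polynomial.X * q).coeff m * (Polynomial.X * q').coeff n * e := by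
    rw [← Polynomial.coeff_X_pow_mul _ 2, e1, Polynomial.coeff_mul_add_eq_of_natDegree_le
      (Polynomial.natDegree_mul_le_of_le hq hq') hs2, Polynomial.coeff_mul_add_eq_of_natDegree_le hq hq', hse]
  have d2 : (q * q' * s).natDegree ≤ m + n := by
    rw [Polynomial.natDegree_le_iff_coeff_eq_zero] at d1 ⊢
    intro N hN
    rw [← Polynomial.coeff_X_pow_mul _ 2, e1]
    exact d1 _ (by omega)
  have e2 : Polynomial.X * (p * q' + q * p') = p * (Polynomial.X * q') + (Polynomial.X * q) * p' := by
    ring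
  rw [conicMap_mul h.sq_eq, mem_filt, lead_apply, lead_apply, lead_apply, e2, Polynomial.coeff_add,
    Polynomial.coeff_add, Polynomial.coeff_mul_add_eq_of_natDegree_le hp hp',
    Polynomial.coeff_mul_add_eq_of_natDegree_le hp hq', Polynomial.coeff_mul_add_eq_of_natDegree_le hq hp', c1]
  refine ⟨⟨Polynomial.natDegree_add_le_of_degree_le (Polynomial.natDegree_mul_le_of_le hp hp') d2,
    Polynomial.natDegree_add_le_of_degree_le (Polynomial.natDegree_mul_le_of_le hp hq')
      (Polynomial.natDegree_mul_le_of_le hq hp')⟩, ?_⟩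
  simp only [map_add, map_mul, ← hθ.sq]
  ring

theorem add_le_of_mul_mem {m n N : ℕ} {r t : R} (hr : r ∈ h.filt m) (ht : t ∈ h.filt n)
    (hr0 : h.lead θ m r ≠ 0) (ht0 : h.lead θ n t ≠ 0) (hN : r * t ∈ h.filt N) : m + n ≤ N := by
  by_contra hlt
  have h1 := (h.mul_mem_filt hθ hs2 hse hr ht).2
  rw [h.lead_eq_zero_of_lt θ (not_le.1 hlt) hN] at h1
  exact mul_ne_zero hr0 ht0 h1.symm

/-- Division with remainder by `g`. -/
theorem exists_eq_add_mul {m : ℕ} {g : R} (hg : g ∈ h.filt m) (hg0 : h.lead θ m g ≠ 0) (u : R) :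
    ∃ w ∈ h.filt m, ∃ r, u = w + g * r := by
  obtain ⟨n, hn⟩ := h.exists_mem_filt u
  induction n generalizing u with
  | zero => exact ⟨u, h.filt_mono (Nat.zero_le _) hn, 0, by simp⟩
  | succ n ih =>
    rcases Nat.lt_or_ge m (n + 1) with h1 | h1
    · obtain ⟨r, hr, hr0⟩ := h.exists_lead_eq hθ (m := n + 1 - m) (by omega)
        (h.lead θ (n + 1) u / h.lead θ m g)
      obtain ⟨h2, h3⟩ := h.mul_mem_filt hθ hs2 hse hg hr
      rw [show m + (n + 1 - m) = n + 1 by omega] at h2 h3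
      obtain ⟨w, hw, r', e⟩ := ih (u - g * r) (h.mem_filt_of_lead_eq_zero hθ (sub_mem hn h2) (by
        rw [map_sub, h3, hr0, mul_div_cancel₀ _ hg0, sub_self]))
      exact ⟨w, hw, r + r', by linear_combination e⟩
    · exact ⟨u, h.filt_mono h1 hn, 0, by simp⟩

end Quad

end IsConicCoord

theorem exists_linearMap_sum_sq {k E V : Type*} [Field k] [Field E] [Algebra k E] [AddCommGroup V]
    [Module k V] (hE : ∃ α β : E, -1 = α ^ 2 + β ^ 2) (π : V →ₗ[k] E) :
    ∃ Ψ : (Fin 4 → V) →ₗ[k] E × E, ∀ z, Ψ z = 0 →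
      π (z 0) ^ 2 + π (z 1) ^ 2 + π (z 2) ^ 2 + π (z 3) ^ 2 = 0 := by
  obtain ⟨α, β, hαβ⟩ := hE
  let c : Fin 4 → (Fin 4 → V) →ₗ[k] E := fun i => π ∘ₗ LinearMap.proj i
  refine ⟨(c 2 - (LinearMap.mulLeft k α ∘ₗ c 0 - LinearMap.mulLeft k β ∘ₗ c 1)).prod
    (c 3 - (LinearMap.mulLeft k β ∘ₗ c 0 + LinearMap.mulLeft k α ∘ₗ c 1)), fun z hz => ?_⟩
  have h1 : π (z 2) - (α * π (z 0) - β * π (z 1)) = 0 := (Prod.ext_iff.1 hz).1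
  have h2 : π (z 3) - (β * π (z 0) + α * π (z 1)) = 0 := (Prod.ext_iff.1 hz).2
  linear_combination (π (z 2) + (α * π (z 0) - β * π (z 1))) * h1 +
    (π (z 3) + (β * π (z 0) + α * π (z 1))) * h2 - (π (z 0) ^ 2 + π (z 1) ^ 2) * hαβ

namespace IsConicCoord

variable {k R M : Type*} [Field k] [CommRing R] [Algebra k R] [Field M] [Algebra k M]
  {s : Polynomial k} {x y : R} (h : IsConicCoord s x y)
  {e : k} {θ : M} {σ : M ≃ₐ[k] M} (hθ : IsQuadExt e θ σ) (hs2 : s.natDegree ≤ 2)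
  (hse : s.coeff 2 = e)

include hθ hs2 hse

/-- On a conic without rational points, every proper nonzero ideal is generated by each of
its nonzero elements of minimal degree. -/
theorem exists_generator (hpt : ∀ u v : k, u ^ 2 ≠ s.eval v) {𝔭 : Ideal R}
    (hbot : 𝔭 ≠ ⊥) (htop : 𝔭 ≠ ⊤) :
    ∃ (m : ℕ) (g : R), m ≠ 0 ∧ g ∈ h.filt m ∧ h.lead θ m g ≠ 0 ∧ 𝔭 = Ideal.span {g} := by
  classical
  have hex : ∃ m, ∃ g ∈ 𝔭, g ≠ 0 ∧ g ∈ h.filt m := by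
    obtain ⟨g, hg, hg0⟩ := Submodule.exists_mem_ne_zero_of_ne_bot hbot
    obtain ⟨m, hm⟩ := h.exists_mem_filt g
    exact ⟨m, g, hg, hg0, hm⟩
  obtain ⟨g, hg, hg0, hgm⟩ := Nat.find_spec hex
  have hm0 : Nat.find hex ≠ 0 := by
    intro h0
    rw [h0] at hgm
    obtain ⟨c, rfl⟩ := h.mem_filt_zero hgm
    have hc : c ≠ 0 := fun hc => hg0 (by rw [hc, map_zero])
    apply htop
    refine Ideal.eq_top_of_isUnit_mem _ hg ?_
    exact (isUnit_iff_ne_zero.2 hc).map _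
  obtain ⟨m, hm⟩ := Nat.exists_eq_succ_of_ne_zero hm0
  have hmin : ∀ u ∈ 𝔭, u ∈ h.filt m → u = 0 := by
    intro u hu hum
    by_contra hu0
    exact Nat.find_min hex (m := m) (by omega) ⟨u, hu, hu0, hum⟩
  rw [hm] at hgm
  have hlg : h.lead θ (m + 1) g ≠ 0 := fun h0 =>
    hg0 (hmin g hg (h.mem_filt_of_lead_eq_zero hθ hgm h0))
  refine ⟨m + 1, g, by omega, hgm, hlg, le_antisymm (fun u hu => ?_)
    ((Ideal.span_singleton_le_iff_mem _).2 hg)⟩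
  by_contra hug
  obtain ⟨w, hw, r, rfl⟩ := h.exists_eq_add_mul hθ hs2 hse hgm hlg u
  have hwp : w ∈ 𝔭 := by
    have := 𝔭.sub_mem hu (𝔭.mul_mem_right r hg)
    rwa [add_sub_cancel_right] at this
  have hwg : w ∉ Ideal.span {g} := fun hwg =>
    hug (add_mem hwg (Ideal.mul_mem_right _ _ (Ideal.mem_span_singleton_self g)))
  have key : ∀ v ∈ 𝔭, v ∈ h.filt (m + 1) → ∃ a b : k, v = a • g + b • w := by
    intro v hv hvm
    have hli : LinearIndependent k ![h.lead θ (m + 1) g, h.lead θ (m + 1) w] := by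
      rw [LinearIndependent.pair_iff' hlg]
      intro a ha
      apply hwg
      have h1 : w - a • g = 0 := by
        refine hmin _ (𝔭.sub_mem hwp (Submodule.smul_of_tower_mem 𝔭 a hg))
          (h.mem_filt_of_lead_eq_zero hθ (sub_mem hw (Submodule.smul_mem _ a hgm)) ?_)
        rw [map_sub, map_smul, ha, sub_self]
      rw [sub_eq_zero.1 h1]
      exact Submodule.smul_of_tower_mem _ a (Ideal.mem_span_singleton_self g)
    have hspan := hli.span_eq_top_of_card_eq_finrank (by rw [hθ.finrank_eq]; rfl)
    have h1 : h.lead θ (m + 1) v ∈ Submodule.span k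
        (Set.range ![h.lead θ (m + 1) g, h.lead θ (m + 1) w]) := hspan ▸ Submodule.mem_top
    rw [Matrix.range_cons, Matrix.range_cons, Matrix.range_empty, Set.union_empty,
      Set.singleton_union, Submodule.mem_span_pair] at h1
    obtain ⟨a, b, hab⟩ := h1
    refine ⟨a, b, sub_eq_zero.1 (hmin _ (𝔭.sub_mem hv (𝔭.add_mem
      (Submodule.smul_of_tower_mem 𝔭 a hg) (Submodule.smul_of_tower_mem 𝔭 b hwp)))
      (h.mem_filt_of_lead_eq_zero hθ (sub_mem hvm (add_mem (Submodule.smul_mem _ a hgm)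
        (Submodule.smul_mem _ b hw))) ?_))⟩
    rw [map_sub, map_add, map_smul, map_smul, hab, sub_self]
  have eig : ∀ t : R, ∃ (b : k) (r : R), t * w = b • w + g * r := by
    intro t
    obtain ⟨v, hv, r, e⟩ := h.exists_eq_add_mul hθ hs2 hse hgm hlg (t * w)
    have hvp : v ∈ 𝔭 := by
      have := 𝔭.sub_mem (𝔭.mul_mem_left t hwp) (𝔭.mul_mem_right r hg)
      rwa [e, add_sub_cancel_right] at this
    obtain ⟨a, b, rfl⟩ := key v hvp hv
    refine ⟨b, algebraMap k R a + r, ?_⟩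
    rw [e, Algebra.smul_def a]; ring
  obtain ⟨bx, rx, ex⟩ := eig x
  obtain ⟨b, ry, ey⟩ := eig y
  have hpoly : ∀ p : Polynomial k, ∃ r, Polynomial.aeval y p * w = p.eval b • w + g * r := by
    intro p
    induction p using Polynomial.induction_on' with
    | add p q hp hq =>
      obtain ⟨r, hr⟩ := hp
      obtain ⟨t, ht⟩ := hq
      exact ⟨r + t, by rw [map_add, add_mul, hr, ht, Polynomial.eval_add, add_smul]; ring⟩
    | monomial n a =>
      induction n with
      | zero => exact ⟨0, by simp [Algebra.smul_def]⟩
      | succ n ih =>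
        obtain ⟨r, hr⟩ := ih
        refine ⟨y * r + algebraMap k R (a * b ^ n) * ry, ?_⟩
        simp only [Polynomial.aeval_monomial, Polynomial.eval_monomial, Algebra.smul_def,
          map_mul, map_pow] at hr ey ⊢
        linear_combination y * hr + algebraMap k R a * algebraMap k R b ^ n * ey
  obtain ⟨r, hr⟩ := hpoly s
  apply hwg
  have hc : s.eval b - bx ^ 2 ≠ 0 := fun h0 => hpt bx b (sub_eq_zero.1 h0).symm
  have h1 : (s.eval b - bx ^ 2) • w ∈ Ideal.span {g} := by
    rw [Ideal.mem_span_singleton]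
    refine ⟨x * rx + algebraMap k R bx * rx - r, ?_⟩
    simp only [Algebra.smul_def, map_sub, map_pow] at ex hr ⊢
    linear_combination hr * (-1) + (x + algebraMap k R bx) * ex - w * h.sq_eq
  have h2 := Submodule.smul_of_tower_mem (Ideal.span {g}) (s.eval b - bx ^ 2)⁻¹ h1
  rwa [smul_smul, inv_mul_cancel₀ hc, one_smul] at h2

include h in
theorem mem_sup_sumFourSq {K : Type*} [Field K] (j : R →+* K) (hj : Function.Injective j)
    (hpt : ∀ u v : k, u ^ 2 ≠ s.eval v) (hK : ¬ ∃ u v : K, -1 = u ^ 2 + v ^ 2)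
    (hM : ∃ α β : M, -1 = α ^ 2 + β ^ 2)
    (hE : ∀ 𝔭 : Ideal R, 𝔭.IsMaximal → FiniteDimensional k (R ⧸ 𝔭) →
      ∃ α β : R ⧸ 𝔭, -1 = α ^ 2 + β ^ 2) {f : R} (hf : f ≠ 0) (t : Kˣ) (ht : (t : K) = j f) :
    t ∈ (Units.map ((j.comp (algebraMap k R) : k →+* K) : k →* K)).range ⊔ sumFourSq K := by
  have hj0 : ∀ {r : R}, r ≠ 0 → j r ≠ 0 := fun hr => (map_ne_zero_iff j hj).2 hr
  have hdom : IsDomain R := hj.isDomain j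
  obtain ⟨m, hfm, hlf⟩ := h.exists_lead_ne_zero hθ hf
  induction m using Nat.strong_induction_on generalizing f t with
  | _ m ih =>
  by_cases hu : IsUnit f
  · obtain ⟨⟨f, f', hff, hff'⟩, rfl⟩ := hu
    obtain ⟨m', hfm', hlf'⟩ := h.exists_lead_ne_zero (r := f') hθ
      (fun h0 => one_ne_zero (α := R) (by rw [← hff, h0, mul_zero]))
    have h1 : m + m' ≤ 0 := h.add_le_of_mul_mem hθ hs2 hse hfm hfm' hlf hlf' (by
      change f * f' ∈ _
      rw [hff, ← map_one (algebraMap k R)]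
      exact h.one_mem_filt 1)
    obtain rfl : m = 0 := by omega
    obtain ⟨c, hc⟩ := h.mem_filt_zero hfm
    have hc0 : c ≠ 0 := fun h0 => hf (by rw [hc, h0, map_zero])
    refine Subgroup.mem_sup_left ⟨Units.mk0 c hc0, Units.ext ?_⟩
    rw [ht, hc]
    simp
  obtain ⟨𝔭, hmax, hf𝔭⟩ := exists_max_ideal_of_mem_nonunits hu
  have hbot : 𝔭 ≠ ⊥ := fun h0 => hf (by simpa [h0] using hf𝔭)
  obtain ⟨n, g, hn, hg, hlg, h𝔭⟩ := h.exists_generator hθ hs2 hse hpt hbot hmax.ne_top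
  have hg0 : g ≠ 0 := fun h0 => hlg (by rw [h0, map_zero])
  have hdiv : ∀ u ∈ 𝔭, ∃ r, u = g * r := fun u hu => Ideal.mem_span_singleton.1 (h𝔭 ▸ hu)
  have := h.finiteDimensional_filt n
  have hMfd : FiniteDimensional k M := FiniteDimensional.of_finrank_pos (by
    rw [hθ.finrank_eq]; norm_num)
  let π : h.filt n →ₗ[k] R ⧸ 𝔭 := (Ideal.Quotient.mkₐ k 𝔭).toLinearMap ∘ₗ (h.filt n).subtype
  have hπ : ∀ z, π z = Ideal.Quotient.mk 𝔭 z := fun _ => rfl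
  have hπs : Function.Surjective π := by
    intro z
    obtain ⟨u, rfl⟩ := Ideal.Quotient.mk_surjective z
    obtain ⟨w, hw, r, rfl⟩ := h.exists_eq_add_mul hθ hs2 hse hg hlg u
    refine ⟨⟨w, hw⟩, ?_⟩
    rw [hπ, Ideal.Quotient.eq, h𝔭, Ideal.mem_span_singleton]
    exact ⟨-r, by ring⟩
  have hfd : FiniteDimensional k (R ⧸ 𝔭) := Module.Finite.of_surjective π hπs
  have hrk : finrank k (R ⧸ 𝔭) ≤ 2 * n := by
    have h1 := LinearMap.finrank_range_add_finrank_ker π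
    rw [LinearMap.range_eq_top.2 hπs, finrank_top, h.finrank_filt] at h1
    have h2 : 0 < finrank k (LinearMap.ker π) := by
      refine Submodule.one_le_finrank_iff.2 ((Submodule.ne_bot_iff _).2
        ⟨⟨g, hg⟩, ?_, fun h0 => hg0 (congrArg Subtype.val h0)⟩)
      rw [LinearMap.mem_ker, hπ, Ideal.Quotient.eq_zero_iff_mem, h𝔭]
      exact Ideal.mem_span_singleton_self g
    omega
  let := Ideal.Quotient.field 𝔭
  obtain ⟨Ψ, hΨ⟩ := exists_linearMap_sum_sq (hE 𝔭 hmax hfd) π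
  obtain ⟨Ψ', hΨ'⟩ := exists_linearMap_sum_sq hM (h.lead θ n ∘ₗ (h.filt n).subtype)
  have hker : LinearMap.ker (Ψ.prod Ψ') ≠ ⊥ := by
    apply LinearMap.ker_ne_bot_of_finrank_lt
    rw [finrank_prod, finrank_prod, finrank_prod, hθ.finrank_eq, finrank_pi_fintype]
    simp only [h.finrank_filt, Finset.sum_const, Finset.card_univ, Fintype.card_fin, smul_eq_mul]
    omega
  obtain ⟨z, hz, hz0⟩ := Submodule.exists_mem_ne_zero_of_ne_bot hker
  have hz1 := hΨ z (Prod.ext_iff.1 hz).1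
  have hz2 := hΨ' z (Prod.ext_iff.1 hz).2
  set S : R := (z 0 : R) ^ 2 + (z 1 : R) ^ 2 + (z 2 : R) ^ 2 + (z 3 : R) ^ 2 with hS
  have hS𝔭 : S ∈ 𝔭 := by
    rw [← Ideal.Quotient.eq_zero_iff_mem, hS]
    simp only [map_add, map_pow]
    exact hz1
  have hS0 : S ≠ 0 := by
    intro h0
    have h1 := congrArg j h0
    simp only [hS, map_add, map_pow, map_zero] at h1
    obtain ⟨e0, e1, e2, e3⟩ := eq_zero_of_sum_four_sq hK h1
    have hinj : ∀ {w : h.filt n}, j w = 0 → w = 0 := fun hw =>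
      Subtype.ext ((map_eq_zero_iff j hj).1 hw)
    apply hz0
    funext i
    fin_cases i
    · exact hinj e0
    · exact hinj e1
    · exact hinj e2
    · exact hinj e3
  have hSm : S ∈ h.filt (2 * n - 1) := by
    have h1 : ∀ i, (z i : R) ^ 2 ∈ h.filt (2 * n - 1 + 1) ∧
        h.lead θ (2 * n - 1 + 1) ((z i : R) ^ 2) = h.lead θ n (z i) ^ 2 := by
      intro i
      have h1 := h.mul_mem_filt hθ hs2 hse (z i).2 (z i).2
      rw [← sq, ← sq] at h1
      rwa [show 2 * n - 1 + 1 = n + n by omega]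
    refine h.mem_filt_of_lead_eq_zero hθ (add_mem (add_mem (add_mem (h1 0).1 (h1 1).1) (h1 2).1)
      (h1 3).1) ?_
    rw [hS, map_add, map_add, map_add, (h1 0).2, (h1 1).2, (h1 2).2, (h1 3).2]
    exact hz2
  obtain ⟨r, hr⟩ := hdiv S hS𝔭
  obtain ⟨q, hq⟩ := hdiv f hf𝔭
  have hr0 : r ≠ 0 := fun h0 => hS0 (by rw [hr, h0, mul_zero])
  have hq0 : q ≠ 0 := fun h0 => hf (by rw [hq, h0, mul_zero])
  obtain ⟨dr, hdr, hlr⟩ := h.exists_lead_ne_zero hθ hr0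
  obtain ⟨dq, hdq, hlq⟩ := h.exists_lead_ne_zero hθ hq0
  have hdr' := h.add_le_of_mul_mem hθ hs2 hse hg hdr hlg hlr (hr ▸ hSm)
  have hdq' := h.add_le_of_mul_mem hθ hs2 hse hg hdq hlg hlq (hq ▸ hfm)
  have Hr := ih dr (by omega) hr0 (Units.mk0 _ (hj0 hr0)) rfl hdr hlr
  have Hq := ih dq (by omega) hq0 (Units.mk0 _ (hj0 hq0)) rfl hdq hlq
  have HS : Units.mk0 _ (hj0 hS0) ∈ sumFourSq K := ⟨j (z 0), j (z 1), j (z 2), j (z 3), by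
    simp [hS]⟩
  have e1 : t = Units.mk0 _ (hj0 hS0) / Units.mk0 _ (hj0 hr0) * Units.mk0 _ (hj0 hq0) := by
    ext
    have := hj0 hr0
    rw [ht, hq, Units.val_mul, Units.val_div_eq_div_val, Units.val_mk0, Units.val_mk0, Units.val_mk0,
      hr, map_mul, map_mul]
    field_simp
  rw [e1]
  exact mul_mem (div_mem (Subgroup.mem_sup_right HS) Hr) Hq

end IsConicCoord

section ConicIndex

variable {k : Type*} [Field k] [NumberField k] [IsTotallyComplex k]

theorem level_le_two_of_neg_algebra {c : k} (hc0 : c ≠ 0) (d : 𝓞 k)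
    (hcd : c = 1 + 8 * algebraMap (𝓞 k) k d) {E : Type*} [Field E] [Algebra k E]
    [FiniteDimensional k E] {X Y : E} (hXY : -algebraMap k E c = X ^ 2 + Y ^ 2) :
    ∃ x y : E, -1 = x ^ 2 + y ^ 2 := by
  have : CharZero E := charZero_of_injective_algebraMap (algebraMap k E).injective
  have : FiniteDimensional ℚ E := FiniteDimensional.trans ℚ k E
  have : NumberField E := { }
  have : IsTotallyComplex E := isTotallyComplex_of_algebra k E
  refine level_le_two_of_neg (c := algebraMap k E c) (by simpa using hc0)
    (algebraMap (𝓞 k) (𝓞 E) d) ?_ hXY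
  rw [hcd, map_add, map_mul, map_one, map_ofNat]
  rfl

variable {b : k}

theorem conicS_natDegree_le : (conicS b (-1)).natDegree ≤ 2 := by
  rw [conicS]
  compute_degree

theorem conicS_coeff_two : (conicS b (-1)).coeff 2 = b⁻¹ := by
  simp [conicS, Polynomial.coeff_one]

theorem conicS_eval (v : k) : (conicS b (-1)).eval v = b⁻¹ * (1 + v ^ 2) := by
  simp [conicS]

theorem sumFourSq_index_ne_zero_of_conic (h2 : ¬ ∃ x y : k, -1 = x ^ 2 + y ^ 2) {c : k}
    (hc0 : c ≠ 0) (d : 𝓞 k) (hcd : c = 1 + 8 * algebraMap (𝓞 k) k d)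
    (hnc : ¬ ∃ x y : k, -c = x ^ 2 + y ^ 2) {K : Type*} [Field K] {ι : k →+* K}
    (hK : IsConicFunctionField k (-c) (-1) K ι) (hlev : ¬ ∃ x y : K, -1 = x ^ 2 + y ^ 2) :
    (sumFourSq K).index ≠ 0 := by
  obtain ⟨j, hj, hjι, hfrac⟩ := hK
  have hb0 : -c ≠ 0 := neg_ne_zero.2 hc0
  have hcoord := isConicCoord_conicRing (b := (-1 : k)) hb0
  have hsq : ¬ IsSquare (-c)⁻¹ := by
    rintro ⟨w, hw⟩
    refine hnc ⟨w⁻¹, 0, ?_⟩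
    rw [← inv_inv (-c), hw]
    ring
  obtain ⟨M, _, _, _, θ, σ, hθ⟩ := exists_isQuadExt hsq
  have hpt : ∀ u v : k, u ^ 2 ≠ (conicS (-c) (-1)).eval v := by
    intro u v huv
    rw [conicS_eval] at huv
    have h1 : -c * u ^ 2 = 1 + v ^ 2 := by
      rw [huv, mul_inv_cancel_left₀ hb0]
    by_cases hu : u = 0
    · exact h2 ⟨v, 0, by rw [hu] at h1; linear_combination h1⟩
    · refine hnc ⟨1 / u, v / u, ?_⟩
      field_simp
      linear_combination h1
  have hM : ∃ α β : M, -1 = α ^ 2 + β ^ 2 := by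
    have : FiniteDimensional k M := FiniteDimensional.of_finrank_pos (by
      rw [hθ.finrank_eq]; norm_num)
    refine level_le_two_of_neg_algebra (E := M) hc0 d hcd (X := 1 / θ) (Y := 0) ?_
    have h1 := hθ.sq
    have hr := hθ.r_ne_zero
    rw [map_inv₀, map_neg] at h1
    rw [div_pow, h1]
    simp
  have hE : ∀ 𝔭 : Ideal (ConicRing k (-c) (-1)), 𝔭.IsMaximal →
      FiniteDimensional k (ConicRing k (-c) (-1) ⧸ 𝔭) →
      ∃ α β : ConicRing k (-c) (-1) ⧸ 𝔭, -1 = α ^ 2 + β ^ 2 := by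
    intro 𝔭 hmax hfd
    let := Ideal.Quotient.field 𝔭
    have h1 := congrArg (Ideal.Quotient.mk 𝔭) (conicRing_rel (a := -c) (b := (-1 : k)))
    simp only [map_add, map_mul, map_pow, map_one, map_neg] at h1
    set X := Ideal.Quotient.mk 𝔭 (Ideal.Quotient.mk _ (MvPolynomial.X 0)) with hX
    set Y := Ideal.Quotient.mk 𝔭 (Ideal.Quotient.mk _ (MvPolynomial.X 1)) with hY
    by_cases hX0 : X = 0
    · exact ⟨Y, 0, by rw [hX0] at h1; linear_combination h1⟩
    · refine level_le_two_of_neg_algebra (E := ConicRing k (-c) (-1) ⧸ 𝔭) hc0 d hcd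
        (X := 1 / X) (Y := Y / X) ?_
      field_simp
      linear_combination h1
  have htop : (Units.map (ι : k →* K)).range ⊔ sumFourSq K = ⊤ := by
    rw [eq_top_iff]
    intro t _
    obtain ⟨p, q, hq, hpq⟩ := hfrac t
    have hp : j p ≠ 0 := fun h0 => t.ne_zero (by rw [hpq, h0, zero_div])
    have key : ∀ (r) (hr : j r ≠ 0), Units.mk0 _ hr ∈ (Units.map (ι : k →* K)).range ⊔ sumFourSq K := by
      intro r hr
      have := hcoord.mem_sup_sumFourSq hθ conicS_natDegree_le conicS_coeff_two j hj hpt hlev hM hE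
        (f := r) (fun h0 => hr (by rw [h0, map_zero])) (Units.mk0 _ hr) rfl
      rwa [hjι] at this
    have e : t = Units.mk0 _ hp / Units.mk0 _ hq := by
      ext; simp [hpq]
    rw [e]
    exact div_mem (key p hp) (key q hq)
  have h1 : (sumFourSq K).index = (sumFourSq K).relIndex (Units.map (ι : k →* K)).range := by
    rw [← Subgroup.relIndex_sup_right, htop, Subgroup.relIndex_top_right]
  have h3 : (sumFourSq K).relIndex (Units.map (ι : k →* K)).range =
      ((sumFourSq K).comap (Units.map (ι : k →* K))).index := by
    rw [Subgroup.index_comap]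
  rw [h1, h3]
  intro h0
  have h4 := Subgroup.index_dvd_of_le (H := sumFourSq k)
    (K := (sumFourSq K).comap (Units.map (ι : k →* K))) (fun x hx => map_mem_sumFourSq ι hx)
  rw [h0, zero_dvd_iff] at h4
  exact sumFourSq_index_ne_zero k h2 h4

end ConicIndex

section RatFunc

variable {k : Type*} [Field k] [CharZero k]

theorem Polynomial.eq_zero_of_sum_four_sq (h2 : ¬ ∃ x y : k, -1 = x ^ 2 + y ^ 2)
    {a b c d : Polynomial k} (h : a ^ 2 + b ^ 2 + c ^ 2 + d ^ 2 = 0) :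
    a = 0 ∧ b = 0 ∧ c = 0 ∧ d = 0 := by
  have key : ∀ x : k, a.eval x = 0 ∧ b.eval x = 0 ∧ c.eval x = 0 ∧ d.eval x = 0 := fun x => by
    have := congrArg (Polynomial.eval x) h
    simp only [Polynomial.eval_add, Polynomial.eval_pow, Polynomial.eval_zero] at this
    exact _root_.eq_zero_of_sum_four_sq h2 this
  exact ⟨Polynomial.funext fun x => by simpa using (key x).1,
    Polynomial.funext fun x => by simpa using (key x).2.1,
    Polynomial.funext fun x => by simpa using (key x).2.2.1,
    Polynomial.funext fun x => by simpa using (key x).2.2.2⟩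

theorem RatFunc.exists_common_denom (u : Fin 4 → RatFunc k) :
    ∃ (r : Polynomial k) (p : Fin 4 → Polynomial k), r ≠ 0 ∧
      ∀ i, algebraMap _ (RatFunc k) (p i) = algebraMap _ (RatFunc k) r * u i := by
  obtain ⟨r, hr⟩ := IsLocalization.exist_integer_multiples_of_finite
    (nonZeroDivisors (Polynomial k)) u
  choose p hp using hr
  exact ⟨r, p, nonZeroDivisors.ne_zero r.2, fun i => by rw [hp i, Algebra.smul_def]⟩

theorem RatFunc.not_exists_neg_one_eq (h2 : ¬ ∃ x y : k, -1 = x ^ 2 + y ^ 2) :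
    ¬ ∃ x y : RatFunc k, -1 = x ^ 2 + y ^ 2 := by
  rintro ⟨x, y, h⟩
  obtain ⟨r, p, hr, hp⟩ := RatFunc.exists_common_denom ![x, y, 0, 0]
  have h0 := hp 0
  have h1 := hp 1
  simp only [Matrix.cons_val_zero, Matrix.cons_val_one] at h0 h1
  have h3 : p 0 ^ 2 + p 1 ^ 2 + r ^ 2 + 0 ^ 2 = 0 := by
    apply IsFractionRing.injective (Polynomial k) (RatFunc k)
    simp only [map_add, map_pow, map_zero, h0, h1]
    linear_combination -(algebraMap _ (RatFunc k) r ^ 2) * h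
  exact hr (Polynomial.eq_zero_of_sum_four_sq h2 h3).2.2.1

theorem Polynomial.eq_zero_of_mul_sq_eq_sum_four_sq (h2 : ¬ ∃ x y : k, -1 = x ^ 2 + y ^ 2)
    {a a' : k} (haa : a ≠ a') (n : ℕ) {r : Polynomial k} (hn : r.natDegree ≤ n)
    {p : Fin 4 → Polynomial k}
    (h : (Polynomial.X - Polynomial.C a) * (Polynomial.X - Polynomial.C a') * r ^ 2 =
      p 0 ^ 2 + p 1 ^ 2 + p 2 ^ 2 + p 3 ^ 2) : r = 0 := by
  induction n using Nat.strong_induction_on generalizing r p with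
  | _ n ih =>
  by_contra hr
  have h1 := congrArg (Polynomial.eval a) h
  simp only [Polynomial.eval_add, Polynomial.eval_pow, Polynomial.eval_mul, Polynomial.eval_sub,
    Polynomial.eval_X, Polynomial.eval_C, sub_self, zero_mul] at h1
  obtain ⟨e0, e1, e2, e3⟩ := _root_.eq_zero_of_sum_four_sq h2 h1.symm
  have hp : ∀ i, (p i).eval a = 0 := by
    intro i; fin_cases i
    exacts [e0, e1, e2, e3]
  choose q hq using fun i => Polynomial.dvd_iff_isRoot.2 (hp i)
  have hX : (Polynomial.X - Polynomial.C a : Polynomial k) ≠ 0 := Polynomial.X_sub_C_ne_zero a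
  have h3 : (Polynomial.X - Polynomial.C a') * r ^ 2 = (Polynomial.X - Polynomial.C a) *
      (q 0 ^ 2 + q 1 ^ 2 + q 2 ^ 2 + q 3 ^ 2) := by
    apply mul_left_cancel₀ hX
    rw [hq 0, hq 1, hq 2, hq 3] at h
    linear_combination h
  have h4 := congrArg (Polynomial.eval a) h3
  simp only [Polynomial.eval_pow, Polynomial.eval_mul, Polynomial.eval_sub,
    Polynomial.eval_X, Polynomial.eval_C, sub_self, zero_mul, mul_eq_zero, sub_eq_zero, haa,
    false_or, pow_eq_zero_iff two_ne_zero] at h4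
  obtain ⟨s, rfl⟩ := Polynomial.dvd_iff_isRoot.2 h4
  have hs : s ≠ 0 := fun h0 => hr (by rw [h0, mul_zero])
  rw [Polynomial.natDegree_mul hX hs, Polynomial.natDegree_X_sub_C] at hn
  refine hs (ih (n - 1) (by omega) (r := s) (p := q) (by omega) ?_)
  apply mul_left_cancel₀ hX
  linear_combination h3

theorem sumFourSq_ratFunc_index (h2 : ¬ ∃ x y : k, -1 = x ^ 2 + y ^ 2) :
    (sumFourSq (RatFunc k)).index = 0 := by
  by_contra hne
  have : (sumFourSq (RatFunc k)).FiniteIndex := ⟨hne⟩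
  have hlin : ∀ n : ℕ, algebraMap _ (RatFunc k) (Polynomial.X - Polynomial.C (n : k)) ≠ 0 := fun n =>
    (map_ne_zero_iff _ (IsFractionRing.injective _ _)).2 (Polynomial.X_sub_C_ne_zero _)
  let f : ℕ → (RatFunc k)ˣ ⧸ sumFourSq (RatFunc k) := fun n =>
    QuotientGroup.mk (Units.mk0 _ (hlin n))
  obtain ⟨m, n, hmn, hf⟩ := Finite.exists_ne_map_eq_of_infinite f
  obtain ⟨a, b, c, d, h⟩ := QuotientGroup.eq.1 hf
  obtain ⟨r, p, hr, hp⟩ := RatFunc.exists_common_denom ![a, b, c, d]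
  have h0 := hp 0
  have h1 := hp 1
  have h3 := hp 2
  have h4 := hp 3
  simp only [Matrix.cons_val] at h0 h1 h3 h4
  apply hr
  set A : Polynomial k := Polynomial.X - Polynomial.C (m : k) with hA
  have hA0 : A ≠ 0 := Polynomial.X_sub_C_ne_zero _
  refine Polynomial.eq_zero_of_mul_sq_eq_sum_four_sq (a := (m : k)) (a' := (n : k)) h2
    (by exact_mod_cast hmn) _ le_rfl (p := fun i => A * p i) ?_
  apply IsFractionRing.injective (Polynomial k) (RatFunc k)
  simp only [map_add, map_pow, map_mul, h0, h1, h3, h4]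
  rw [Units.val_mul, Units.val_inv_eq_inv_val, Units.val_mk0, Units.val_mk0,
    inv_mul_eq_iff_eq_mul₀ (hlin m)] at h
  rw [h]
  ring

end RatFunc

section ConicOneOne

variable {k : Type*} [Field k] [CharZero k]

theorem nonempty_ratFunc_equiv {L : Type*} [Field L] {ι : k →+* L}
    (hL : IsConicFunctionField k 1 1 L ι) : Nonempty (RatFunc k ≃+* L) := by
  obtain ⟨j, hj, hjι, hfrac⟩ := hL
  let := ι.toAlgebra
  have hcoord := isConicCoord_conicRing (a := (1 : k)) (b := 1) one_ne_zero
  have : CharZero L := charZero_of_injective_algebraMap ι.injective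
  set x₀ : ConicRing k 1 1 := Ideal.Quotient.mk _ (MvPolynomial.X 0) with hx₀
  set y₀ : ConicRing k 1 1 := Ideal.Quotient.mk _ (MvPolynomial.X 1) with hy₀
  have hjc : ∀ c : k, j (algebraMap k _ c) = algebraMap k L c := fun c => RingHom.congr_fun hjι c
  have hy : Transcendental k (j y₀) := by
    rw [transcendental_iff]
    intro p hp
    have h1 : j (Polynomial.aeval y₀ p) = 0 := by
      rw [← hp, Polynomial.aeval_def, Polynomial.aeval_def, Polynomial.hom_eval₂, hjι]
      rfl
    have h2 : conicMap y₀ y₀ (p, 0) = 0 := by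
      rw [conicMap_apply, map_zero, zero_mul, add_zero]
      exact (map_eq_zero_iff j hj).1 h1
    have h3 : conicMap x₀ y₀ (p, 0) = 0 := by
      rw [← h2]; simp
    exact (Prod.ext_iff.1 (hcoord.bij.1 (h3.trans (map_zero _).symm))).1
  have hrel : j x₀ ^ 2 + j y₀ ^ 2 = 1 := by
    have := congrArg j (conicRing_rel (a := (1 : k)) (b := 1))
    simpa using this
  have hx1 : 1 + j x₀ ≠ 0 := by
    intro h0
    have h1 : j y₀ ^ 2 = 0 := by linear_combination hrel + (1 - j x₀) * h0
    apply hy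
    rw [pow_eq_zero_iff two_ne_zero] at h1
    rw [h1]
    exact isAlgebraic_zero
  set t : L := j y₀ / (1 + j x₀) with ht
  have ht1 : 1 + t ^ 2 = 2 / (1 + j x₀) := by
    rw [ht]; field_simp; linear_combination hrel
  have ht0 : 1 + t ^ 2 ≠ 0 := by
    rw [ht1]; exact div_ne_zero two_ne_zero hx1
  have hyt : j y₀ = 2 * t / (1 + t ^ 2) := by
    rw [ht1, ht]; field_simp
  have hxt : j x₀ = (1 - t ^ 2) / (1 + t ^ 2) := by
    have : 1 - t ^ 2 = 2 - (1 + t ^ 2) := by ring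
    rw [this, ht1]; field_simp; ring
  have htt : Transcendental k t := by
    intro halg
    apply hy
    rw [hyt]
    have h2 : IsAlgebraic k (t ^ 2) := halg.pow 2
    have h3 : IsAlgebraic k (1 + t ^ 2) := isAlgebraic_one.add h2
    have h4 : IsAlgebraic k (2 : L) := by
      have := isAlgebraic_algebraMap (R := k) (A := L) (2 : k)
      rwa [map_ofNat] at this
    rw [div_eq_mul_inv]
    exact (h4.mul halg).mul h3.inv
  let φ : Polynomial k →+* L := (Polynomial.aeval t : Polynomial k →ₐ[k] L).toRingHom
  have hφ : nonZeroDivisors (Polynomial k) ≤ (nonZeroDivisors L).comap φ := by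
    intro p hp
    rw [Submonoid.mem_comap, mem_nonZeroDivisors_iff_ne_zero]
    intro h0
    exact nonZeroDivisors.ne_zero hp ((transcendental_iff.1 htt) p h0)
  let χ : RatFunc k →+* L := RatFunc.liftRingHom φ hφ
  have hχ : ∀ p : Polynomial k, χ (algebraMap _ _ p) = Polynomial.aeval t p := by
    intro p
    have h1 := RatFunc.liftRingHom_apply_div φ hφ p 1
    rwa [map_one, map_one, div_one, div_one] at h1
  refine ⟨RingEquiv.ofBijective χ ⟨χ.injective, fun z => ?_⟩⟩
  have hr : ∀ p, j p ∈ χ.fieldRange := by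
    intro p
    obtain ⟨P, rfl⟩ := Ideal.Quotient.mk_surjective p
    have htr : t ∈ χ.fieldRange := ⟨algebraMap _ _ Polynomial.X, by rw [hχ, Polynomial.aeval_X]⟩
    have h2r : (2 : L) ∈ χ.fieldRange := ⟨2, map_ofNat χ 2⟩
    induction P using MvPolynomial.induction_on with
    | C c =>
      refine ⟨algebraMap _ _ (Polynomial.C c), ?_⟩
      rw [hχ, Polynomial.aeval_C, ← hjc]
      rfl
    | add P Q hP hQ =>
      rw [map_add, map_add]; exact add_mem hP hQ
    | mul_X P i hP =>
      rw [map_mul, map_mul]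
      refine mul_mem hP ?_
      fin_cases i
      · change j x₀ ∈ _
        rw [hxt]
        exact div_mem (sub_mem (one_mem _) (pow_mem htr 2)) (add_mem (one_mem _) (pow_mem htr 2))
      · change j y₀ ∈ _
        rw [hyt]
        exact div_mem (mul_mem h2r htr) (add_mem (one_mem _) (pow_mem htr 2))
  obtain ⟨p, q, hq, rfl⟩ := hfrac z
  exact div_mem (hr p) (hr q)

end ConicOneOne

section SumThreeSq

variable {k : Type*} [Field k] [CharZero k]

/-- If `c` is the common value of two orthogonal vectors in `k³`, it is a sum of two squares. -/
theorem exists_sum_two_sq_of_orthogonal (h2 : ¬ ∃ x y : k, -1 = x ^ 2 + y ^ 2) {c : k} (hc : c ≠ 0)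
    {a b : Fin 3 → k} (ha : a 0 ^ 2 + a 1 ^ 2 + a 2 ^ 2 = c)
    (hb : b 0 ^ 2 + b 1 ^ 2 + b 2 ^ 2 = c) (hab : a 0 * b 0 + a 1 * b 1 + a 2 * b 2 = 0) :
    ∃ x y : k, c = x ^ 2 + y ^ 2 := by
  obtain ⟨n₀, h₀⟩ : ∃ n, n = (a 1 * b 2 - a 2 * b 1) / c := ⟨_, rfl⟩
  obtain ⟨n₁, h₁⟩ : ∃ n, n = (a 2 * b 0 - a 0 * b 2) / c := ⟨_, rfl⟩
  obtain ⟨n₂, h₂⟩ : ∃ n, n = (a 0 * b 1 - a 1 * b 0) / c := ⟨_, rfl⟩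
  have hn : n₀ ^ 2 + n₁ ^ 2 + n₂ ^ 2 = 1 := by
    rw [h₀, h₁, h₂]
    field_simp
    linear_combination (b 0 ^ 2 + b 1 ^ 2 + b 2 ^ 2) * ha + c * hb -
      (a 0 * b 0 + a 1 * b 1 + a 2 * b 2) * hab
  have hna : a 0 * n₀ + a 1 * n₁ + a 2 * n₂ = 0 := by
    rw [h₀, h₁, h₂]
    field_simp
    ring
  by_cases hm : 1 + n₂ = 0
  · have h3 : n₀ ^ 2 + n₁ ^ 2 + 0 ^ 2 + 0 ^ 2 = 0 := by
      linear_combination hn + (1 - n₂) * hm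
    obtain ⟨e0, e1, -⟩ := eq_zero_of_sum_four_sq h2 h3
    refine ⟨a 0, a 1, ?_⟩
    have h4 : a 2 = 0 := by
      rw [e0, e1] at hna
      linear_combination a 2 * hm - hna
    rw [← ha, h4]; ring
  · refine ⟨a 0 - a 2 * n₀ / (1 + n₂), a 1 - a 2 * n₁ / (1 + n₂), ?_⟩
    field_simp
    linear_combination (-(1 + n₂) ^ 2) * ha + 2 * (1 + n₂) * a 2 * hna - a 2 ^ 2 * hn

theorem Polynomial.natDegree_le_of_sum_three_sq (h2 : ¬ ∃ x y : k, -1 = x ^ 2 + y ^ 2)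
    {G : Fin 3 → Polynomial k} {n : ℕ} (h : (G 0 ^ 2 + G 1 ^ 2 + G 2 ^ 2).natDegree ≤ 2 * n) (i : Fin 3) :
    (G i).natDegree ≤ n := by
  have key : ∀ N, (∀ i, (G i).natDegree ≤ n + N) → ∀ i, (G i).natDegree ≤ n := by
    intro N
    induction N with
    | zero => exact fun h => h
    | succ N ih =>
      intro hN
      apply ih
      have hc : ∀ i, (G i ^ 2).coeff (2 * (n + N + 1)) = (G i).coeff (n + N + 1) ^ 2 := by
        intro i
        rw [two_mul, sq, sq]
        exact Polynomial.coeff_mul_add_eq_of_natDegree_le (hN i) (hN i)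
      have h3 := Polynomial.coeff_eq_zero_of_natDegree_lt
        (lt_of_le_of_lt h (show 2 * n < 2 * (n + N + 1) by omega))
      rw [Polynomial.coeff_add, Polynomial.coeff_add, hc, hc, hc] at h3
      obtain ⟨e0, e1, e2, -⟩ := _root_.eq_zero_of_sum_four_sq h2
        (a := (G 0).coeff (n + N + 1)) (b := (G 1).coeff (n + N + 1))
        (c := (G 2).coeff (n + N + 1)) (d := 0) (by linear_combination h3)
      have he : ∀ i, (G i).coeff (n + N + 1) = 0 := by
        intro i; fin_cases i
        exacts [e0, e1, e2]
      intro i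
      refine Nat.lt_succ_iff.1 (lt_of_le_of_ne (hN i) fun h4 => ?_)
      have h5 := he i
      have h6 : (G i).natDegree = n + N + 1 := h4
      rw [← h6, Polynomial.coeff_natDegree, Polynomial.leadingCoeff_eq_zero] at h5
      rw [h5] at h6
      simp at h6
  exact key ((G 0).natDegree + (G 1).natDegree + (G 2).natDegree) (by
    intro i; fin_cases i <;> simp <;> omega) i

/-- The Cassels–Pfister theorem for sums of three squares. -/
theorem Polynomial.exists_sum_three_sq (h2 : ¬ ∃ x y : k, -1 = x ^ 2 + y ^ 2) {f : Polynomial k}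
    (n : ℕ) {Q : Polynomial k} (hQ : Q ≠ 0) (hn : Q.natDegree ≤ n) {P : Fin 3 → Polynomial k}
    (h : f * Q ^ 2 = P 0 ^ 2 + P 1 ^ 2 + P 2 ^ 2) :
    ∃ G : Fin 3 → Polynomial k, f = G 0 ^ 2 + G 1 ^ 2 + G 2 ^ 2 := by
  induction n using Nat.strong_induction_on generalizing Q P with
  | _ n ih =>
  obtain ⟨G, hG⟩ : ∃ G : Fin 3 → Polynomial k, ∀ i, G i = P i / Q := ⟨_, fun _ => rfl⟩
  obtain ⟨R, hR⟩ : ∃ R : Fin 3 → Polynomial k, ∀ i, R i = P i % Q := ⟨_, fun _ => rfl⟩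
  have hP : ∀ i, P i = Q * G i + R i := fun i => by
    rw [hG, hR, EuclideanDomain.div_add_mod]
  have hdeg : ∀ i, (R i ^ 2).degree < (Q * Q).degree := by
    intro i
    have h1 : (R i).degree < Q.degree := by rw [hR]; exact Polynomial.degree_mod_lt _ hQ
    by_cases h0 : R i = 0
    · rw [h0, zero_pow two_ne_zero, Polynomial.degree_zero]
      exact bot_lt_iff_ne_bot.2 (by simpa using hQ)
    · have h3 := Polynomial.natDegree_lt_natDegree h0 h1
      apply Polynomial.degree_lt_degree
      rw [Polynomial.natDegree_pow, Polynomial.natDegree_mul hQ hQ]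
      omega
  rw [hP 0, hP 1, hP 2] at h
  obtain ⟨N, hN⟩ : ∃ N, N = G 0 ^ 2 + G 1 ^ 2 + G 2 ^ 2 - f := ⟨_, rfl⟩
  obtain ⟨Q', hQ'⟩ : ∃ Q', Q' = -(Q * N) - 2 * (R 0 * G 0 + R 1 * G 1 + R 2 * G 2) := ⟨_, rfl⟩
  have hRQ : R 0 ^ 2 + R 1 ^ 2 + R 2 ^ 2 = Q * Q' := by
    rw [hQ', hN]; linear_combination -h
  by_cases hR0 : R 0 ^ 2 + R 1 ^ 2 + R 2 ^ 2 = 0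
  · obtain ⟨e0, e1, e2, -⟩ := Polynomial.eq_zero_of_sum_four_sq h2
      (a := R 0) (b := R 1) (c := R 2) (d := 0) (by linear_combination hR0)
    refine ⟨G, mul_right_cancel₀ (pow_ne_zero 2 hQ) ?_⟩
    rw [h, e0, e1, e2]; ring
  · have hQ0 : Q' ≠ 0 := fun h0 => hR0 (by rw [hRQ, h0, mul_zero])
    have hlt : (Q * Q').degree < (Q * Q).degree := by
      rw [← hRQ]
      exact (Polynomial.degree_add_le _ _).trans_lt (max_lt
        ((Polynomial.degree_add_le _ _).trans_lt (max_lt (hdeg 0) (hdeg 1))) (hdeg 2))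
    have hlt' := Polynomial.natDegree_lt_natDegree (mul_ne_zero hQ hQ0) hlt
    rw [Polynomial.natDegree_mul hQ hQ0, Polynomial.natDegree_mul hQ hQ] at hlt'
    refine ih Q'.natDegree (by omega) hQ0 le_rfl (P := fun i => Q' * G i + N * R i) ?_
    have e1 : Q' * N + 2 * N * (R 0 * G 0 + R 1 * G 1 + R 2 * G 2) + N ^ 2 * Q = 0 := by
      rw [hQ']; ring
    linear_combination -Q' * e1 + Q' ^ 2 * hN - N ^ 2 * hRQ

/-- If `c (1 + y²)` is a sum of three squares in `k(y)` then `c` is a sum of two squares. -/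
theorem exists_sum_two_sq_of_sum_three_sq (h2 : ¬ ∃ x y : k, -1 = x ^ 2 + y ^ 2) {c : k}
    (hc : c ≠ 0) {Q : Polynomial k} (hQ : Q ≠ 0) {P : Fin 3 → Polynomial k}
    (h : Polynomial.C c * (1 + Polynomial.X ^ 2) * Q ^ 2 = P 0 ^ 2 + P 1 ^ 2 + P 2 ^ 2) :
    ∃ x y : k, c = x ^ 2 + y ^ 2 := by
  obtain ⟨G, hG⟩ := Polynomial.exists_sum_three_sq h2 _ hQ le_rfl h
  have hdeg : ∀ i, (G i).natDegree ≤ 1 := by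
    apply Polynomial.natDegree_le_of_sum_three_sq h2
    rw [← hG]
    compute_degree
  have hlin : ∀ i (t : k), (G i).eval t = (G i).coeff 0 + (G i).coeff 1 * t := by
    intro i t
    conv_lhs => rw [Polynomial.eq_X_add_C_of_natDegree_le_one (hdeg i)]
    simp; ring
  have hev : ∀ t : k, c * (1 + t ^ 2) = ((G 0).coeff 0 + (G 0).coeff 1 * t) ^ 2 +
      ((G 1).coeff 0 + (G 1).coeff 1 * t) ^ 2 + ((G 2).coeff 0 + (G 2).coeff 1 * t) ^ 2 := by
    intro t
    have := congrArg (Polynomial.eval t) hG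
    simpa [hlin] using this
  have h0 := hev 0
  have h1 := hev 1
  have h3 := hev (-1)
  refine exists_sum_two_sq_of_orthogonal h2 hc (a := fun i => (G i).coeff 0)
    (b := fun i => (G i).coeff 1) ?_ ?_ ?_
  · linear_combination -h0
  · linear_combination h0 - (1 / 2) * h1 - (1 / 2) * h3
  · linear_combination (-1 / 4) * h1 + (1 / 4) * h3

theorem not_exists_neg_one_eq_of_conic (h2 : ¬ ∃ x y : k, -1 = x ^ 2 + y ^ 2) {c : k}
    (hc0 : c ≠ 0) (hc : ¬ ∃ x y : k, c = x ^ 2 + y ^ 2) {K : Type*} [Field K] {ι : k →+* K}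
    (hK : IsConicFunctionField k (-c) (-1) K ι) : ¬ ∃ x y : K, -1 = x ^ 2 + y ^ 2 := by
  rintro ⟨u, v, huv⟩
  obtain ⟨j, hj, -, hfrac⟩ := hK
  have hcoord := isConicCoord_conicRing (b := (-1 : k)) (neg_ne_zero.2 hc0)
  set x : ConicRing k (-c) (-1) := Ideal.Quotient.mk _ (MvPolynomial.X 0) with hx
  set y : ConicRing k (-c) (-1) := Ideal.Quotient.mk _ (MvPolynomial.X 1) with hy
  obtain ⟨p₁, q₁, hq₁, rfl⟩ := hfrac u
  obtain ⟨p₂, q₂, hq₂, rfl⟩ := hfrac v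
  have hsum : (p₁ * q₂) ^ 2 + (p₂ * q₁) ^ 2 + (q₁ * q₂) ^ 2 = 0 := by
    apply hj
    simp only [map_add, map_mul, map_pow, map_zero]
    field_simp at huv
    linear_combination -huv
  obtain ⟨A₀, B₀, e₀⟩ := hcoord.exists_rep (p₁ * q₂)
  obtain ⟨A₁, B₁, e₁⟩ := hcoord.exists_rep (p₂ * q₁)
  obtain ⟨A₂, B₂, e₂⟩ := hcoord.exists_rep (q₁ * q₂)
  set s := conicS (-c) (-1) with hs
  rw [e₀, e₁, e₂, sq, sq, sq, conicMap_mul hcoord.sq_eq, conicMap_mul hcoord.sq_eq,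
    conicMap_mul hcoord.sq_eq, ← map_add, ← map_add, map_eq_zero_iff _ hcoord.bij.1] at hsum
  have hs1 : A₀ * A₀ + B₀ * B₀ * s + (A₁ * A₁ + B₁ * B₁ * s) + (A₂ * A₂ + B₂ * B₂ * s) = 0 :=
    (Prod.ext_iff.1 hsum).1
  have hs2 : A₀ * B₀ + B₀ * A₀ + (A₁ * B₁ + B₁ * A₁) + (A₂ * B₂ + B₂ * A₂) = 0 :=
    (Prod.ext_iff.1 hsum).2
  have horth : A₀ * B₀ + A₁ * B₁ + A₂ * B₂ = 0 := by
    have h3 : (2 : Polynomial k) * (A₀ * B₀ + A₁ * B₁ + A₂ * B₂) = 0 := by linear_combination hs2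
    exact (mul_eq_zero.1 h3).resolve_left two_ne_zero
  have hcs : Polynomial.C c * s = -(1 + Polynomial.X ^ 2) := by
    have h3 : Polynomial.C c * Polynomial.C (-c)⁻¹ = (-1 : Polynomial k) := by
      rw [← Polynomial.C_mul, inv_neg, mul_neg, mul_inv_cancel₀ hc0, Polynomial.C_neg,
        Polynomial.C_1]
    rw [hs, conicS, ← mul_assoc, h3, Polynomial.C_neg, Polynomial.C_1]; ring
  have hnorm : Polynomial.C c * (A₀ ^ 2 + A₁ ^ 2 + A₂ ^ 2) =
      (B₀ ^ 2 + B₁ ^ 2 + B₂ ^ 2) * (1 + Polynomial.X ^ 2) := by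
    linear_combination Polynomial.C c * hs1 - (B₀ ^ 2 + B₁ ^ 2 + B₂ ^ 2) * hcs
  have hC : Polynomial.C c ≠ 0 := by simpa using hc0
  have hB : B₀ ^ 2 + B₁ ^ 2 + B₂ ^ 2 ≠ 0 := by
    intro h0
    obtain ⟨-, -, b2, -⟩ := Polynomial.eq_zero_of_sum_four_sq h2 (d := 0)
      (a := B₀) (b := B₁) (c := B₂) (by linear_combination h0)
    rw [h0, zero_mul] at hnorm
    obtain ⟨-, -, a2, -⟩ := Polynomial.eq_zero_of_sum_four_sq h2 (d := 0)
      (a := A₀) (b := A₁) (c := A₂) (by linear_combination (mul_eq_zero.1 hnorm).resolve_left hC)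
    have h3 : j (q₁ * q₂) = 0 := by
      rw [e₂, a2, b2]; simp
    rw [map_mul] at h3
    exact mul_ne_zero hq₁ hq₂ h3
  refine hc (exists_sum_two_sq_of_sum_three_sq h2 hc0 hB
    (P := ![Polynomial.C c * (A₁ * B₂ - A₂ * B₁), Polynomial.C c * (A₂ * B₀ - A₀ * B₂),
      Polynomial.C c * (A₀ * B₁ - A₁ * B₀)]) ?_)
  simp only [Matrix.cons_val]
  linear_combination (-Polynomial.C c * (B₀ ^ 2 + B₁ ^ 2 + B₂ ^ 2)) * hnorm +
    Polynomial.C c ^ 2 * (A₀ * B₀ + A₁ * B₁ + A₂ * B₂) * horth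

end SumThreeSq

section Transport

variable {K L : Type*} [Field K] [Field L] {α : SqClass K ≃* SqClass L}

theorem IsWittEquiv.exists_neg_one_eq_iff (h : IsWittEquiv α) :
    (∃ x y : K, -1 = x ^ 2 + y ^ 2) ↔ ∃ x y : L, -1 = x ^ 2 + y ^ 2 := by
  have h1 : α (sqCl 1) = sqCl 1 := map_one α
  simpa using h.represents 1 1 (-1) 1 1 (-1) h1 h1 h.map_neg_one

theorem IsWittEquiv.mem_sumFourSq (h : IsWittEquiv α) {c : Kˣ} {c' : Lˣ}
    (hc : α (sqCl c) = sqCl c') (hm : c ∈ sumFourSq K) : c' ∈ sumFourSq L := by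
  have h1 : α (sqCl 1) = sqCl 1 := map_one α
  have htwo : ∀ (u : Kˣ) (u' : Lˣ), α (sqCl u) = sqCl u' → (∃ x y : K, (u : K) = x ^ 2 + y ^ 2) →
      ∃ x y : L, (u' : L) = x ^ 2 + y ^ 2 := fun u u' hu hx => by
    simpa using (h.represents 1 1 u 1 1 u' h1 h1 hu).1 (by simpa using hx)
  obtain ⟨p, q, r, s, hpq⟩ := hm
  by_cases hu : p ^ 2 + q ^ 2 = 0
  · obtain ⟨x, y, hxy⟩ := htwo c c' hc ⟨r, s, by linear_combination hpq + hu⟩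
    exact ⟨x, y, 0, 0, by linear_combination hxy⟩
  by_cases hw : r ^ 2 + s ^ 2 = 0
  · obtain ⟨x, y, hxy⟩ := htwo c c' hc ⟨p, q, by linear_combination hpq + hw⟩
    exact ⟨x, y, 0, 0, by linear_combination hxy⟩
  obtain ⟨u', hu'⟩ := QuotientGroup.mk_surjective (α (sqCl (Units.mk0 _ hu)))
  obtain ⟨w', hw'⟩ := QuotientGroup.mk_surjective (α (sqCl (Units.mk0 _ hw)))
  obtain ⟨x₁, y₁, e₁⟩ := htwo _ u' hu'.symm ⟨p, q, rfl⟩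
  obtain ⟨x₂, y₂, e₂⟩ := htwo _ w' hw'.symm ⟨r, s, rfl⟩
  obtain ⟨x, y, e⟩ := (h.represents _ _ c u' w' c' hu'.symm hw'.symm hc).1
    ⟨1, 1, by simp only [Units.val_mk0]; linear_combination hpq⟩
  exact ⟨x₁ * x, y₁ * x, x₂ * y, y₂ * y, by rw [e, e₁, e₂]; ring⟩

theorem IsWittEquiv.sumFourSq_index_ne_zero (h : IsWittEquiv α) (hK : (sumFourSq K).index ≠ 0) :
    (sumFourSq L).index ≠ 0 := by
  have hle : sumFourSq K ≤ (((sumFourSq L).map (QuotientGroup.mk' (sqSubgroup L))).comap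
      α.toMonoidHom).comap (QuotientGroup.mk' (sqSubgroup K)) := by
    intro c hc
    obtain ⟨c', hc'⟩ := QuotientGroup.mk_surjective (α (sqCl c))
    exact ⟨c', h.mem_sumFourSq hc'.symm hc, hc'⟩
  have hdvd := Subgroup.index_dvd_of_le hle
  rw [Subgroup.index_comap_of_surjective _ (QuotientGroup.mk'_surjective _),
    Subgroup.index_comap_of_surjective _ α.surjective,
    ← Subgroup.index_comap_of_surjective _ (QuotientGroup.mk'_surjective (sqSubgroup L)),
    Subgroup.comap_map_eq, QuotientGroup.ker_mk', sup_eq_left.2] at hdvd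
  · exact ne_zero_of_dvd_ne_zero hK hdvd
  · rintro _ ⟨x, rfl⟩
    exact sq_mem_sumFourSq x

theorem sumFourSq_index_eq_zero_of_ringEquiv (e : K ≃+* L) (hK : (sumFourSq K).index = 0) :
    (sumFourSq L).index = 0 := by
  have hle : sumFourSq L ≤ (sumFourSq K).comap (Units.map (e.symm : L →* K)) := fun x hx =>
    map_mem_sumFourSq (e.symm : L →+* K) hx
  have hdvd := Subgroup.index_dvd_of_le hle
  have hs : Function.Surjective (Units.map (e.symm : L →* K)) :=
    (Units.mapEquiv e.symm.toMulEquiv).surjective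
  rwa [Subgroup.index_comap_of_surjective _ hs, hK, zero_dvd_iff] at hdvd

end Transport

theorem exists_neg_one_eq_of_conic {k K : Type*} [Field k] [Field K] {ι : k →+* K}
    (hK : IsConicFunctionField k (-1) (-1) K ι) : ∃ x y : K, -1 = x ^ 2 + y ^ 2 := by
  obtain ⟨j, -⟩ := hK
  have h := congrArg j (conicRing_rel (a := (-1 : k)) (b := -1))
  simp only [map_neg, map_one, map_add, map_mul, map_pow] at h
  exact ⟨j (Ideal.Quotient.mk _ (MvPolynomial.X 0)), j (Ideal.Quotient.mk _ (MvPolynomial.X 1)),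
    by linear_combination h⟩

section Choice

variable {k : Type*} [Field k] [NumberField k]

theorem NumberField.isTotallyComplex_of_isSumSq (h : IsSumSq (-1 : k)) : IsTotallyComplex k := by
  refine ⟨fun v => InfinitePlace.not_isReal_iff_isComplex.1 fun hv => ?_⟩
  have h1 : ∀ x : k, IsSumSq x → 0 ≤ InfinitePlace.embedding_of_isReal hv x := by
    intro x hx
    induction hx with
    | zero => simp
    | sq_add a _ ih =>
      rw [map_add, map_mul]
      exact add_nonneg (mul_self_nonneg _) ih
  have h3 := h1 _ h
  rw [map_neg, map_one] at h3
  linarith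

theorem exists_vord_one_add_eight_mul (q : HeightOneSpectrum (𝓞 k)) (hq : vord q (2 : k) = 0) :
    ∃ d : 𝓞 k, vord q (1 + 8 * algebraMap (𝓞 k) k d) = 1 := by
  obtain ⟨π, hπ, hπ1⟩ := exists_vord_eq_one (K := k) q
  have h8 : (8 : 𝓞 k) ∉ q.asIdeal := fun h =>
    two_notMem q hq (q.isPrime.mem_of_pow_mem 3 (by norm_num; exact h))
  have := q.isPrime.isMaximal q.ne_bot
  obtain ⟨u, w, hw, huw⟩ := Ideal.IsMaximal.exists_inv_pow q.asIdeal h8 2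
  have e : (1 : k) + 8 * algebraMap (𝓞 k) k (u * (π - 1)) =
      algebraMap (𝓞 k) k π + algebraMap (𝓞 k) k (-(w * (π - 1))) := by
    have h1 := congrArg (algebraMap (𝓞 k) k) huw
    simp only [map_add, map_mul, map_neg, map_sub, map_one, map_ofNat] at h1 ⊢
    linear_combination (algebraMap (𝓞 k) k π - 1) * h1
  refine ⟨u * (π - 1), ?_⟩
  rw [e, (vord_add_eq_left q ((map_ne_zero_iff _ (IsFractionRing.injective _ _)).2 hπ) ?_).2, hπ1]
  by_cases h0 : -(w * (π - 1)) = 0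
  · left; rw [h0, map_zero]
  · right
    have h3 := (le_vord_iff_mem (K := k) q h0 2).2 (neg_mem (Ideal.mul_mem_right _ _ hw))
    rw [hπ1]
    exact lt_of_lt_of_le (by norm_num) h3

theorem exists_not_sum_two_sq (h2 : ¬ ∃ x y : k, -1 = x ^ 2 + y ^ 2) :
    ∃ d : 𝓞 k, (1 + 8 * algebraMap (𝓞 k) k d ≠ 0) ∧
      (¬ ∃ x y : k, 1 + 8 * algebraMap (𝓞 k) k d = x ^ 2 + y ^ 2) ∧
      ¬ ∃ x y : k, -(1 + 8 * algebraMap (𝓞 k) k d) = x ^ 2 + y ^ 2 := by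
  have hsq : ¬ IsSquare (-1 : k) := fun ⟨x, hx⟩ => h2 ⟨x, 0, by rw [hx]; ring⟩
  obtain ⟨q, hqT, hq⟩ := exists_not_isSqNear hsq
    (finite_vord_ne_zero (R := 𝓞 k) (x := (2 : k)) two_ne_zero).toFinset
  have hq2 : vord q (2 : k) = 0 := by simpa using hqT
  obtain ⟨d, hd⟩ := exists_vord_one_add_eight_mul q hq2
  have key : ∀ c : k, vord q c = 1 → ¬ ∃ x y : k, c = x ^ 2 + y ^ 2 := by
    rintro c hc ⟨x, y, hxy⟩
    have hc0 : c ≠ 0 := by rintro rfl; simp at hc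
    have h1 : (-1 : k) ≠ 0 := by simp
    have h3 := tame_norm q h1 (Units.mk0 c hc0) x y (by rw [Units.val_mk0, hxy]; ring)
    rw [tame_of_even q h1 (by simp), Units.val_mk0, hc, if_neg (by simp), leg_eq_one_iff] at h3
    exact hq h3
  refine ⟨d, ?_, key _ hd, key _ (by rw [vord_neg, hd])⟩
  intro h0
  simp [h0] at hd

end Choice

/-- Let `k` be a number field which is not formally real (`−1` is a sum of squares) but in
which `−1` is not a sum of two squares.  Then there is a nonzero `b ∈ k` such that the
fields `k_{−1,−1}`, `k_{b,−1}` and `k_{1,1}` are pairwise not Witt equivalent; in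
particular there are at least three Witt-inequivalent fields of the form `k_{a,b}`. -/
theorem exists_three_conics_not_wittEquivalent
    (k : Type u) [Field k] [NumberField k]
    (hnr : IsSumSq (-1 : k))
    (h2 : ¬ ∃ x y : k, -1 = x ^ 2 + y ^ 2) :
    ∃ b : k, b ≠ 0 ∧
      ConicNotWittEquivalent k (-1) (-1) b (-1) ∧
      ConicNotWittEquivalent k (-1) (-1) 1 1 ∧
      ConicNotWittEquivalent k b (-1) 1 1 := by
  have := NumberField.isTotallyComplex_of_isSumSq hnr
  obtain ⟨d, hc0, hc, hnc⟩ := exists_not_sum_two_sq h2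
  refine ⟨-(1 + 8 * algebraMap (𝓞 k) k d), neg_ne_zero.2 hc0, ?_, ?_, ?_⟩
  · rintro K L _ _ ι ι' hK hL ⟨α, hα⟩
    exact not_exists_neg_one_eq_of_conic h2 hc0 hc hL
      (hα.exists_neg_one_eq_iff.1 (exists_neg_one_eq_of_conic hK))
  · rintro K L _ _ ι ι' hK hL ⟨α, hα⟩
    obtain ⟨e⟩ := nonempty_ratFunc_equiv hL
    obtain ⟨x, y, h⟩ := hα.exists_neg_one_eq_iff.1 (exists_neg_one_eq_of_conic hK)
    exact RatFunc.not_exists_neg_one_eq h2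
      ⟨e.symm x, e.symm y, by simpa using congrArg e.symm h⟩
  · rintro K L _ _ ι ι' hK hL ⟨α, hα⟩
    obtain ⟨e⟩ := nonempty_ratFunc_equiv hL
    exact hα.sumFourSq_index_ne_zero
      (sumFourSq_index_ne_zero_of_conic h2 hc0 d rfl hnc hK
        (not_exists_neg_one_eq_of_conic h2 hc0 hc hK))
      (sumFourSq_index_eq_zero_of_ringEquiv e (sumFourSq_ratFunc_index h2))

end
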